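/- For every ε > 0 there exists a constant C > 0 such that for all real X ≥ 2, the absolute value of the sum of (p) over all primes p ≤ X with p ≡ −1 (mod 16) is at most C·X^(149/150 + ε), where for each such prime p the symbol (p) denotes the Jacobi symbol (2u/v) for any positive integers u, v with p = u² − 2v². -/

import Mathlib

section
lemma spin_factor_bound (δ : ℝ) (hδ : 0 < δ) (p k : ℕ) (hp : 2 ≤ p) :
    ((k : ℝ) + 1) ≤ (if (p : ℝ) < 2 ^ (1 / δ) then (1 + 2 / δ) else 1) * ((p : ℝ) ^ k) ^ δ := by
  have hp' : (2 : ℝ) ≤ p := by exact_mod_cast hp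
  have e : ((p : ℝ) ^ k) ^ δ = ((p : ℝ) ^ δ) ^ k := by
    rw [← Real.rpow_natCast, ← Real.rpow_natCast, ← Real.rpow_mul (by positivity),
      ← Real.rpow_mul (by positivity), mul_comm]
  rw [e]
  split_ifs with h
  · have h1 : 1 + δ / 2 ≤ (p : ℝ) ^ δ := by
      have : (2 : ℝ) ^ δ ≤ (p : ℝ) ^ δ := Real.rpow_le_rpow (by norm_num) hp' hδ.le
      refine le_trans ?_ this
      rw [Real.rpow_def_of_pos (by norm_num)]
      have := Real.add_one_le_exp (Real.log 2 * δ)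
      have h2 := Real.log_two_gt_d9
      nlinarith
    have h2 : 1 + (k : ℝ) * (δ / 2) ≤ ((p : ℝ) ^ δ) ^ k := by
      refine le_trans ?_ (pow_le_pow_left₀ (by positivity) h1 k)
      exact one_add_mul_le_pow (by linarith) k
    have h3 : (1 + 2 / δ) * (1 + (k : ℝ) * (δ / 2)) ≤ (1 + 2 / δ) * ((p : ℝ) ^ δ) ^ k := by
      gcongr
    refine le_trans ?_ h3
    have : (1 + 2 / δ) * (1 + (k : ℝ) * (δ / 2)) = 1 + k + 2 / δ + k * (δ / 2) := by
      field_simp; ring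
    rw [this]
    have : 0 < 2 / δ := by positivity
    have : 0 ≤ (k : ℝ) * (δ / 2) := by positivity
    linarith
  · push Not at h
    have h1 : (2 : ℝ) ≤ (p : ℝ) ^ δ := by
      have : ((2 : ℝ) ^ (1 / δ)) ^ δ ≤ (p : ℝ) ^ δ := Real.rpow_le_rpow (by positivity) h hδ.le
      rwa [← Real.rpow_mul (by norm_num), one_div_mul_cancel hδ.ne', Real.rpow_one] at this
    rw [one_mul]
    refine le_trans ?_ (pow_le_pow_left₀ (by norm_num) h1 k)
    have := one_add_mul_le_pow (a := (1 : ℝ)) (by norm_num) k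
    norm_num at this ⊢
    linarith

/-- Divisor bound. -/
lemma spin_divisor_bound (δ : ℝ) (hδ : 0 < δ) :
    ∃ C : ℝ, 1 ≤ C ∧ ∀ n : ℕ, ((n.divisors.card : ℕ) : ℝ) ≤ C * (n : ℝ) ^ δ := by
  set P : ℕ := ⌈(2 : ℝ) ^ (1 / δ)⌉₊ with hP
  have hC1 : 1 ≤ 1 + 2 / δ := by have : 0 < 2 / δ := by positivity
                                 linarith
  refine ⟨(1 + 2 / δ) ^ P, one_le_pow₀ hC1, fun n => ?_⟩
  rcases eq_or_ne n 0 with rfl | hn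
  · simp; positivity
  rw [Nat.card_divisors hn]
  push_cast
  have h1 : ∏ p ∈ n.primeFactors, ((n.factorization p : ℝ) + 1) ≤
      ∏ p ∈ n.primeFactors, ((if (p : ℝ) < 2 ^ (1 / δ) then (1 + 2 / δ) else 1) *
        ((p : ℝ) ^ (n.factorization p)) ^ δ) := by
    apply Finset.prod_le_prod
    · intros; positivity
    · intro p hp
      exact spin_factor_bound δ hδ p _ (Nat.prime_of_mem_primeFactors hp).two_le
  refine h1.trans ?_
  rw [Finset.prod_mul_distrib]
  have h2 : ∏ p ∈ n.primeFactors, ((p : ℝ) ^ (n.factorization p)) ^ δ = (n : ℝ) ^ δ := by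
    rw [Real.finsetProd_rpow _ _ (fun i _ => by positivity)]
    congr 1
    conv_rhs => rw [← Nat.prod_factorization_pow_eq_self hn]
    rw [Finsupp.prod, Nat.support_factorization]
    push_cast; rfl
  rw [h2]
  gcongr
  rw [Finset.prod_ite, Finset.prod_const_one, mul_one, Finset.prod_const]
  apply pow_le_pow_right₀ hC1
  calc _ ≤ (Finset.range P).card := by
        apply Finset.card_le_card
        intro p hp
        simp only [Finset.mem_filter] at hp
        rw [Finset.mem_range]
        have := hp.2.trans_le (Nat.le_ceil _)
        exact_mod_cast this
    _ = P := by simp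
end

section
/-- Weights of the Fourier expansion of an interval. -/
noncomputable def spinKap (q : ℕ) (h : ZMod q) : ℝ :=
  if h = 0 then 1 else (1 / (h.val : ℝ) + 1 / ((q : ℝ) - h.val)) / 2

lemma spin_sin_lower (t : ℝ) (h0 : 0 ≤ t) (h1 : t ≤ 1) : 2 * t * (1 - t) ≤ Real.sin (Real.pi * t) := by
  have hpi := Real.pi_pos
  rcases le_total t (1/2) with h | h
  · have := Real.mul_le_sin (x := Real.pi * t) (by positivity) (by nlinarith)
    have e : 2 / Real.pi * (Real.pi * t) = 2 * t := by field_simp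
    rw [e] at this
    nlinarith
  · have := Real.mul_le_sin (x := Real.pi * (1 - t)) (by nlinarith) (by nlinarith)
    have e : 2 / Real.pi * (Real.pi * (1 - t)) = 2 * (1 - t) := by field_simp
    rw [e] at this
    have e2 : Real.sin (Real.pi * (1 - t)) = Real.sin (Real.pi * t) := by
      rw [← Real.sin_pi_sub]; congr 1; ring
    rw [e2] at this
    nlinarith

lemma spin_norm_psi {q : ℕ} [NeZero q] (h : ZMod q) : ‖(ZMod.stdAddChar h : ℂ)‖ = 1 := by
  exact AddChar.norm_apply _ _

lemma spin_psi_sub_one {q : ℕ} [NeZero q] (h : ZMod q) :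
    4 * ((h.val : ℝ) / q) * (1 - (h.val : ℝ) / q) ≤ ‖(ZMod.stdAddChar h : ℂ) - 1‖ := by
  have hq : (0 : ℝ) < q := by exact_mod_cast Nat.pos_of_ne_zero (NeZero.ne q)
  have e : (ZMod.stdAddChar h : ℂ) = Complex.exp (Complex.I * ((2 * Real.pi * ((h.val : ℝ) / q) : ℝ) : ℂ)) := by
    rw [ZMod.stdAddChar_apply, ZMod.toCircle_apply]
    congr 1
    push_cast
    ring
  rw [e, Complex.norm_exp_I_mul_ofReal_sub_one]
  have hlt : (h.val : ℝ) ≤ q := by exact_mod_cast (ZMod.val_lt h).le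
  have := spin_sin_lower ((h.val : ℝ) / q) (by positivity) ((div_le_one hq).2 hlt)
  have e2 : 2 * Real.pi * ((h.val : ℝ) / q) / 2 = Real.pi * ((h.val : ℝ) / q) := by ring
  rw [e2]
  calc _ = 2 * (2 * ((h.val : ℝ) / q) * (1 - (h.val : ℝ) / q)) := by ring
    _ ≤ 2 * Real.sin (Real.pi * ((h.val : ℝ) / q)) := by linarith
    _ ≤ _ := by exact Real.le_norm_self _

lemma spinKap_nonneg {q : ℕ} [NeZero q] (h : ZMod q) : 0 ≤ spinKap q h := by
  unfold spinKap
  split_ifs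
  · norm_num
  · have : (h.val : ℝ) ≤ q := by exact_mod_cast (ZMod.val_lt h).le
    have : 0 ≤ (q : ℝ) - h.val := by linarith
    positivity

lemma spin_geom {q : ℕ} [NeZero q] (h : ZMod q) (hh : h ≠ 0) (L : ℕ) :
    ‖∑ j ∈ Finset.range L, (ZMod.stdAddChar h : ℂ) ^ j‖ ≤ q * spinKap q h := by
  have hq : (0 : ℝ) < q := by exact_mod_cast Nat.pos_of_ne_zero (NeZero.ne q)
  have hv : (0 : ℝ) < h.val := by
    have : h.val ≠ 0 := by simpa using hh
    exact_mod_cast Nat.pos_of_ne_zero this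
  have hlt : (0 : ℝ) < q - h.val := by
    have : (h.val : ℝ) < q := by exact_mod_cast (ZMod.val_lt h)
    linarith
  have h1 := spin_psi_sub_one h
  have hpos : 0 < 4 * ((h.val : ℝ) / q) * (1 - (h.val : ℝ) / q) := by
    have : (1 - (h.val : ℝ) / q) = (q - h.val) / q := by field_simp
    rw [this]; positivity
  have hne : (ZMod.stdAddChar h : ℂ) ≠ 1 := by
    intro h2; rw [h2, sub_self, norm_zero] at h1; linarith
  rw [geom_sum_eq hne, norm_div]
  have h3 : ‖(ZMod.stdAddChar h : ℂ) ^ L - 1‖ ≤ 2 := by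
    refine (norm_sub_le _ _).trans ?_
    rw [norm_pow, spin_norm_psi]; norm_num
  calc _ ≤ 2 / (4 * ((h.val : ℝ) / q) * (1 - (h.val : ℝ) / q)) := by gcongr
    _ = q * spinKap q h := by
      rw [spinKap, if_neg hh]
      have : (1 - (h.val : ℝ) / q) = (q - h.val) / q := by field_simp
      rw [this]
      field_simp
      ring

lemma spin_interval_sum {q : ℕ} [NeZero q] (h : ZMod q) (s : ZMod q) (L : ℕ) (hL : h ≠ 0 ∨ L ≤ q) :
    ‖∑ j ∈ Finset.range L, (ZMod.stdAddChar (-(h * (s + (j : ZMod q)))) : ℂ)‖ ≤ q * spinKap q h := by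
  by_cases hh : h = 0
  · subst hh
    have : L ≤ q := by tauto
    simp [spinKap]
    exact_mod_cast this
  · have e : ∀ j : ℕ, (ZMod.stdAddChar (-(h * (s + (j : ZMod q)))) : ℂ) =
        (starRingEnd ℂ) ((ZMod.stdAddChar (h * s) : ℂ) * (ZMod.stdAddChar h : ℂ) ^ j) := by
      intro j
      rw [← AddChar.map_nsmul_eq_pow, ← AddChar.map_add_eq_mul, ← AddChar.map_neg_eq_conj]
      congr 2
      simp; ring
    simp_rw [e]
    rw [← map_sum, RCLike.norm_conj, ← Finset.mul_sum, norm_mul, spin_norm_psi, one_mul]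
    exact spin_geom h hh L

lemma spin_sum_range_zmod {q : ℕ} [NeZero q] {α : Type*} [AddCommMonoid α] (f : ℕ → α) :
    ∑ h : ZMod q, f h.val = ∑ j ∈ Finset.range q, f j := by
  obtain ⟨n, rfl⟩ : ∃ n, q = n + 1 := ⟨q - 1, by have := Nat.pos_of_ne_zero (NeZero.ne q); omega⟩
  exact Fin.sum_univ_eq_sum_range f (n + 1)

lemma spin_harmonic_le (n : ℕ) : ∑ j ∈ Finset.range n, (1 / ((j : ℝ) + 1)) ≤ 1 + Real.log n := by
  have := harmonic_le_one_add_log n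
  rw [harmonic] at this
  push_cast at this
  simpa [one_div] using this

lemma spinKap_sum (q : ℕ) [NeZero q] : ∑ h : ZMod q, spinKap q h ≤ 2 + Real.log q := by
  have hq : 0 < q := Nat.pos_of_ne_zero (NeZero.ne q)
  have e : ∀ h : ZMod q, spinKap q h =
    (fun j : ℕ => if j = 0 then (1:ℝ) else (1 / (j : ℝ) + 1 / ((q : ℝ) - j)) / 2) h.val := by
    intro h; simp [spinKap]
  rw [Finset.sum_congr rfl (fun h _ => e h), spin_sum_range_zmod (q := q)
    (fun j : ℕ => if j = 0 then (1:ℝ) else (1 / (j : ℝ) + 1 / ((q : ℝ) - j)) / 2)]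
  obtain ⟨n, rfl⟩ : ∃ n, q = n + 1 := ⟨q - 1, by omega⟩
  rw [Finset.sum_range_succ']
  simp only [Nat.add_eq_zero_iff, one_ne_zero, and_false, if_false, if_true]
  rw [← Finset.sum_div, Finset.sum_add_distrib]
  have r : ∑ i ∈ Finset.range n, 1 / (((n + 1 : ℕ) : ℝ) - ((i + 1 : ℕ) : ℝ)) =
      ∑ i ∈ Finset.range n, 1 / ((i : ℝ) + 1) := by
    rw [← Finset.sum_range_reflect]
    apply Finset.sum_congr rfl
    intro i hi
    rw [Finset.mem_range] at hi
    congr 1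
    have h5 : n - 1 - i + 1 = n - i := by omega
    rw [h5, Nat.cast_sub (by omega)]
    push_cast; ring
  rw [r]
  have h1 := spin_harmonic_le n
  have h2 : Real.log n ≤ Real.log ((n + 1 : ℕ) : ℝ) := by
    rcases Nat.eq_zero_or_pos n with rfl | hn
    · simp
    · apply Real.log_le_log (by exact_mod_cast hn); push_cast; linarith
  push_cast at *
  linarith

/-- separation of the condition `k < t`. -/
lemma spin_separate (H : ℕ) [NeZero H] (t : ℕ) : ∃ c : ZMod H → ℂ, (∀ h, ‖c h‖ ≤ spinKap H h) ∧
    ∀ k : ℕ, k < H → (if k < t then (1 : ℂ) else 0) =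
      ∑ h : ZMod H, c h * (ZMod.stdAddChar (h * (k : ZMod H)) : ℂ) := by
  have hH : (0 : ℝ) < H := by exact_mod_cast Nat.pos_of_ne_zero (NeZero.ne H)
  refine ⟨fun h => (1 / (H : ℂ)) * ∑ j ∈ Finset.range (min t H),
    (ZMod.stdAddChar (-(h * (0 + (j : ZMod H)))) : ℂ), fun h => ?_, fun k hk => ?_⟩
  · rw [norm_mul]
    have := spin_interval_sum h 0 (min t H) (Or.inr (min_le_right _ _))
    have e : ‖(1 / (H : ℂ))‖ = 1 / H := by simp
    rw [e]
    calc _ ≤ 1 / (H : ℝ) * (H * spinKap H h) := by gcongr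
      _ = _ := by field_simp
  · have hHc : (H : ℂ) ≠ 0 := by exact_mod_cast hH.ne'
    have : ∀ h : ZMod H, (1 / (H : ℂ)) * (∑ j ∈ Finset.range (min t H),
      (ZMod.stdAddChar (-(h * (0 + (j : ZMod H)))) : ℂ)) * (ZMod.stdAddChar (h * (k : ZMod H)) : ℂ)
      = (1 / (H : ℂ)) * ∑ j ∈ Finset.range (min t H), (ZMod.stdAddChar (h * ((k : ZMod H) - (j : ZMod H))) : ℂ) := by
      intro h
      rw [mul_assoc, Finset.sum_mul]
      congr 1
      apply Finset.sum_congr rfl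
      intro j _
      rw [← AddChar.map_add_eq_mul]
      congr 1; ring
    simp_rw [this]
    rw [← Finset.mul_sum, Finset.sum_comm]
    have h2 : ∀ j ∈ Finset.range (min t H), ∑ h : ZMod H, (ZMod.stdAddChar (h * ((k : ZMod H) - (j : ZMod H))) : ℂ)
        = if j = k then (H : ℂ) else 0 := by
      intro j hj
      rw [Finset.mem_range] at hj
      rw [AddChar.sum_mulShift _ (ZMod.isPrimitive_stdAddChar H)]
      have : ((k : ZMod H) - (j : ZMod H) = 0) ↔ j = k := by
        rw [sub_eq_zero, ZMod.natCast_eq_natCast_iff', Nat.mod_eq_of_lt hk,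
          Nat.mod_eq_of_lt (by omega)]
        exact eq_comm
      simp [this, ZMod.card]
    rw [Finset.sum_congr rfl h2]
    rw [Finset.sum_ite_eq']
    by_cases hkt : k < t
    · have : k ∈ Finset.range (min t H) := by simp; omega
      rw [if_pos hkt, if_pos this]; field_simp
    · have : k ∉ Finset.range (min t H) := by simp; omega
      rw [if_neg hkt, if_neg this]; simp
end

section
open NumberTheorySymbols in
lemma spin_exists_nonres (q : ℕ) (hq : Odd q) (hs : ¬ IsSquare q) : ∃ t : ℤ, jacobiSym t q = -1 := by
  have hq0 : q ≠ 0 := by rintro rfl; simp at hq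
  obtain ⟨a, b, hab, ha⟩ := Nat.sq_mul_squarefree q
  have ha1 : a ≠ 1 := by
    rintro rfl
    exact hs ⟨b, by rw [← hab]; ring⟩
  obtain ⟨p, hp, hpa⟩ := Nat.exists_prime_and_dvd ha1
  have ha0 : a ≠ 0 := ha.ne_zero
  have hb0 : b ≠ 0 := by rintro rfl; simp at hab; exact hq0 hab.symm
  have hf : q.factorization p = 2 * b.factorization p + 1 := by
    rw [← hab, Nat.factorization_mul (pow_ne_zero _ hb0) ha0, Nat.factorization_pow]
    have : a.factorization p = 1 := by
      have h1 := ha.natFactorization_le_one p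
      have h2 := (hp.dvd_iff_one_le_factorization ha0).1 hpa
      omega
    simp [this]
  set e := q.factorization p with he
  have hpm := Nat.ordProj_mul_ordCompl_eq_self q p
  have hnd := Nat.not_dvd_ordCompl hp hq0
  set m := q / p ^ q.factorization p with hm
  rw [← he] at hpm
  have hp2 : p ≠ 2 := by
    rintro rfl
    have : 2 ∣ q := by rw [← hpm, hf]; exact Dvd.dvd.mul_right (dvd_pow_self _ (by omega)) _
    rw [Nat.odd_iff] at hq; omega
  have hm0 : m ≠ 0 := by rintro h; rw [h] at hpm; simp at hpm; exact hq0 hpm.symm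
  have : Fact p.Prime := ⟨hp⟩
  obtain ⟨n, hn⟩ := FiniteField.exists_nonsquare (F := ZMod p) (by rwa [ZMod.ringChar_zmod_n])
  have hcop : Nat.Coprime p m := (Nat.Prime.coprime_iff_not_dvd hp).2 hnd
  obtain ⟨t, ht1, ht2⟩ := Nat.chineseRemainder hcop n.val 1
  refine ⟨t, ?_⟩
  rw [← hpm, jacobiSym.mul_right' _ (pow_ne_zero _ hp.ne_zero) hm0, jacobiSym.pow_right]
  have h1 : jacobiSym t p = -1 := by
    rw [ZMod.nonsquare_iff_jacobiSym_eq_neg_one]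
    have : ((t : ℤ) : ZMod p) = n := by
      rw [Int.cast_natCast, (ZMod.natCast_eq_natCast_iff _ _ _).2 ht1]; simp
    rwa [this]
  have h2 : jacobiSym t m = 1 := by
    rw [← jacobiSym.one_left m]
    apply jacobiSym.mod_left'
    have := (Int.natCast_modEq_iff).2 ht2
    exact this
  rw [h1, h2, hf, mul_one]
  rw [pow_succ, pow_mul]; norm_num

/-- Jacobi symbol on `ZMod v`. -/
noncomputable def spinJ (v : ℕ) (u : ZMod v) : ℂ := ((jacobiSym (u.val : ℤ) v : ℤ) : ℂ)

lemma spin_jacobi_abs_le (a : ℤ) (b : ℕ) : |jacobiSym a b| ≤ 1 := by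
  rcases jacobiSym.trichotomy a b with h | h | h <;> rw [h] <;> norm_num

lemma spin_jacobi_norm_le (a : ℤ) (b : ℕ) : ‖((jacobiSym a b : ℤ) : ℂ)‖ ≤ 1 := by
  rcases jacobiSym.trichotomy a b with h | h | h <;> rw [h] <;> norm_num

lemma spinJ_norm (v : ℕ) (u : ZMod v) : ‖spinJ v u‖ ≤ 1 := spin_jacobi_norm_le _ _

lemma spinJ_intCast (v : ℕ) [NeZero v] (n : ℤ) : spinJ v (n : ZMod v) = ((jacobiSym n v : ℤ) : ℂ) := by
  unfold spinJ
  congr 1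
  rw [ZMod.val_intCast]
  exact (jacobiSym.mod_left n v).symm

lemma spinJ_mul (v : ℕ) [NeZero v] (a b : ZMod v) : spinJ v (a * b) = spinJ v a * spinJ v b := by
  have h := spinJ_intCast v ((a.val : ℤ) * b.val)
  have e : (((a.val : ℤ) * b.val : ℤ) : ZMod v) = a * b := by push_cast; simp
  rw [e] at h
  rw [h, jacobiSym.mul_left]
  unfold spinJ; push_cast; rfl

/-- Gauss sums. -/
noncomputable def spinG (v : ℕ) [NeZero v] (h : ZMod v) : ℂ :=
  ∑ u : ZMod v, spinJ v u * (ZMod.stdAddChar (h * u) : ℂ)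

lemma spinJ_sum (v : ℕ) [NeZero v] (hv : Odd v) (hs : ¬ IsSquare v) : ∑ u : ZMod v, spinJ v u = 0 := by
  obtain ⟨t, ht⟩ := spin_exists_nonres v hv hs
  have hu : IsUnit (t : ZMod v) := by
    rw [ZMod.coe_int_isUnit_iff_isCoprime]
    by_contra h
    have := (jacobiSym.eq_zero_iff_not_coprime (a := t) (b := v)).2 (by
      rw [Int.isCoprime_iff_gcd_eq_one] at h
      rwa [Int.gcd_comm])
    rw [this] at ht; norm_num at ht
  obtain ⟨T, hT⟩ := hu
  have h1 : ∑ u : ZMod v, spinJ v ((T : ZMod v) * u) = ∑ u : ZMod v, spinJ v u :=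
    Equiv.sum_comp (Units.mulLeft T) (fun u => spinJ v u)
  have h2 : spinJ v (T : ZMod v) = -1 := by rw [hT, spinJ_intCast, ht]; norm_num
  simp_rw [spinJ_mul, h2] at h1
  rw [← Finset.mul_sum] at h1
  linear_combination (-1/2 : ℂ) * h1

lemma spinG_unit (v : ℕ) [NeZero v] (T : (ZMod v)ˣ) (h : ZMod v) :
    ‖spinG v h‖ ≤ ‖spinG v (T * h)‖ := by
  have h1 : ∑ u : ZMod v, spinJ v ((T : ZMod v) * u) * (ZMod.stdAddChar (h * ((T : ZMod v) * u)) : ℂ)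
     = spinG v h :=
    Equiv.sum_comp (Units.mulLeft T) (fun u => spinJ v u * (ZMod.stdAddChar (h * u) : ℂ))
  rw [← h1]
  have : ∀ u : ZMod v, spinJ v ((T : ZMod v) * u) * (ZMod.stdAddChar (h * ((T : ZMod v) * u)) : ℂ)
      = spinJ v T * (spinJ v u * (ZMod.stdAddChar ((T : ZMod v) * h * u) : ℂ)) := by
    intro u
    have e : h * ((T : ZMod v) * u) = (T : ZMod v) * h * u := by ring
    rw [spinJ_mul, mul_assoc, e]
  simp_rw [this]
  rw [← Finset.mul_sum, norm_mul]
  have := spinJ_norm v T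
  calc _ ≤ 1 * ‖spinG v (T * h)‖ := by unfold spinG; gcongr
    _ = _ := one_mul _

lemma spinG_parseval (v : ℕ) [NeZero v] : ∑ h : ZMod v, ‖spinG v h‖ ^ 2 ≤ (v : ℝ) ^ 2 := by
  have key : ∑ h : ZMod v, ((‖spinG v h‖ ^ 2 : ℝ) : ℂ) =
      (v : ℂ) * ∑ u : ZMod v, ((‖spinJ v u‖ ^ 2 : ℝ) : ℂ) := by
    have e : ∀ h : ZMod v, ((‖spinG v h‖ ^ 2 : ℝ) : ℂ) = ∑ u : ZMod v, ∑ w : ZMod v,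
        spinJ v u * (starRingEnd ℂ) (spinJ v w) * (ZMod.stdAddChar (h * (u - w)) : ℂ) := by
      intro h
      rw [Complex.ofReal_pow, ← Complex.mul_conj']
      unfold spinG
      rw [map_sum, Finset.sum_mul_sum]
      apply Finset.sum_congr rfl; intro u _
      apply Finset.sum_congr rfl; intro w _
      rw [map_mul (starRingEnd ℂ), ← AddChar.map_neg_eq_conj]
      have : (ZMod.stdAddChar (h * (u - w)) : ℂ) = ZMod.stdAddChar (h * u) * ZMod.stdAddChar (-(h * w)) := by
        rw [← AddChar.map_add_eq_mul]; congr 1; ring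
      rw [this]; ring
    simp_rw [e]
    rw [Finset.sum_comm, Finset.mul_sum]
    apply Finset.sum_congr rfl; intro u _
    rw [Finset.sum_comm]
    have : ∀ w : ZMod v, ∑ h : ZMod v, spinJ v u * (starRingEnd ℂ) (spinJ v w) * (ZMod.stdAddChar (h * (u - w)) : ℂ)
        = if w = u then (v : ℂ) * (spinJ v u * (starRingEnd ℂ) (spinJ v w)) else 0 := by
      intro w
      rw [← Finset.mul_sum, AddChar.sum_mulShift _ (ZMod.isPrimitive_stdAddChar v)]
      by_cases hw : w = u
      · simp [hw, ZMod.card]; ring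
      · have : u - w ≠ 0 := fun h => hw (sub_eq_zero.1 h).symm
        simp [hw, this]
    simp_rw [this]
    rw [Finset.sum_ite_eq']
    simp only [Finset.mem_univ, if_true]
    rw [Complex.mul_conj']; push_cast; ring
  have key2 : ∑ h : ZMod v, ‖spinG v h‖ ^ 2 = (v : ℝ) * ∑ u : ZMod v, ‖spinJ v u‖ ^ 2 := by
    exact_mod_cast key
  rw [key2, sq]
  gcongr
  calc _ ≤ ∑ u : ZMod v, (1 : ℝ) := by
        apply Finset.sum_le_sum; intro u _
        exact pow_le_one₀ (norm_nonneg _) (spinJ_norm v u)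
    _ = v := by simp [ZMod.card]

lemma spin_totient_divisors (v : ℕ) : v ≤ v.divisors.card * v.totient := by
  rcases Nat.eq_zero_or_pos v with rfl | hv
  · simp
  conv_lhs => rw [← Nat.sum_totient v]
  rw [← smul_eq_mul]
  apply Finset.sum_le_card_nsmul
  intro d hd
  exact Nat.le_of_dvd (Nat.totient_pos.2 hv) (Nat.totient_dvd_of_dvd (Nat.dvd_of_mem_divisors hd))

lemma spin_fiber (v : ℕ) [NeZero v] (h c : ZMod v) :
    (Finset.univ.filter (fun T : (ZMod v)ˣ => (T : ZMod v) * h = c)).card ≤ Nat.gcd h.val v := by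
  classical
  have hv : 0 < v := Nat.pos_of_ne_zero (NeZero.ne v)
  rcases (Finset.univ.filter (fun T : (ZMod v)ˣ => (T : ZMod v) * h = c)).eq_empty_or_nonempty with he | ⟨T0, hT0⟩
  · rw [he]; simp
  have hg : 0 < Nat.gcd h.val v := Nat.gcd_pos_of_pos_right _ hv
  refine le_trans ?_ (IsAddCyclic.card_nsmul_eq_zero_le (α := ZMod v) hg)
  apply Finset.card_le_card_of_injOn (fun T : (ZMod v)ˣ => (T : ZMod v) - (T0 : ZMod v))
  · intro T hT
    simp only [Finset.coe_filter, Finset.mem_univ, true_and, Set.mem_ofPred_eq] at hT ⊢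
    simp only [Finset.mem_filter, Finset.mem_univ, true_and] at hT0
    have h0 : ((T : ZMod v) - T0) * h = 0 := by rw [sub_mul, hT, hT0, sub_self]
    rw [nsmul_eq_mul]
    have hb := Nat.gcd_eq_gcd_ab h.val v
    have : ((Nat.gcd h.val v : ℕ) : ZMod v) = h * ((Nat.gcdA h.val v : ℤ) : ZMod v) := by
      have := congrArg (fun z : ℤ => (z : ZMod v)) hb
      simpa using this
    rw [this]
    calc _ = (((T : ZMod v) - T0) * h) * ((Nat.gcdA h.val v : ℤ) : ZMod v) := by ring
      _ = 0 := by rw [h0, zero_mul]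
  · intro T _ T' _ hTT
    simp only [sub_left_inj] at hTT
    exact Units.ext hTT

lemma spinG_bound (v : ℕ) [NeZero v] (h : ZMod v) :
    ‖spinG v h‖ ^ 2 ≤ (v : ℝ) * v.divisors.card * (Nat.gcd h.val v : ℝ) := by
  classical
  have hv : 0 < v := Nat.pos_of_ne_zero (NeZero.ne v)
  have h1 : (v.totient : ℝ) * ‖spinG v h‖ ^ 2 ≤ (Nat.gcd h.val v : ℝ) * (v : ℝ) ^ 2 := by
    calc (v.totient : ℝ) * ‖spinG v h‖ ^ 2 = ∑ T : (ZMod v)ˣ, ‖spinG v h‖ ^ 2 := by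
          rw [Finset.sum_const, Finset.card_univ, ZMod.card_units_eq_totient, nsmul_eq_mul]
      _ ≤ ∑ T : (ZMod v)ˣ, ‖spinG v (T * h)‖ ^ 2 := by
          apply Finset.sum_le_sum; intro T _
          have := spinG_unit v T h
          gcongr
      _ = ∑ c : ZMod v, ∑ T ∈ Finset.univ.filter (fun T : (ZMod v)ˣ => (T : ZMod v) * h = c),
            ‖spinG v (T * h)‖ ^ 2 := by
          rw [Finset.sum_fiberwise]
      _ ≤ ∑ c : ZMod v, (Nat.gcd h.val v : ℝ) * ‖spinG v c‖ ^ 2 := by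
          apply Finset.sum_le_sum; intro c _
          have : ∀ T ∈ Finset.univ.filter (fun T : (ZMod v)ˣ => (T : ZMod v) * h = c),
            ‖spinG v (T * h)‖ ^ 2 = ‖spinG v c‖ ^ 2 := by
            intro T hT; rw [(Finset.mem_filter.1 hT).2]
          rw [Finset.sum_congr rfl this, Finset.sum_const, nsmul_eq_mul]
          have := spin_fiber v h c
          gcongr
      _ ≤ _ := by
          rw [← Finset.mul_sum]
          have := spinG_parseval v
          gcongr
  have h2 : (v : ℝ) ≤ v.divisors.card * v.totient := by exact_mod_cast spin_totient_divisors v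
  have ht : (0 : ℝ) < v.totient := by exact_mod_cast Nat.totient_pos.2 hv
  have hv' : (0 : ℝ) < v := by exact_mod_cast hv
  refine le_of_mul_le_mul_left (h1.trans ?_) ht
  calc (Nat.gcd h.val v : ℝ) * (v : ℝ) ^ 2 = (Nat.gcd h.val v : ℝ) * v * v := by ring
    _ ≤ (Nat.gcd h.val v : ℝ) * v * (v.divisors.card * v.totient) := by gcongr
    _ = _ := by ring

lemma spin_gcd_sum (v : ℕ) (hv : 0 < v) :
    ∑ j ∈ Finset.range (v - 1), ((Nat.gcd (j + 1) v : ℝ) / ((j : ℝ) + 1)) ≤ v.divisors.card * (1 + Real.log v) := by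
  have h1 : ∀ j ∈ Finset.range (v - 1), ((Nat.gcd (j + 1) v : ℝ) / ((j : ℝ) + 1)) ≤
      ∑ g ∈ v.divisors, if g ∣ j + 1 then (1 / (((j + 1) / g : ℕ) : ℝ)) else 0 := by
    intro j hj
    have hg : Nat.gcd (j + 1) v ∈ v.divisors := Nat.mem_divisors.2 ⟨Nat.gcd_dvd_right _ _, hv.ne'⟩
    refine le_trans ?_ (Finset.single_le_sum (fun g _ => ?_) hg)
    · rw [if_pos (Nat.gcd_dvd_left _ _), Nat.cast_div (Nat.gcd_dvd_left _ _)
        (by exact_mod_cast (Nat.gcd_pos_of_pos_left _ (Nat.succ_pos j)).ne')]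
      push_cast
      rw [one_div_div]
    · split_ifs
      · positivity
      · exact le_rfl
  refine (Finset.sum_le_sum h1).trans ?_
  rw [Finset.sum_comm, ← nsmul_eq_mul]
  apply Finset.sum_le_card_nsmul
  intro g hg
  have hg0 : 0 < g := Nat.pos_of_mem_divisors hg
  refine le_trans ?_ (spin_harmonic_le v)
  rw [← Finset.sum_filter]
  have e : ∀ i ∈ Finset.range v, 1 / ((i : ℝ) + 1) = (fun k : ℕ => 1 / (k : ℝ)) (i + 1) := by
    intro i _; push_cast; rfl
  rw [Finset.sum_congr rfl e, ← Finset.sum_image (s := Finset.range v) (g := fun i => i + 1) (f := fun k : ℕ => 1 / (k : ℝ)) (by intro a _ b _ h; simpa using h)]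
  rw [← Finset.sum_image (f := fun k : ℕ => 1 / (k : ℝ)) (g := fun j => (j + 1) / g)]
  · apply Finset.sum_le_sum_of_subset_of_nonneg
    · intro k hk
      simp only [Finset.mem_image, Finset.mem_filter, Finset.mem_range] at hk ⊢
      obtain ⟨j, ⟨hj, hgj⟩, rfl⟩ := hk
      have h3 : 0 < (j + 1) / g := Nat.div_pos (Nat.le_of_dvd (Nat.succ_pos _) hgj) hg0
      have h4 : (j + 1) / g ≤ j + 1 := Nat.div_le_self _ _
      exact ⟨(j + 1) / g - 1, by omega, by omega⟩
    · intros; positivity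
  · intro a ha b hb hab
    simp only [Finset.coe_filter, Set.mem_ofPred_eq] at ha hb
    simp only at hab
    have h1 := Nat.div_mul_cancel ha.2
    have h2 := Nat.div_mul_cancel hb.2
    rw [hab] at h1
    omega

lemma spin_kap_gcd (v : ℕ) [NeZero v] :
    ∑ h ∈ Finset.univ.filter (fun h : ZMod v => h ≠ 0), spinKap v h * (Nat.gcd h.val v : ℝ) ≤
      v.divisors.card * (1 + Real.log v) := by
  have hv : 0 < v := Nat.pos_of_ne_zero (NeZero.ne v)
  refine le_trans (le_of_eq ?_) (spin_gcd_sum v hv)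
  rw [Finset.sum_filter]
  have e : ∀ h : ZMod v, (if h ≠ 0 then spinKap v h * (Nat.gcd h.val v : ℝ) else 0) =
    (fun j : ℕ => if j = 0 then (0:ℝ) else (1 / (j : ℝ) + 1 / ((v : ℝ) - j)) / 2 * (Nat.gcd j v : ℝ)) h.val := by
    intro h
    by_cases hh : h = 0
    · simp [hh]
    · simp [spinKap, hh]
  rw [Finset.sum_congr rfl (fun h _ => e h), spin_sum_range_zmod (q := v)
    (fun j : ℕ => if j = 0 then (0:ℝ) else (1 / (j : ℝ) + 1 / ((v : ℝ) - j)) / 2 * (Nat.gcd j v : ℝ))]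
  obtain ⟨n, rfl⟩ : ∃ n, v = n + 1 := ⟨v - 1, by omega⟩
  rw [Finset.sum_range_succ']
  simp only [Nat.add_eq_zero_iff, one_ne_zero, and_false, if_false, if_true, add_zero, Nat.add_sub_cancel]
  have r : ∑ i ∈ Finset.range n, 1 / (((n + 1 : ℕ) : ℝ) - ((i + 1 : ℕ) : ℝ)) * (Nat.gcd (i + 1) (n + 1) : ℝ) =
      ∑ i ∈ Finset.range n, (Nat.gcd (i + 1) (n + 1) : ℝ) / ((i : ℝ) + 1) := by
    rw [← Finset.sum_range_reflect]
    apply Finset.sum_congr rfl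
    intro i hi
    rw [Finset.mem_range] at hi
    have h5 : n - 1 - i + 1 = n - i := by omega
    have h6 : Nat.gcd (n - i) (n + 1) = Nat.gcd (i + 1) (n + 1) := by
      have : n - i = (n + 1) - (i + 1) := by omega
      rw [this, Nat.gcd_self_sub_left (by omega)]
    rw [h5, h6, Nat.cast_sub (by omega)]
    push_cast
    have h7 : (n : ℝ) + 1 - ((n : ℝ) - i) = i + 1 := by ring
    rw [h7]; ring
  have : ∀ i ∈ Finset.range n, (1 / ((i + 1 : ℕ) : ℝ) + 1 / (((n + 1 : ℕ) : ℝ) - ((i + 1 : ℕ) : ℝ))) / 2 * (Nat.gcd (i + 1) (n + 1) : ℝ)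
      = ((Nat.gcd (i + 1) (n + 1) : ℝ) / ((i : ℝ) + 1)) / 2 +
        (1 / (((n + 1 : ℕ) : ℝ) - ((i + 1 : ℕ) : ℝ)) * (Nat.gcd (i + 1) (n + 1) : ℝ)) / 2 := by
    intro i _; push_cast; ring
  rw [Finset.sum_congr rfl this, Finset.sum_add_distrib, ← Finset.sum_div, ← Finset.sum_div, r]
  ring

/-- A Pólya–Vinogradov type inequality. -/
lemma spin_polya (v : ℕ) (hv : Odd v) (hs : ¬ IsSquare v) (s : ℤ) (L : ℕ) :
    |((∑ j ∈ Finset.range L, jacobiSym (s + j) v : ℤ) : ℝ)| ≤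
      Real.sqrt (v * v.divisors.card) * (v.divisors.card * (1 + Real.log v)) := by
  have hv0 : v ≠ 0 := by rintro rfl; simp at hv
  have : NeZero v := ⟨hv0⟩
  have hvp : (0 : ℝ) < v := by exact_mod_cast Nat.pos_of_ne_zero hv0
  have hvc : (v : ℂ) ≠ 0 := by exact_mod_cast hv0
  have e1 : |((∑ j ∈ Finset.range L, jacobiSym (s + j) v : ℤ) : ℝ)| =
      ‖∑ j ∈ Finset.range L, spinJ v ((s : ZMod v) + (j : ZMod v))‖ := by
    rw [← Real.norm_eq_abs, ← Complex.norm_real]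
    congr 1
    push_cast
    apply Finset.sum_congr rfl
    intro j _
    have := spinJ_intCast v (s + j)
    push_cast at this
    rw [this]
  have e2 : ∀ x : ZMod v, spinJ v x = (1 / (v : ℂ)) * ∑ h : ZMod v, spinG v h * (ZMod.stdAddChar (-(h * x)) : ℂ) := by
    intro x
    unfold spinG
    have : ∀ h : ZMod v, (∑ u : ZMod v, spinJ v u * (ZMod.stdAddChar (h * u) : ℂ)) * (ZMod.stdAddChar (-(h * x)) : ℂ)
        = ∑ u : ZMod v, spinJ v u * (ZMod.stdAddChar (h * (u - x)) : ℂ) := by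
      intro h
      rw [Finset.sum_mul]
      apply Finset.sum_congr rfl; intro u _
      rw [mul_assoc, ← AddChar.map_add_eq_mul]; congr 2; ring
    simp_rw [this]
    rw [Finset.sum_comm]
    have : ∀ u : ZMod v, ∑ h : ZMod v, spinJ v u * (ZMod.stdAddChar (h * (u - x)) : ℂ) = if u = x then v * spinJ v u else 0 := by
      intro u
      rw [← Finset.mul_sum, AddChar.sum_mulShift _ (ZMod.isPrimitive_stdAddChar v)]
      by_cases hw : u = x
      · simp [hw, ZMod.card]; ring
      · have : u - x ≠ 0 := fun h => hw (sub_eq_zero.1 h)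
        simp [hw, this]
    simp_rw [this]
    rw [Finset.sum_ite_eq']
    simp only [Finset.mem_univ, if_true]
    field_simp
  rw [e1]
  have e3 : ∑ j ∈ Finset.range L, spinJ v ((s : ZMod v) + (j : ZMod v)) =
      (1 / (v : ℂ)) * ∑ h : ZMod v, spinG v h * ∑ j ∈ Finset.range L, (ZMod.stdAddChar (-(h * ((s : ZMod v) + (j : ZMod v)))) : ℂ) := by
    simp_rw [e2 _]
    rw [← Finset.mul_sum, Finset.sum_comm]
    simp_rw [← Finset.mul_sum]
  rw [e3, norm_mul]
  have e4 : ‖(1 / (v : ℂ))‖ = 1 / v := by simp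
  rw [e4]
  have hG0 : spinG v 0 = 0 := by
    unfold spinG
    simpa using spinJ_sum v hv hs
  have h5 : ‖∑ h : ZMod v, spinG v h * ∑ j ∈ Finset.range L, (ZMod.stdAddChar (-(h * ((s : ZMod v) + (j : ZMod v)))) : ℂ)‖ ≤
      ∑ h ∈ Finset.univ.filter (fun h : ZMod v => h ≠ 0), (Real.sqrt (v * v.divisors.card) * v) * (spinKap v h * (Nat.gcd h.val v : ℝ)) := by
    rw [Finset.sum_filter]
    refine (norm_sum_le _ _).trans (Finset.sum_le_sum fun h _ => ?_)
    by_cases hh : h = 0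
    · simp [hh, hG0]
    · rw [if_pos hh, norm_mul]
      have h6 := spin_interval_sum h (s : ZMod v) L (Or.inl hh)
      have hgpos : (1 : ℝ) ≤ (Nat.gcd h.val v : ℝ) := by
        exact_mod_cast Nat.gcd_pos_of_pos_right _ (Nat.pos_of_ne_zero hv0)
      have h7 : ‖spinG v h‖ ≤ Real.sqrt (v * v.divisors.card) * (Nat.gcd h.val v : ℝ) := by
        apply le_of_sq_le_sq _ (by positivity)
        rw [mul_pow, Real.sq_sqrt (by positivity)]
        refine (spinG_bound v h).trans ?_
        gcongr
        nlinarith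
      have h8 := spinKap_nonneg h
      calc _ ≤ (Real.sqrt (v * v.divisors.card) * (Nat.gcd h.val v : ℝ)) * (v * spinKap v h) := by gcongr
        _ = _ := by ring
  rw [← Finset.mul_sum] at h5
  have h9 := spin_kap_gcd v
  calc _ ≤ 1 / (v : ℝ) * ((Real.sqrt (v * v.divisors.card) * v) * (v.divisors.card * (1 + Real.log v))) := by
        gcongr
        exact h5.trans (by gcongr)
    _ = _ := by field_simp
end

section
/-- The fundamental domain. -/
def spinD (w : ℤ√2) : Prop := 0 < w.re ∧ 0 ≤ w.im ∧ 3 * w.im < 2 * w.re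

instance (w : ℤ√2) : Decidable (spinD w) := by unfold spinD; infer_instance

lemma spin_norm (w : ℤ√2) : w.norm = w.re ^ 2 - 2 * w.im ^ 2 := by
  rw [Zsqrtd.norm_def]; ring

lemma spinD_re_sq {w : ℤ√2} (h : spinD w) : w.re ^ 2 < 9 * w.norm := by
  obtain ⟨h1, h2, h3⟩ := h
  rw [spin_norm]; nlinarith

lemma spinD_norm_pos {w : ℤ√2} (h : spinD w) : 0 < w.norm := by
  have := spinD_re_sq h
  nlinarith [sq_nonneg w.re]

lemma spinD_im_sq {w : ℤ√2} (h : spinD w) : w.im ^ 2 < 4 * w.norm := by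
  obtain ⟨h1, h2, h3⟩ := h
  rw [spin_norm]; nlinarith

lemma spin_reduce_aux (n : ℕ) : ∀ w : ℤ√2, w.re.toNat ≤ n → 0 < w.re → 0 < w.norm →
    ∃ e : ℤ√2, e.norm = 1 ∧ 0 < e.re ∧ spinD (e * w) := by
  induction n with
  | zero => intro w h1 h2; omega
  | succ n ih =>
    intro w h1 h2 h3
    have h3' := h3
    rw [spin_norm] at h3
    by_cases hD : spinD w
    · exact ⟨1, by simp [Zsqrtd.norm_def], by simp, by simpa using hD⟩
    have step : ∀ g : ℤ√2, g.norm = 1 → 0 < (g * w).re → (g * w).re < w.re →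
        (∀ e : ℤ√2, e.norm = 1 → 0 < e.re → 0 < (e * g).re) →
        ∃ e : ℤ√2, e.norm = 1 ∧ 0 < e.re ∧ spinD (e * w) := by
      intro g hg hp hl hpos
      obtain ⟨e, he1, he2, he3⟩ := ih (g * w) (by omega) hp (by rw [Zsqrtd.norm_mul, hg, one_mul]; exact h3')
      exact ⟨e * g, by rw [Zsqrtd.norm_mul, he1, hg]; rfl, hpos e he1 he2, by rwa [mul_assoc]⟩
    by_cases hb : w.im < 0
    · by_cases h23 : 0 ≤ 2 * w.re + 3 * w.im
      · refine ⟨⟨3, 2⟩, by simp [Zsqrtd.norm_def], by simp, ?_⟩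
        refine ⟨?_, ?_, ?_⟩ <;> simp <;> nlinarith
      · apply step ⟨3, 2⟩ (by simp [Zsqrtd.norm_def])
        · simp; nlinarith
        · simp; nlinarith
        · intro e he1 he2
          rw [spin_norm] at he1
          simp
          nlinarith
    · have h23 : 2 * w.re ≤ 3 * w.im := by
        by_contra hc
        exact hD ⟨h2, by omega, by omega⟩
      apply step ⟨3, -2⟩ (by simp [Zsqrtd.norm_def])
      · simp; nlinarith
      · simp; nlinarith
      · intro e he1 he2
        rw [spin_norm] at he1
        simp
        nlinarith

lemma spin_reduce (w : ℤ√2) (h : 0 < w.re) (h' : 0 < w.norm) :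
    ∃ e : ℤ√2, e.norm = 1 ∧ 0 < e.re ∧ spinD (e * w) := spin_reduce_aux _ w le_rfl h h'

lemma spin_unit_aux {e w : ℤ√2} (he : e.norm = 1) (hp : 0 < e.re) (hw : spinD w) (hew : spinD (e * w)) :
    e.im ≤ 0 := by
  by_contra hc
  push Not at hc
  obtain ⟨h1, h2, h3⟩ := hw
  obtain ⟨h4, h5, h6⟩ := hew
  rw [spin_norm] at he
  simp at h4 h5 h6
  have ht : 2 ≤ e.im := by
    by_contra h
    have : e.im = 1 := by omega
    rw [this] at he
    have : e.re < 2 := by nlinarith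
    have : e.re = 1 := by omega
    rw [this] at he; norm_num at he
  have a1 : 2 * e.re ≤ 3 * e.im := by nlinarith
  have a2 : 4 * e.im ≤ 3 * e.re := by nlinarith
  nlinarith [mul_nonneg (sub_nonneg.2 a1) h1.le, mul_nonneg (sub_nonneg.2 a2) h2]

lemma spin_unit_unique {e w : ℤ√2} (he : e.norm = 1) (hp : 0 < e.re) (hw : spinD w) (hew : spinD (e * w)) :
    e = 1 := by
  have h1 := spin_unit_aux he hp hw hew
  have h2 : (star e) * (e * w) = w := by
    rw [← mul_assoc, mul_comm (star e) e, ← Zsqrtd.norm_eq_mul_conj, he]; simp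
  have h3 := spin_unit_aux (e := star e) (w := e * w) (by rw [Zsqrtd.norm_conj, he]) (by simpa using hp) hew (by rwa [h2])
  simp at h3
  have h4 : e.im = 0 := by omega
  rw [spin_norm, h4] at he
  have : e.re = 1 := by nlinarith
  ext <;> simp [this, h4]

lemma spin_root_inj {w1 w2 : ℤ√2} (h1 : spinD w1) (h2 : spinD w2) (hn : w1.norm = w2.norm)
    (hd : w1.norm ∣ w1.im * w2.re - w1.re * w2.im) : w1 = w2 := by
  have hm := spinD_norm_pos h1
  have hm2 := spinD_norm_pos h2
  have hN : (w1 * star w2).norm = w1.norm ^ 2 := by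
    rw [Zsqrtd.norm_mul, Zsqrtd.norm_conj, ← hn]; ring
  have him : (w1 * star w2).im = w1.im * w2.re - w1.re * w2.im := by simp; ring
  have hre : (w1 * star w2).re = w1.re * w2.re - 2 * (w1.im * w2.im) := by simp; ring
  have hdim : w1.norm ∣ (w1 * star w2).im := by rw [him]; exact hd
  have hdre : w1.norm ∣ (w1 * star w2).re := by
    rw [← Int.pow_dvd_pow_iff (n := 2) (by norm_num)]
    rw [spin_norm (w1 * star w2)] at hN
    have : (w1 * star w2).re ^ 2 = w1.norm ^ 2 + 2 * (w1 * star w2).im ^ 2 := by linarith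
    rw [this]
    exact dvd_add dvd_rfl (Dvd.dvd.mul_left (pow_dvd_pow_of_dvd hdim 2) _)
  obtain ⟨x, hx⟩ := hdre
  obtain ⟨y, hy⟩ := hdim
  have hE : w1 * star w2 = (w1.norm : ℤ√2) * ⟨x, y⟩ := by
    ext
    · rw [hx]; simp
    · rw [hy]; simp
  have hnE : (⟨x, y⟩ : ℤ√2).norm = 1 := by
    have h := hN
    rw [hE, Zsqrtd.norm_mul, Zsqrtd.norm_intCast] at h
    have : w1.norm ^ 2 * ((⟨x, y⟩ : ℤ√2).norm - 1) = 0 := by linear_combination h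
    rcases mul_eq_zero.1 this with h | h
    · exact absurd h (by positivity)
    · omega
  have hxp : 0 < x := by
    obtain ⟨a1, a2, a3⟩ := h1
    obtain ⟨b1, b2, b3⟩ := h2
    have : 0 < w1.re * w2.re - 2 * (w1.im * w2.im) := by nlinarith [mul_le_mul a3.le b3.le (by positivity) (by positivity), mul_pos a1 b1]
    rw [← hre, hx] at this
    exact (pos_iff_pos_of_mul_pos this).1 hm
  have hw : w1 = ⟨x, y⟩ * w2 := by
    have : (w1.norm : ℤ√2) * w1 = (w1.norm : ℤ√2) * (⟨x, y⟩ * w2) := by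
      rw [← mul_assoc, ← hE, mul_assoc, mul_comm (star w2), ← Zsqrtd.norm_eq_mul_conj, hn, mul_comm]
    have hz : (w1.norm : ℤ√2) ≠ 0 := by
      rw [Ne, Zsqrtd.ext_iff]; simp; omega
    ext
    · have := congrArg Zsqrtd.re this; simp at this
      rcases this with h | h
      · simpa using h
      · omega
    · have := congrArg Zsqrtd.im this; simp at this
      rcases this with h | h
      · simpa using h
      · omega
  have := spin_unit_unique (e := ⟨x, y⟩) hnE hxp h2 (by rw [← hw]; exact h1)
  rw [hw, this, one_mul]
end

section
/-- Square roots of a unit modulo odd `d`. -/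
lemma spin_sqrt_count (d : ℕ) [NeZero d] (hd : Odd d) (c : ZMod d) (hc : IsUnit c) :
    (Finset.univ.filter (fun x : ZMod d => x ^ 2 = c)).card ≤ d.divisors.card := by
  classical
  have hd0 : d ≠ 0 := NeZero.ne d
  rcases (Finset.univ.filter (fun x : ZMod d => x ^ 2 = c)).eq_empty_or_nonempty with he | ⟨x0, hx0⟩
  · rw [he]; simp
  have hx0' : x0 ^ 2 = c := (Finset.mem_filter.1 hx0).2
  have h2 : IsUnit (2 : ZMod d) := by
    have := (ZMod.isUnit_iff_coprime 2 d).2 ((Nat.coprime_two_left).2 hd)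
    simpa using this
  have hu : IsUnit (2 * x0) := by
    apply h2.mul
    rw [← hx0'] at hc
    exact (isUnit_pow_iff (by norm_num)).1 hc
  set r0 : ℤ := (x0.val : ℤ) with hr0
  have hr0c : (r0 : ZMod d) = x0 := by simp [r0]
  have hcop : IsCoprime (2 * r0) (d : ℤ) := by
    have : IsUnit ((2 * r0 : ℤ) : ZMod d) := by push_cast; rw [hr0c]; exact hu
    rw [ZMod.coe_int_isUnit_iff_isCoprime] at this
    exact this.symm
  apply Finset.card_le_card_of_injOn (fun x : ZMod d => Int.gcd ((x.val : ℤ) - r0) d)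
  · intro x _
    rw [Finset.mem_coe, Nat.mem_divisors]
    exact ⟨by exact_mod_cast Int.gcd_dvd_right ((x.val : ℤ) - r0) (d : ℤ), hd0⟩
  · have main : ∀ x : ZMod d, x ^ 2 = c → ∃ k : ℤ, (d : ℤ) = (Int.gcd ((x.val : ℤ) - r0) d : ℤ) * k ∧
        k ∣ (x.val : ℤ) + r0 := by
      intro x hx
      obtain ⟨k, hk⟩ : ((Int.gcd ((x.val : ℤ) - r0) d : ℕ) : ℤ) ∣ d := Int.gcd_dvd_right _ _
      refine ⟨k, hk, ?_⟩
      have hdv : (d : ℤ) ∣ ((x.val : ℤ) - r0) * ((x.val : ℤ) + r0) := by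
        rw [← ZMod.intCast_zmod_eq_zero_iff_dvd]
        push_cast
        rw [hr0c]; simp
        linear_combination hx - hx0'
      obtain ⟨l, hl⟩ : ((Int.gcd ((x.val : ℤ) - r0) d : ℕ) : ℤ) ∣ (x.val : ℤ) - r0 := Int.gcd_dvd_left _ _
      have hb := Int.gcd_eq_gcd_ab ((x.val : ℤ) - r0) d
      set g : ℤ := ((Int.gcd ((x.val : ℤ) - r0) d : ℕ) : ℤ) with hg
      have hg0 : g ≠ 0 := by
        intro h
        rw [h, zero_mul] at hk
        exact hd0 (by exact_mod_cast hk)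
      have hco : IsCoprime k l := by
        refine ⟨Int.gcdB ((x.val : ℤ) - r0) d, Int.gcdA ((x.val : ℤ) - r0) d, ?_⟩
        apply mul_left_cancel₀ hg0
        linear_combination (-1 : ℤ) * hb - Int.gcdB ((x.val : ℤ) - r0) d * hk - Int.gcdA ((x.val : ℤ) - r0) d * hl
      apply hco.dvd_of_dvd_mul_left
      rw [hl] at hdv
      have h5 : g * k ∣ g * (l * ((x.val : ℤ) + r0)) := by
        rw [← mul_assoc, ← hk]; exact hdv
      exact Int.dvd_of_mul_dvd_mul_left hg0 h5
    intro x hx y hy hxy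
    have hx' : x ^ 2 = c := by simpa using hx
    have hy' : y ^ 2 = c := by simpa using hy
    simp only at hxy
    obtain ⟨k, hk1, hk2⟩ := main x hx'
    obtain ⟨l, hl1, hl2⟩ := main y hy'
    have gx : ((Int.gcd ((x.val : ℤ) - r0) d : ℕ) : ℤ) ∣ (x.val : ℤ) - r0 := Int.gcd_dvd_left _ _
    have gy : ((Int.gcd ((y.val : ℤ) - r0) d : ℕ) : ℤ) ∣ (y.val : ℤ) - r0 := Int.gcd_dvd_left _ _
    rw [← hxy] at hl1 gy
    set g : ℤ := ((Int.gcd ((x.val : ℤ) - r0) d : ℕ) : ℤ) with hg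
    have hg0 : g ≠ 0 := by
      intro h
      rw [h, zero_mul] at hk1
      exact hd0 (by exact_mod_cast hk1)
    have hkl : k = l := mul_left_cancel₀ hg0 (hk1.symm.trans hl1)
    subst hkl
    have hcgk : IsCoprime g k := by
      have h6 : IsCoprime (2 * r0) g := hcop.of_isCoprime_of_dvd_right ⟨k, hk1⟩
      rw [Int.isCoprime_iff_gcd_eq_one]
      by_contra hne
      obtain ⟨p, hp, hpd⟩ := Nat.exists_prime_and_dvd hne
      have p1 : (p : ℤ) ∣ g := (Int.natCast_dvd_natCast.2 hpd).trans (Int.gcd_dvd_left _ _)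
      have p2 : (p : ℤ) ∣ k := (Int.natCast_dvd_natCast.2 hpd).trans (Int.gcd_dvd_right _ _)
      have p3 : (p : ℤ) ∣ 2 * r0 := by
        have := dvd_sub (p2.trans hk2) (p1.trans gx)
        ring_nf at this ⊢; exact this
      have := h6.isUnit_of_dvd' p3 p1
      rw [Int.isUnit_iff_natAbs_eq] at this
      simp at this
      exact hp.one_lt.ne' this
    have hfin : (d : ℤ) ∣ (x.val : ℤ) - y.val := by
      rw [hk1]
      apply hcgk.mul_dvd
      · have := dvd_sub gx gy; ring_nf at this ⊢; exact this
      · have := dvd_sub hk2 hl2; ring_nf at this ⊢; exact this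
    rw [← ZMod.intCast_zmod_eq_zero_iff_dvd] at hfin
    push_cast at hfin
    simp at hfin
    exact sub_eq_zero.1 hfin

/-- Thue lemma. -/
lemma spin_thue (m : ℕ) (hm : Odd m) (r : ℤ) (hr : (m : ℤ) ∣ r ^ 2 - 2) :
    ∃ w : ℤ√2, spinD w ∧ w.norm = m ∧ (m : ℤ) ∣ w.re - r * w.im := by
  have hm0 : m ≠ 0 := by rintro rfl; simp at hm
  have : NeZero m := ⟨hm0⟩
  obtain ⟨q, hq⟩ := hr
  obtain ⟨a, b, hab, ha, hb, hdv⟩ : ∃ a b : ℤ, ¬ (a = 0 ∧ b = 0) ∧ a ^ 2 ≤ m ∧ b ^ 2 ≤ m ∧ (m : ℤ) ∣ a - r * b := by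
    set K := Nat.sqrt m with hK
    have hc : (Finset.univ : Finset (ZMod m)).card < (Finset.range (K + 1) ×ˢ Finset.range (K + 1)).card := by
      rw [Finset.card_univ, ZMod.card, Finset.card_product, Finset.card_range]
      exact Nat.lt_succ_sqrt m
    obtain ⟨x, hx, y, hy, hxy, hf⟩ := Finset.exists_ne_map_eq_of_card_lt_of_maps_to hc
      (f := fun x : ℕ × ℕ => ((x.1 : ZMod m) - (r : ZMod m) * (x.2 : ZMod m))) (fun x _ => Finset.mem_univ _)
    simp only [Finset.mem_product, Finset.mem_range] at hx hy
    have hKm : (K : ℤ) * K ≤ m := by exact_mod_cast Nat.sqrt_le m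
    refine ⟨(x.1 : ℤ) - y.1, (x.2 : ℤ) - y.2, ?_, ?_, ?_, ?_⟩
    · rintro ⟨h1, h2⟩
      exact hxy (Prod.ext (by omega) (by omega))
    · have : |(x.1 : ℤ) - y.1| ≤ K := by rw [abs_le]; omega
      have h3 := abs_nonneg ((x.1 : ℤ) - y.1)
      rw [← sq_abs]; nlinarith
    · have : |(x.2 : ℤ) - y.2| ≤ K := by rw [abs_le]; omega
      have h3 := abs_nonneg ((x.2 : ℤ) - y.2)
      rw [← sq_abs]; nlinarith
    · rw [← ZMod.intCast_zmod_eq_zero_iff_dvd]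
      push_cast
      linear_combination hf
  obtain ⟨k, hk⟩ := hdv
  have hmp : (0 : ℤ) < m := by exact_mod_cast Nat.pos_of_ne_zero hm0
  obtain ⟨w, hwn, hwd⟩ : ∃ w : ℤ√2, w.norm = m ∧ (m : ℤ) ∣ w.re - r * w.im := by
    have hn0 : a ^ 2 - 2 * b ^ 2 ≠ 0 := by
      intro h
      have h2 : (⟨a, b⟩ : ℤ√2).norm = 0 := by rw [spin_norm]; exact h
      rw [Zsqrtd.norm_eq_zero] at h2
      · rw [Zsqrtd.ext_iff] at h2; simp at h2; exact hab h2
      · intro n hn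
        have : |n| < 2 := by rw [abs_lt]; constructor <;> nlinarith
        rw [abs_lt] at this
        have h3 : n = -1 ∨ n = 0 ∨ n = 1 := by omega
        rcases h3 with rfl | rfl | rfl <;> norm_num at hn
    have hdiv : a ^ 2 - 2 * b ^ 2 = m * (k * (a + r * b) + q * b ^ 2) := by
      linear_combination (a + r * b) * hk + b ^ 2 * hq
    set c := k * (a + r * b) + q * b ^ 2 with hc
    have c1 : c ≤ 1 := by nlinarith [sq_nonneg b]
    have c2 : -2 ≤ c := by nlinarith [sq_nonneg a]
    have c3 : c ≠ 0 := by intro h; rw [h, mul_zero] at hdiv; exact hn0 hdiv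
    have c4 : c = 1 ∨ c = -1 ∨ c = -2 := by omega
    rcases c4 with h | h | h
    · exact ⟨⟨a, b⟩, by rw [spin_norm]; rw [h, mul_one] at hdiv; exact hdiv, ⟨k, hk⟩⟩
    · refine ⟨⟨a + 2 * b, a + b⟩, by rw [spin_norm]; rw [h] at hdiv; simp only; linear_combination -hdiv, k - r * k - q * b, ?_⟩
      simp only
      linear_combination (1 - r) * hk - b * hq
    · rw [h] at hdiv
      have hev : Even (a ^ 2) := ⟨b ^ 2 - m, by linarith⟩
      rw [Int.even_pow' (by norm_num)] at hev
      obtain ⟨a', rfl⟩ := hev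
      refine ⟨⟨b, a'⟩, by rw [spin_norm]; simp only; linarith, ?_⟩
      have hco : IsCoprime (m : ℤ) 2 := by
        rw [Int.isCoprime_iff_gcd_eq_one]
        exact_mod_cast (Nat.coprime_two_right).2 hm
      apply hco.dvd_of_dvd_mul_left
      refine ⟨- r * k - q * b, ?_⟩
      simp only
      linear_combination (- r) * hk - b * hq
  obtain ⟨k', hk'⟩ := hwd
  obtain ⟨w, hwn, hwd, hwp⟩ : ∃ w : ℤ√2, w.norm = m ∧ (m : ℤ) ∣ w.re - r * w.im ∧ 0 < w.re := by
    rcases lt_trichotomy w.re 0 with h | h | h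
    · refine ⟨-w, by rw [Zsqrtd.norm_neg, hwn], ⟨-k', ?_⟩, by simpa using h⟩
      simp; linear_combination -hk'
    · exfalso; rw [spin_norm, h] at hwn; nlinarith [sq_nonneg w.im]
    · exact ⟨w, hwn, ⟨k', hk'⟩, h⟩
  obtain ⟨k', hk'⟩ := hwd
  obtain ⟨e, he, hep, heD⟩ := spin_reduce w hwp (by rw [hwn]; exact hmp)
  refine ⟨e * w, heD, by rw [Zsqrtd.norm_mul, he, hwn, one_mul], e.re * k' - e.im * (q * w.im) - e.im * r * k', ?_⟩
  simp
  linear_combination (e.re - e.im * r) * hk' - e.im * w.im * hq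

/-- Elements of the fundamental domain of given norm. -/
def spinDS (n : ℕ) : Finset (ℤ√2) :=
  (((Finset.Icc 0 (9 * n)) ×ˢ (Finset.Icc 0 (9 * n))).image
    (fun x : ℕ × ℕ => (⟨(x.1 : ℤ), (x.2 : ℤ)⟩ : ℤ√2))).filter (fun w => spinD w ∧ w.norm = n)

lemma mem_spinDS {n : ℕ} {w : ℤ√2} : w ∈ spinDS n ↔ spinD w ∧ w.norm = n := by
  unfold spinDS
  rw [Finset.mem_filter]
  refine ⟨fun h => h.2, fun h => ⟨?_, h⟩⟩
  obtain ⟨h, hn⟩ := h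
  have h1 := spinD_re_sq h
  have h2 := spinD_im_sq h
  obtain ⟨a1, a2, a3⟩ := h
  rw [hn] at h1 h2
  have h3 : w.re ≤ 9 * n := by nlinarith
  rw [Finset.mem_image]
  refine ⟨(w.re.toNat, w.im.toNat), ?_, ?_⟩
  · simp only [Finset.mem_product, Finset.mem_Icc]; omega
  · ext <;> simp <;> omega

/-- Primitive elements. -/
def spinPr (w : ℤ√2) : Prop := IsCoprime w.re w.im

lemma spinPr_norm {w : ℤ√2} (h : spinPr w) : IsCoprime w.im w.norm := by
  unfold spinPr at h
  rw [spin_norm]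
  have h1 : IsCoprime w.im (w.re ^ 2) := (h.symm).pow_right
  have : w.re ^ 2 - 2 * w.im ^ 2 = w.re ^ 2 + w.im * (- 2 * w.im) := by ring
  rw [this]
  exact (IsCoprime.add_mul_left_right_iff).2 h1

open Classical in
lemma spinDS_card (n : ℕ) (hn : Odd n) : ((spinDS n).filter spinPr).card ≤ n.divisors.card := by
  have hn0 : n ≠ 0 := by rintro rfl; simp at hn
  have : NeZero n := ⟨hn0⟩
  have h2 : IsUnit (2 : ZMod n) := by
    have := (ZMod.isUnit_iff_coprime 2 n).2 ((Nat.coprime_two_left).2 hn)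
    simpa using this
  refine le_trans ?_ (spin_sqrt_count n hn 2 h2)
  have hu : ∀ w ∈ (spinDS n).filter spinPr, (w.im : ZMod n) * (w.im : ZMod n)⁻¹ = 1 := by
    intro w hw
    rw [Finset.mem_filter, mem_spinDS] at hw
    have := spinPr_norm hw.2
    rw [hw.1.2] at this
    have h3 : IsUnit (w.im : ZMod n) := by
      rw [ZMod.coe_int_isUnit_iff_isCoprime]; exact this.symm
    exact ZMod.mul_inv_of_unit _ h3
  apply Finset.card_le_card_of_injOn (fun w : ℤ√2 => (w.re : ZMod n) * (w.im : ZMod n)⁻¹)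
  · intro w hw
    have h3 := hu w hw
    have hw := Finset.mem_coe.1 hw
    rw [Finset.mem_filter, mem_spinDS] at hw
    simp only [Finset.coe_filter, Finset.mem_univ, true_and, Set.mem_ofPred_eq]
    have h4 : ((w.re ^ 2 - 2 * w.im ^ 2 : ℤ) : ZMod n) = 0 := by
      rw [← spin_norm, hw.1.2]; simp
    push_cast at h4
    linear_combination (w.im : ZMod n)⁻¹ ^ 2 * h4 + 2 * ((w.im : ZMod n) * (w.im : ZMod n)⁻¹ + 1) * h3
  · intro w hw z hz hwz
    have h3 := hu w hw
    have h4 := hu z hz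
    have hw := Finset.mem_coe.1 hw
    have hz := Finset.mem_coe.1 hz
    rw [Finset.mem_filter, mem_spinDS] at hw hz
    simp only at hwz
    apply spin_root_inj hw.1.1 hz.1.1 (by rw [hw.1.2, hz.1.2])
    rw [hw.1.2, ← ZMod.intCast_zmod_eq_zero_iff_dvd]
    push_cast
    linear_combination -(w.im : ZMod n) * (z.im : ZMod n) * hwz + w.re * z.im * h3 - z.re * w.im * h4

lemma spinDS_prime (p : ℕ) (hp : p.Prime) (h16 : p % 16 = 15) : (spinDS p).card = 2 := by
  have : Fact p.Prime := ⟨hp⟩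
  have : NeZero p := ⟨hp.ne_zero⟩
  have hodd : Odd p := by rw [Nat.odd_iff]; omega
  have hsq : IsSquare (2 : ZMod p) := by
    rw [ZMod.exists_sq_eq_two_iff (by omega)]; right; omega
  obtain ⟨x, hx⟩ := hsq
  set r : ℤ := (x.val : ℤ) with hr
  have hrc : (r : ZMod p) = x := by simp [r]
  have hd : (p : ℤ) ∣ r ^ 2 - 2 := by
    rw [← ZMod.intCast_zmod_eq_zero_iff_dvd]; push_cast; rw [hrc, hx]; ring
  have h2 : (2 : ZMod p) ≠ 0 := by
    have : ((2 : ℕ) : ZMod p) ≠ 0 := by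
      rw [Ne, ZMod.natCast_eq_zero_iff]
      intro h
      have := Nat.le_of_dvd (by norm_num) h
      omega
    simpa using this
  have hx0 : x ≠ 0 := by rintro rfl; simp at hx; exact h2 hx
  obtain ⟨w1, d1, n1, c1⟩ := spin_thue p hodd r hd
  obtain ⟨w2, d2, n2, c2⟩ := spin_thue p hodd (-r) (by rwa [neg_sq])
  have him : ∀ w : ℤ√2, spinD w → w.norm = p → (w.im : ZMod p) ≠ 0 := by
    intro w hD hn h0
    have h5 : ((w.re ^ 2 - 2 * w.im ^ 2 : ℤ) : ZMod p) = 0 := by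
      rw [← spin_norm, hn]; simp
    push_cast at h5
    rw [h0] at h5
    have h6 : (w.re : ZMod p) = 0 := by simpa using h5
    rw [ZMod.intCast_zmod_eq_zero_iff_dvd] at h0 h6
    obtain ⟨i, hi⟩ := h0
    obtain ⟨j, hj⟩ := h6
    rw [spin_norm, hi, hj] at hn
    have hp0 : (p : ℤ) ≠ 0 := by exact_mod_cast hp.ne_zero
    have h7 : (p : ℤ) * (j ^ 2 - 2 * i ^ 2) = 1 := by
      apply mul_left_cancel₀ hp0; linear_combination hn
    have h8 := Int.isUnit_iff.1 (IsUnit.of_mul_eq_one _ h7)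
    have := hp.two_le
    omega
  rw [← ZMod.intCast_zmod_eq_zero_iff_dvd] at c1 c2
  push_cast at c1 c2
  rw [hrc] at c1 c2
  have hne : w1 ≠ w2 := by
    rintro rfl
    have : (2 : ZMod p) * x * w1.im = 0 := by linear_combination c2 - c1
    rcases mul_eq_zero.1 this with h | h
    · rcases mul_eq_zero.1 h with h | h
      · exact h2 h
      · exact hx0 h
    · exact him _ d1 n1 h
  have : spinDS p = {w1, w2} := by
    ext w
    rw [mem_spinDS, Finset.mem_insert, Finset.mem_singleton]
    constructor
    · rintro ⟨hD, hn⟩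
      have h5 : ((w.re ^ 2 - 2 * w.im ^ 2 : ℤ) : ZMod p) = 0 := by
        rw [← spin_norm, hn]; simp
      push_cast at h5
      have h6 : ((w.re : ZMod p) - x * w.im) * ((w.re : ZMod p) - - x * w.im) = 0 := by
        linear_combination h5 + (w.im : ZMod p) ^ 2 * hx
      rcases mul_eq_zero.1 h6 with h | h
      · left
        apply spin_root_inj hD d1 (by rw [hn, n1])
        rw [hn, ← ZMod.intCast_zmod_eq_zero_iff_dvd]
        push_cast
        linear_combination (w.im : ZMod p) * c1 - (w1.im : ZMod p) * h
      · right
        apply spin_root_inj hD d2 (by rw [hn, n2])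
        rw [hn, ← ZMod.intCast_zmod_eq_zero_iff_dvd]
        push_cast
        linear_combination (w.im : ZMod p) * c2 - (w2.im : ZMod p) * h
    · rintro (rfl | rfl)
      · exact ⟨d1, n1⟩
      · exact ⟨d2, n2⟩
  rw [this, Finset.card_pair hne]
end

section
/-- The sign in twisted multiplicativity. -/
def spinSg (a c m v : ℕ) : ℤ := (-1) ^ ((a / 2 + c / 2 + m / 2) * (v / 2) + (a / 2) * (c / 2))

lemma spin_neg_one_pow {m n : ℕ} (h : (m : ZMod 2) = (n : ZMod 2)) : (-1 : ℤ) ^ m = (-1) ^ n := by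
  rw [ZMod.natCast_eq_natCast_iff] at h
  rw [neg_one_pow_eq_pow_mod_two m, neg_one_pow_eq_pow_mod_two n, h]

lemma spinSg_mod (a c m v : ℕ) : spinSg a c m v = spinSg (a % 16) (c % 16) (m % 16) (v % 16) := by
  have h : ∀ x : ℕ, ((x / 2 : ℕ) : ZMod 2) = ((x % 16 / 2 : ℕ) : ZMod 2) := by
    intro x
    rw [ZMod.natCast_eq_natCast_iff]; unfold Nat.ModEq; omega
  unfold spinSg
  apply spin_neg_one_pow
  simp only [Nat.cast_add, Nat.cast_mul]
  rw [h a, h c, h m, h v]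

lemma spin_half_mul {x y : ℕ} (hx : Odd x) (hy : Odd y) :
    ((x * y / 2 : ℕ) : ZMod 2) = ((x / 2 : ℕ) : ZMod 2) + ((y / 2 : ℕ) : ZMod 2) := by
  obtain ⟨i, rfl⟩ := hx
  obtain ⟨j, rfl⟩ := hy
  have h1 : (2 * i + 1) * (2 * j + 1) / 2 = 2 * (i * j) + i + j := by
    have : (2 * i + 1) * (2 * j + 1) = 2 * (2 * (i * j) + i + j) + 1 := by ring
    omega
  have h2 : (2 * i + 1) / 2 = i := by omega
  have h3 : (2 * j + 1) / 2 = j := by omega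
  rw [h1, h2, h3]
  push_cast
  have : (2 : ZMod 2) = 0 := by decide
  rw [this]; ring

lemma spin_jac_zero {x : ℤ} {n p : ℕ} (hp : p.Prime) (h1 : (p : ℤ) ∣ x) (h2 : p ∣ n) (hn : n ≠ 0) :
    jacobiSym x n = 0 := by
  have : NeZero n := ⟨hn⟩
  rw [jacobiSym.eq_zero_iff_not_coprime]
  intro h
  have h3 : p ∣ Int.gcd x n := by
    have := Int.dvd_coe_gcd h1 (Int.natCast_dvd_natCast.2 h2)
    exact_mod_cast this
  rw [h] at h3
  exact hp.one_lt.ne' (Nat.dvd_one.1 h3)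

lemma spin_jac_sq {x : ℤ} {n : ℕ} (h : IsCoprime x n) : jacobiSym x n * jacobiSym x n = 1 := by
  rw [← sq, ← jacobiSym.pow_left]
  exact jacobiSym.sq_one' (Int.isCoprime_iff_gcd_eq_one.1 h)

theorem spin_twist (a b c d m : ℕ) (ha : Odd a) (hc : Odd c) (hm : (m : ℤ) = (a : ℤ) ^ 2 - 2 * (b : ℤ) ^ 2)
    (hv : Odd (a * d + b * c)) :
    jacobiSym ((a : ℤ) * c + 2 * b * d) (a * d + b * c) =
      spinSg a c m (a * d + b * c) * (jacobiSym b a * jacobiSym d c * jacobiSym ((a : ℤ) * d + b * c) m) := by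
  have ha0 : a ≠ 0 := by rintro rfl; simp at ha
  have hc0 : c ≠ 0 := by rintro rfl; simp at hc
  have hv0 : a * d + b * c ≠ 0 := by intro h; rw [h] at hv; simp at hv
  have hmo : Odd m := by
    have : Odd (m : ℤ) := by
      rw [hm]
      have h1 : Odd ((a : ℤ) ^ 2) := by
        have : Odd (a : ℤ) := by exact_mod_cast ha
        exact this.pow
      exact h1.sub_even ⟨(b : ℤ) ^ 2, by ring⟩
    exact_mod_cast this
  by_cases hab : Nat.Coprime a b
  swap
  · obtain ⟨p, hp, hpa, hpb⟩ := Nat.Prime.not_coprime_iff_dvd.1 hab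
    rw [spin_jac_zero (x := (b : ℤ)) hp (Int.natCast_dvd_natCast.2 hpb) hpa ha0,
      spin_jac_zero (n := a * d + b * c) hp _ _ hv0]
    · ring
    · have h1 := Int.natCast_dvd_natCast.2 hpa
      have h2 := Int.natCast_dvd_natCast.2 hpb
      exact dvd_add (h1.mul_right _) ((h2.mul_left 2).mul_right _)
    · exact dvd_add (hpa.mul_right _) (hpb.mul_right _)
  by_cases hcd : Nat.Coprime c d
  swap
  · obtain ⟨p, hp, hpc, hpd⟩ := Nat.Prime.not_coprime_iff_dvd.1 hcd
    rw [spin_jac_zero (x := (d : ℤ)) hp (Int.natCast_dvd_natCast.2 hpd) hpc hc0,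
      spin_jac_zero (n := a * d + b * c) hp _ _ hv0]
    · ring
    · have h1 := Int.natCast_dvd_natCast.2 hpc
      have h2 := Int.natCast_dvd_natCast.2 hpd
      exact dvd_add (h1.mul_left _) (h2.mul_left _)
    · exact dvd_add (hpd.mul_left _) (hpc.mul_left _)
  obtain ⟨g, a', c', hg0, hcop, rfl, rfl⟩ : ∃ g a' c' : ℕ, 0 < g ∧ Nat.Coprime a' c' ∧ a = g * a' ∧ c = g * c' := by
    obtain ⟨a', c', h1, h2, h3⟩ := Nat.exists_coprime a c
    exact ⟨Nat.gcd a c, a', c', Nat.gcd_pos_of_pos_left _ (Nat.pos_of_ne_zero ha0), h1, by rw [mul_comm]; exact h2, by rw [mul_comm]; exact h3⟩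
  have hvv : g * a' * d + b * (g * c') = g * (a' * d + b * c') := by ring
  have hgo : Odd g := (Nat.odd_mul.1 ha).1
  have ha_o : Odd a' := (Nat.odd_mul.1 ha).2
  have hc_o : Odd c' := (Nat.odd_mul.1 hc).2
  rw [hvv] at hv ⊢
  have hv_o : Odd (a' * d + b * c') := (Nat.odd_mul.1 hv).2
  set v' := a' * d + b * c' with hv'
  have hg0' : g ≠ 0 := hg0.ne'
  have ha_z : a' ≠ 0 := by rintro rfl; simp at ha_o
  have hc_z : c' ≠ 0 := by rintro rfl; simp at hc_o
  have hv_z : v' ≠ 0 := by intro h; rw [h] at hv_o; simp at hv_o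
  have hm0 : m ≠ 0 := by rintro rfl; simp at hmo
  have cgb : IsCoprime (b : ℤ) (g : ℤ) := by
    exact_mod_cast Nat.isCoprime_iff_coprime.2 (Nat.Coprime.coprime_mul_right hab).symm
  have cgd : IsCoprime (d : ℤ) (g : ℤ) := by
    exact_mod_cast Nat.isCoprime_iff_coprime.2 (Nat.Coprime.coprime_mul_right hcd).symm
  have cab_cop : IsCoprime (a' : ℤ) (b : ℤ) := by
    exact_mod_cast Nat.isCoprime_iff_coprime.2 (Nat.Coprime.coprime_mul_left hab)
  have cac_cop : IsCoprime (a' : ℤ) (c' : ℤ) := by exact_mod_cast Nat.isCoprime_iff_coprime.2 hcop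
  have c2 : ∀ x : ℕ, Odd x → IsCoprime (2 : ℤ) (x : ℤ) := by
    intro x hx
    have := Nat.isCoprime_iff_coprime.2 ((Nat.coprime_two_left).2 hx)
    exact_mod_cast this
  have e1 : jacobiSym (((g * a' : ℕ) : ℤ) * (g * c' : ℕ) + 2 * b * d) g = jacobiSym 2 g * jacobiSym b g * jacobiSym d g := by
    rw [← jacobiSym.mul_left, ← jacobiSym.mul_left]
    apply jacobiSym.mod_left'
    apply Int.ModEq.symm
    rw [Int.modEq_iff_dvd]
    exact ⟨a' * g * c', by push_cast; ring⟩
  have cav_cop : IsCoprime (a' : ℤ) (v' : ℤ) := by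
    rw [hv']; push_cast
    have : (a' : ℤ) * d + b * c' = b * c' + a' * d := by ring
    rw [this, IsCoprime.add_mul_left_right_iff]
    exact cab_cop.mul_right cac_cop
  have e2 : jacobiSym a' v' * jacobiSym (((g * a' : ℕ) : ℤ) * (g * c' : ℕ) + 2 * b * d) v' = jacobiSym m v' * jacobiSym c' v' := by
    rw [← jacobiSym.mul_left, ← jacobiSym.mul_left]
    apply jacobiSym.mod_left'
    apply Int.ModEq.symm
    rw [Int.modEq_iff_dvd]
    refine ⟨2 * b, ?_⟩
    rw [hv', hm]; push_cast; ring
  have e2' : jacobiSym (((g * a' : ℕ) : ℤ) * (g * c' : ℕ) + 2 * b * d) v' = jacobiSym a' v' * jacobiSym m v' * jacobiSym c' v' := by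
    have := spin_jac_sq cav_cop
    calc _ = (jacobiSym a' v' * jacobiSym a' v') * jacobiSym (((g * a' : ℕ) : ℤ) * (g * c' : ℕ) + 2 * b * d) v' := by rw [this, one_mul]
      _ = _ := by rw [mul_assoc, e2]; ring
  have r1 : jacobiSym a' v' = (-1) ^ (a' / 2 * (v' / 2)) * (jacobiSym b a' * jacobiSym c' a') := by
    rw [jacobiSym.quadratic_reciprocity ha_o hv_o, ← jacobiSym.mul_left]
    congr 1
    apply jacobiSym.mod_left'
    apply Int.ModEq.symm
    rw [Int.modEq_iff_dvd]
    exact ⟨d, by rw [hv']; push_cast; ring⟩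
  have r2 : jacobiSym c' v' = (-1) ^ (c' / 2 * (v' / 2)) * (jacobiSym a' c' * jacobiSym d c') := by
    rw [jacobiSym.quadratic_reciprocity hc_o hv_o, ← jacobiSym.mul_left]
    congr 1
    apply jacobiSym.mod_left'
    apply Int.ModEq.symm
    rw [Int.modEq_iff_dvd]
    exact ⟨b, by rw [hv']; push_cast; ring⟩
  have r3 : jacobiSym a' c' = (-1) ^ (a' / 2 * (c' / 2)) * jacobiSym c' a' := jacobiSym.quadratic_reciprocity ha_o hc_o
  have r3' : jacobiSym c' a' * jacobiSym c' a' = 1 := spin_jac_sq cac_cop.symm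
  have r4 : jacobiSym m v' = (-1) ^ (m / 2 * (v' / 2)) * jacobiSym v' m := jacobiSym.quadratic_reciprocity hmo hv_o
  have cgm : IsCoprime (g : ℤ) (m : ℤ) := by
    rw [hm]; push_cast
    have : ((g : ℤ) * a') ^ 2 - 2 * (b : ℤ) ^ 2 = -(2 * (b : ℤ) ^ 2) + g * (g * a' ^ 2) := by ring
    rw [this, IsCoprime.add_mul_left_right_iff]
    exact ((c2 g hgo).symm.mul_right cgb.symm.pow_right).neg_right
  have r5 : jacobiSym v' m = jacobiSym g m * jacobiSym (((g * a' : ℕ) : ℤ) * d + b * (g * c' : ℕ)) m := by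
    have h1 : (((g * a' : ℕ) : ℤ) * d + b * (g * c' : ℕ)) = g * v' := by rw [hv']; push_cast; ring
    rw [h1, jacobiSym.mul_left, ← mul_assoc, spin_jac_sq cgm, one_mul]
  have r6 : jacobiSym g m = (-1) ^ (g / 2 * (m / 2)) * ((-1) ^ (g / 2) * jacobiSym 2 g) := by
    rw [jacobiSym.quadratic_reciprocity hgo hmo]
    congr 1
    have h1 : jacobiSym (m : ℤ) g = jacobiSym (-1 * 2 * (b * b)) g := by
      apply jacobiSym.mod_left'
      apply Int.ModEq.symm
      rw [Int.modEq_iff_dvd]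
      exact ⟨g * a' ^ 2, by rw [hm]; push_cast; ring⟩
    rw [h1, jacobiSym.mul_left, jacobiSym.mul_left _ (b : ℤ), spin_jac_sq cgb, mul_one, jacobiSym.mul_left,
      jacobiSym.at_neg_one hgo, ZMod.χ₄_eq_neg_one_pow (Nat.odd_iff.1 hgo)]
  have r7 : jacobiSym 2 g * jacobiSym 2 g = 1 := by
    have := spin_jac_sq (c2 g hgo); exact this
  rw [jacobiSym.mul_right' _ hg0' hv_z, e1, e2', r4, r5, r6, r2, r1, r3,
    jacobiSym.mul_right' _ hg0' ha_z, jacobiSym.mul_right' _ hg0' hc_z]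
  have sg : spinSg (g * a') (g * c') m (g * v') =
      (-1) ^ (a' / 2 * (v' / 2) + c' / 2 * (v' / 2) + a' / 2 * (c' / 2) + m / 2 * (v' / 2) + g / 2 * (m / 2) + g / 2) := by
    unfold spinSg
    apply spin_neg_one_pow
    simp only [Nat.cast_add, Nat.cast_mul]
    rw [spin_half_mul hgo ha_o, spin_half_mul hgo hc_o, spin_half_mul hgo hv_o]
    generalize ((a' / 2 : ℕ) : ZMod 2) = A
    generalize ((c' / 2 : ℕ) : ZMod 2) = C
    generalize ((v' / 2 : ℕ) : ZMod 2) = V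
    generalize ((m / 2 : ℕ) : ZMod 2) = M
    generalize ((g / 2 : ℕ) : ZMod 2) = G
    revert A C V M G
    decide
  rw [sg]
  simp only [pow_add]
  generalize (-1 : ℤ) ^ (a' / 2 * (v' / 2)) = s1
  generalize (-1 : ℤ) ^ (c' / 2 * (v' / 2)) = s2
  generalize (-1 : ℤ) ^ (a' / 2 * (c' / 2)) = s3
  generalize (-1 : ℤ) ^ (m / 2 * (v' / 2)) = s4
  generalize (-1 : ℤ) ^ (g / 2 * (m / 2)) = s5
  generalize (-1 : ℤ) ^ (g / 2) = s6
  generalize jacobiSym (((g * a' : ℕ) : ℤ) * d + b * (g * c' : ℕ)) m = J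
  linear_combination (s1 * s2 * s3 * s4 * s5 * s6 * jacobiSym b g * jacobiSym d g * jacobiSym b a' * jacobiSym d c' * J) *
    ((jacobiSym c' a' * jacobiSym c' a') * r7 + r3')

def spinS (w : ℤ√2) : ℤ := jacobiSym (2 * w.re) w.im.toNat

lemma spinS_unit (u v : ℕ) (hu : Odd u) (hv : Odd v) :
    jacobiSym (2 * (3 * u + 4 * v)) (2 * u + 3 * v) = jacobiSym (2 * u) v := by
  have hv' : Odd (2 * u + 3 * v) := by
    rw [Nat.odd_iff] at *; omega
  have h1 : jacobiSym (2 * (3 * u + 4 * v)) (2 * u + 3 * v) = jacobiSym (-1 * v) (2 * u + 3 * v) := by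
    apply jacobiSym.mod_left'
    apply Int.ModEq.symm
    rw [Int.modEq_iff_dvd]
    exact ⟨3, by push_cast; ring⟩
  rw [h1, jacobiSym.mul_left, jacobiSym.at_neg_one hv', ZMod.χ₄_eq_neg_one_pow (Nat.odd_iff.1 hv'),
    jacobiSym.quadratic_reciprocity hv hv', ← mul_assoc, ← pow_add]
  have h2 : jacobiSym ((2 * u + 3 * v : ℕ) : ℤ) v = jacobiSym (2 * u) v := by
    apply jacobiSym.mod_left'
    apply Int.ModEq.symm
    rw [Int.modEq_iff_dvd]
    exact ⟨3, by push_cast; ring⟩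
  rw [h2]
  have h3 : Even ((2 * u + 3 * v) / 2 + v / 2 * ((2 * u + 3 * v) / 2)) := by
    obtain ⟨i, rfl⟩ := hu
    obtain ⟨j, rfl⟩ := hv
    have e1 : (2 * (2 * i + 1) + 3 * (2 * j + 1)) / 2 = 2 * i + 3 * j + 2 := by omega
    have e2 : (2 * j + 1) / 2 = j := by omega
    rw [e1, e2]
    rcases Nat.even_or_odd j with ⟨t, rfl⟩ | ⟨t, rfl⟩
    · exact ⟨i + 3 * t + 1 + t * (2 * i + 3 * (t + t) + 2), by ring⟩
    · exact ⟨(t + 1) * (2 * i + 3 * (2 * t + 1) + 2), by ring⟩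
  rw [h3.neg_one_pow, one_mul]
end

section
lemma spin_odd_of_norm {w : ℤ√2} (h : w.norm % 8 = 7) : w.re % 2 = 1 ∧ w.im % 2 = 1 := by
  rw [spin_norm] at h
  rcases Int.even_or_odd' w.re with ⟨i, hi | hi⟩ <;> rcases Int.even_or_odd' w.im with ⟨j, hj | hj⟩
  · exfalso
    rw [hi, hj] at h; ring_nf at h; omega
  · exfalso
    rw [hi, hj] at h; ring_nf at h; omega
  · exfalso
    rcases Int.even_or_odd' i with ⟨t, ht | ht⟩ <;> rw [hi, hj, ht] at h <;> ring_nf at h <;> omega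
  · omega

/-- Reduction of a product of two elements of the fundamental domain. -/
def spinRed (x : ℤ√2) : ℤ√2 := if spinD x then x else ⟨3, -2⟩ * x

lemma spinRed_eq (x : ℤ√2) : ∃ e : ℤ√2, spinRed x = e * x ∧ e.norm = 1 ∧ 0 < e.re := by
  unfold spinRed
  split_ifs
  · exact ⟨1, by simp, by simp [Zsqrtd.norm_def], by simp⟩
  · exact ⟨⟨3, -2⟩, rfl, by simp [Zsqrtd.norm_def], by simp⟩

lemma spin_mul_nonneg {w z : ℤ√2} (hw : spinD w) (hz : spinD z) : 0 < (w * z).re ∧ 0 ≤ (w * z).im := by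
  obtain ⟨h1, h2, h3⟩ := hw
  obtain ⟨h4, h5, h6⟩ := hz
  simp
  constructor <;> positivity

lemma spinRed_D {w z : ℤ√2} (hw : spinD w) (hz : spinD z) : spinD (spinRed (w * z)) := by
  unfold spinRed
  split_ifs with h
  · exact h
  · obtain ⟨p1, p2⟩ := spin_mul_nonneg hw hz
    have h7 : 2 * (w * z).re ≤ 3 * (w * z).im := by
      by_contra hc
      exact h ⟨p1, p2, by omega⟩
    have h8 : 17 * (w * z).im < 12 * (w * z).re := by
      obtain ⟨h1, h2, h3⟩ := hw
      obtain ⟨h4, h5, h6⟩ := hz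
      simp
      nlinarith [mul_pos h1 (sub_pos.2 h6), mul_pos h4 (sub_pos.2 h3), mul_pos (sub_pos.2 h3) (sub_pos.2 h6)]
    generalize w * z = x at *
    refine ⟨?_, ?_, ?_⟩ <;> simp <;> linarith

lemma spinRed_S {x : ℤ√2} (hn : x.norm % 8 = 7) (hD : spinD (spinRed x)) :
    spinS (spinRed x) = spinS x := by
  unfold spinRed at *
  split_ifs at * with h
  · rfl
  · have hn' : ((⟨3, -2⟩ : ℤ√2) * x).norm % 8 = 7 := by
      rw [Zsqrtd.norm_mul]
      have : (⟨3, -2⟩ : ℤ√2).norm = 1 := by simp [Zsqrtd.norm_def]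
      rw [this, one_mul, hn]
    obtain ⟨o1, o2⟩ := spin_odd_of_norm hn'
    obtain ⟨d1, d2, d3⟩ := hD
    set y := (⟨3, -2⟩ : ℤ√2) * x with hy
    have e1 : x.re = 3 * y.re + 4 * y.im := by rw [hy]; simp; ring
    have e2 : x.im = 2 * y.re + 3 * y.im := by rw [hy]; simp; ring
    obtain ⟨u, hu⟩ := Int.eq_ofNat_of_zero_le d1.le
    obtain ⟨v, hv⟩ := Int.eq_ofNat_of_zero_le d2
    have := spinS_unit u v (by rw [Nat.odd_iff]; omega) (by rw [Nat.odd_iff]; omega)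
    unfold spinS
    rw [e1, e2, hu, hv]
    have h3 : (2 * (u : ℤ) + 3 * v).toNat = 2 * u + 3 * v := by omega
    rw [h3, this, Int.toNat_natCast]

lemma spin_dvd_mul (w y : ℤ√2) : w.norm ∣ w.im * (w * y).re - w.re * (w * y).im := by
  refine ⟨- y.im, ?_⟩
  rw [spin_norm]; simp; ring

lemma spinS_coprime {W : ℤ√2} (hi : 0 < W.im) (h : spinS W ≠ 0) : IsCoprime W.re W.im := by
  unfold spinS at h
  rw [jacobiSym.mul_left] at h
  have h1 := right_ne_zero_of_mul h
  rw [Ne, jacobiSym.eq_zero_iff] at h1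
  push Not at h1
  have := h1 (by omega)
  rw [Int.isCoprime_iff_gcd_eq_one]
  rwa [Int.toNat_of_nonneg hi.le] at this

lemma spin_coprime_of_dvd {W : ℤ√2} (h : IsCoprime W.re W.im) {m : ℤ} (hm : m ∣ W.norm) : IsCoprime W.im m :=
  (spinPr_norm h).of_isCoprime_of_dvd_right hm

lemma spin_factor_unique {w w' W : ℤ√2} (hw : spinD w) (hw' : spinD w') (hn : w.norm = w'.norm)
    (hW : IsCoprime W.re W.im) (hm : w.norm ∣ W.norm) (h1 : w.norm ∣ w.im * W.re - w.re * W.im)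
    (h2 : w'.norm ∣ w'.im * W.re - w'.re * W.im) : w = w' := by
  apply spin_root_inj hw hw' hn
  have hc := spin_coprime_of_dvd hW hm
  apply hc.symm.dvd_of_dvd_mul_left
  rw [← hn] at h2
  have := dvd_sub (h1.mul_left w'.im) (h2.mul_left w.im)
  have e : W.im * (w.im * w'.re - w.re * w'.im) = w'.im * (w.im * W.re - w.re * W.im) - w.im * (w'.im * W.re - w'.re * W.im) := by ring
  rw [e]; exact this

lemma spin_split (m k : ℕ) (hmk : m * k % 16 = 15) (W : ℤ√2) (hW : spinD W) (hn : W.norm = (m * k : ℕ))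
    (hc : IsCoprime W.re W.im) : ∃ w z : ℤ√2, spinD w ∧ spinD z ∧ w.norm = m ∧ z.norm = k ∧ spinRed (w * z) = W := by
  have hodd : Odd (m * k) := by rw [Nat.odd_iff]; omega
  have hmo := (Nat.odd_mul.1 hodd).1
  have hm0 : m ≠ 0 := by rintro rfl; simp at hmo
  have hmz : (m : ℤ) ≠ 0 := by exact_mod_cast hm0
  have hmp : (0 : ℤ) < m := by exact_mod_cast Nat.pos_of_ne_zero hm0
  have hcm : IsCoprime W.im (m : ℤ) := spin_coprime_of_dvd hc (by rw [hn]; push_cast; exact dvd_mul_right _ _)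
  obtain ⟨x, y, hxy⟩ := hcm
  have hn' := hn
  rw [spin_norm] at hn
  push_cast at hn
  obtain ⟨w, hwD, hwn, hwd⟩ := spin_thue m hmo (W.re * x) (by
    refine ⟨k * x ^ 2 - 2 * y * (x * W.im + 1), ?_⟩
    linear_combination x ^ 2 * hn + 2 * (x * W.im + 1) * hxy)
  have h1 : (m : ℤ) ∣ w.im * W.re - w.re * W.im := by
    obtain ⟨q, hq⟩ := hwd
    refine ⟨- q * W.im + w.im * W.re * y, ?_⟩
    linear_combination (-W.im) * hq - w.im * W.re * hxy
  have him : (star w * W).im = -(w.im * W.re - w.re * W.im) := by simp; ring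
  have hre : (star w * W).re = w.re * W.re - 2 * (w.im * W.im) := by simp; ring
  have hN : (star w * W).norm = m ^ 2 * k := by
    rw [Zsqrtd.norm_mul, Zsqrtd.norm_conj, hwn, hn']; push_cast; ring
  have hdim : (m : ℤ) ∣ (star w * W).im := by rw [him]; exact (dvd_neg).2 h1
  have hdre : (m : ℤ) ∣ (star w * W).re := by
    rw [← Int.pow_dvd_pow_iff (n := 2) (by norm_num)]
    rw [spin_norm (star w * W)] at hN
    have : (star w * W).re ^ 2 = m ^ 2 * k + 2 * (star w * W).im ^ 2 := by linarith
    rw [this]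
    exact dvd_add (dvd_mul_right _ _) (Dvd.dvd.mul_left (pow_dvd_pow_of_dvd hdim 2) _)
  obtain ⟨i, hi⟩ := hdre
  obtain ⟨j, hj⟩ := hdim
  have hE : star w * W = (m : ℤ√2) * ⟨i, j⟩ := by
    ext
    · rw [hi]; simp
    · rw [hj]; simp
  have hW2 : W = w * ⟨i, j⟩ := by
    have : (m : ℤ√2) * W = (m : ℤ√2) * (w * ⟨i, j⟩) := by
      have e : (m : ℤ√2) * (w * ⟨i, j⟩) = w * ((m : ℤ√2) * ⟨i, j⟩) := by ring
      rw [e, ← hE, ← mul_assoc, ← Zsqrtd.norm_eq_mul_conj, hwn]; simp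
    ext
    · have := congrArg Zsqrtd.re this; simp at this
      rcases this with h | h
      · simpa using h
      · omega
    · have := congrArg Zsqrtd.im this; simp at this
      rcases this with h | h
      · simpa using h
      · omega
  have hnk : (⟨i, j⟩ : ℤ√2).norm = k := by
    have h := hn'
    rw [hW2, Zsqrtd.norm_mul, hwn] at h
    push_cast at h
    exact mul_left_cancel₀ hmz h
  have hkp : (0 : ℤ) < k := by
    have : k ≠ 0 := by rintro rfl; simp at hmk
    exact_mod_cast Nat.pos_of_ne_zero this
  have hip : 0 < i := by
    obtain ⟨a1, a2, a3⟩ := hwD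
    obtain ⟨b1, b2, b3⟩ := hW
    have : 0 < w.re * W.re - 2 * (w.im * W.im) := by nlinarith [mul_le_mul a3.le b3.le (by positivity) (by positivity), mul_pos a1 b1]
    rw [← hre, hi] at this
    exact (pos_iff_pos_of_mul_pos this).1 hmp
  obtain ⟨e, he, hep, heD⟩ := spin_reduce ⟨i, j⟩ hip (by rw [hnk]; exact hkp)
  refine ⟨w, e * ⟨i, j⟩, hwD, heD, hwn, by rw [Zsqrtd.norm_mul, he, one_mul, hnk], ?_⟩
  obtain ⟨e', he', hn1, hp1⟩ := spinRed_eq (w * (e * ⟨i, j⟩))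
  have hD' := spinRed_D hwD heD
  have h5 : spinRed (w * (e * ⟨i, j⟩)) = (e' * e) * W := by
    rw [he']; conv_rhs => rw [hW2]
    ring
  have h6 : e' * e = 1 := by
    apply spin_unit_unique (w := W)
    · rw [Zsqrtd.norm_mul, hn1, he, one_mul]
    · rw [spin_norm] at hn1 he
      simp
      have hsq : (2 * e'.im * e.im) ^ 2 < (e'.re * e.re) ^ 2 := by
        have : (e'.re * e.re) ^ 2 = (1 + 2 * e'.im ^ 2) * (1 + 2 * e.im ^ 2) := by
          rw [mul_pow]; congr 1 <;> linarith
        rw [this]; nlinarith [sq_nonneg e'.im, sq_nonneg e.im]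
      have := abs_lt_of_sq_lt_sq hsq (by positivity)
      rw [abs_lt] at this
      linarith [this.1]
    · exact hW
    · rw [← h5]; exact hD'
  rw [h5, h6, one_mul]

lemma spinDS_mul (m k : ℕ) (hmk : m * k % 16 = 15) :
    ∑ W ∈ spinDS (m * k), spinS W = ∑ w ∈ spinDS m, ∑ z ∈ spinDS k, spinS (w * z) := by
  rw [← Finset.sum_product']
  symm
  have hfacts : ∀ p ∈ spinDS m ×ˢ spinDS k, spinD p.1 ∧ p.1.norm = m ∧ spinD p.2 ∧ p.2.norm = k ∧
      (p.1 * p.2).norm = (m * k : ℕ) ∧ (p.1 * p.2).norm % 8 = 7 ∧ spinS (spinRed (p.1 * p.2)) = spinS (p.1 * p.2) ∧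
      spinD (spinRed (p.1 * p.2)) ∧ (spinRed (p.1 * p.2)).norm = (m * k : ℕ) := by
    intro p hp
    rw [Finset.mem_product, mem_spinDS, mem_spinDS] at hp
    obtain ⟨⟨a1, a2⟩, a3, a4⟩ := hp
    have h1 : (p.1 * p.2).norm = (m * k : ℕ) := by rw [Zsqrtd.norm_mul, a2, a4]; push_cast; rfl
    have h2 : (p.1 * p.2).norm % 8 = 7 := by rw [h1]; omega
    have h3 := spinRed_D a1 a3
    obtain ⟨e, he, he2, -⟩ := spinRed_eq (p.1 * p.2)
    exact ⟨a1, a2, a3, a4, h1, h2, spinRed_S h2 h3, h3, by rw [he, Zsqrtd.norm_mul, he2, one_mul, h1]⟩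
  have himpos : ∀ W : ℤ√2, spinD W → W.norm = (m * k : ℕ) → 0 < W.im := by
    intro W hW hn
    have := (spin_odd_of_norm (w := W) (by rw [hn]; omega)).2
    have := hW.2.1
    omega
  apply Finset.sum_bij_ne_zero (fun p _ _ => spinRed (p.1 * p.2))
  · intro p hp _
    obtain ⟨-, -, -, -, -, -, -, h8, h9⟩ := hfacts p hp
    exact mem_spinDS.2 ⟨h8, h9⟩
  · intro p hp h0 q hq h0' hpq
    obtain ⟨a1, a2, a3, a4, a5, a6, a7, a8, a9⟩ := hfacts p hp
    obtain ⟨b1, b2, b3, b4, b5, b6, b7, b8, b9⟩ := hfacts q hq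
    have hc : IsCoprime (spinRed (p.1 * p.2)).re (spinRed (p.1 * p.2)).im :=
      spinS_coprime (himpos _ a8 a9) (by rw [a7]; exact h0)
    obtain ⟨e, he, -, -⟩ := spinRed_eq (p.1 * p.2)
    obtain ⟨e', he', -, -⟩ := spinRed_eq (q.1 * q.2)
    have hp1 : spinRed (p.1 * p.2) = p.1 * (e * p.2) := by rw [he]; ring
    have hp2 : spinRed (p.1 * p.2) = p.2 * (e * p.1) := by rw [he]; ring
    have hq1 : spinRed (p.1 * p.2) = q.1 * (e' * q.2) := by rw [hpq, he']; ring
    have hq2 : spinRed (p.1 * p.2) = q.2 * (e' * q.1) := by rw [hpq, he']; ring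
    have r1 : p.1 = q.1 := by
      apply spin_factor_unique a1 b1 (by rw [a2, b2]) hc (by rw [a2, a9]; push_cast; exact dvd_mul_right _ _)
      · rw [hp1]; exact spin_dvd_mul _ _
      · rw [hq1]; exact spin_dvd_mul _ _
    have r2 : p.2 = q.2 := by
      apply spin_factor_unique a3 b3 (by rw [a4, b4]) hc (by rw [a4, a9]; push_cast; exact dvd_mul_left _ _)
      · rw [hp2]; exact spin_dvd_mul _ _
      · rw [hq2]; exact spin_dvd_mul _ _
    exact Prod.ext r1 r2
  · intro W hW h0
    rw [mem_spinDS] at hW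
    obtain ⟨w, z, d1, d2, n1, n2, hr⟩ := spin_split m k hmk W hW.1 hW.2 (spinS_coprime (himpos _ hW.1 hW.2) h0)
    have hmem : (w, z) ∈ spinDS m ×ˢ spinDS k := by
      rw [Finset.mem_product, mem_spinDS, mem_spinDS]; exact ⟨⟨d1, n1⟩, d2, n2⟩
    refine ⟨(w, z), hmem, ?_, hr⟩
    obtain ⟨-, -, -, -, -, -, h7, -, -⟩ := hfacts _ hmem
    simp only at h7 ⊢
    rw [← h7, hr]; exact h0
  · intro p hp _
    obtain ⟨-, -, -, -, -, -, h7, -, -⟩ := hfacts p hp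
    exact h7.symm

/-- The bilinear symbol. -/
def spinGam (w z : ℤ√2) : ℤ := jacobiSym ((w * z).im) w.norm.toNat

/-- The twisting character. -/
def spinTw (w : ℤ√2) : ℤ := jacobiSym w.im w.re.toNat

/-- Residue class modulo 16. -/
def spinCl (w : ℤ√2) : ZMod 16 × ZMod 16 := ((w.re : ZMod 16), (w.im : ZMod 16))

/-- The sign function on residue classes. -/
def spinDel (r s : ZMod 16 × ZMod 16) : ℤ :=
  if (r.1 ^ 2 - 2 * r.2 ^ 2) * (s.1 ^ 2 - 2 * s.2 ^ 2) = 15 then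
    spinSg r.1.val s.1.val (r.1 ^ 2 - 2 * r.2 ^ 2).val (r.1 * s.2 + r.2 * s.1).val *
      jacobiSym 2 (r.1 * s.2 + r.2 * s.1).val
  else 0

lemma spinDel_abs (r s : ZMod 16 × ZMod 16) : |spinDel r s| ≤ 1 := by
  unfold spinDel
  split_ifs
  · rw [abs_mul]
    have h1 : |spinSg r.1.val s.1.val (r.1 ^ 2 - 2 * r.2 ^ 2).val (r.1 * s.2 + r.2 * s.1).val| ≤ 1 := by
      unfold spinSg; rw [abs_pow]; simp
    exact mul_le_one₀ h1 (abs_nonneg _) (spin_jacobi_abs_le _ _)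
  · simp

lemma spinS_mul {w z : ℤ√2} (hw : spinD w) (hz : spinD z) :
    (if (w.norm * z.norm) % 16 = 15 then spinS (w * z) else 0) =
      spinDel (spinCl w) (spinCl z) * (spinTw w * spinTw z * spinGam w z) := by
  have hiff : ((spinCl w).1 ^ 2 - 2 * (spinCl w).2 ^ 2) * ((spinCl z).1 ^ 2 - 2 * (spinCl z).2 ^ 2) = 15 ↔
      (w.norm * z.norm) % 16 = 15 := by
    have : ((spinCl w).1 ^ 2 - 2 * (spinCl w).2 ^ 2) * ((spinCl z).1 ^ 2 - 2 * (spinCl z).2 ^ 2) =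
      ((w.norm * z.norm : ℤ) : ZMod 16) := by
      rw [spin_norm, spin_norm]; unfold spinCl; push_cast; rfl
    rw [this]
    have h15 : (15 : ZMod 16) = ((15 : ℤ) : ZMod 16) := by norm_num
    rw [h15, ZMod.intCast_eq_intCast_iff]
    unfold Int.ModEq
    norm_num
  unfold spinDel
  by_cases h : (w.norm * z.norm) % 16 = 15
  swap
  · rw [if_neg h, if_neg (fun h' => h (hiff.1 h')), zero_mul]
  rw [if_pos h, if_pos (hiff.2 h)]
  have hn8 : (w * z).norm % 8 = 7 := by rw [Zsqrtd.norm_mul]; omega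
  have hov := (spin_odd_of_norm hn8).2
  have hwn := spinD_norm_pos hw
  have hoddn : Odd (w.norm * z.norm) := by rw [Int.odd_iff]; omega
  have hoddw := (Int.odd_mul.1 hoddn).1
  have hoddz := (Int.odd_mul.1 hoddn).2
  have hre : ∀ x : ℤ√2, Odd x.norm → Odd x.re := by
    intro x hx
    rw [spin_norm] at hx
    have : Odd (x.re ^ 2) := by
      have := hx.add_even (⟨x.im ^ 2, by ring⟩ : Even (2 * x.im ^ 2))
      simpa using this
    exact (Int.odd_pow' (by norm_num)).1 this
  have o1 := hre w hoddw
  have o2 := hre z hoddz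
  obtain ⟨h1, h2, h3⟩ := hw
  obtain ⟨h4, h5, h6⟩ := hz
  obtain ⟨a, ha⟩ := Int.eq_ofNat_of_zero_le h1.le
  obtain ⟨b, hb⟩ := Int.eq_ofNat_of_zero_le h2
  obtain ⟨c, hc⟩ := Int.eq_ofNat_of_zero_le h4.le
  obtain ⟨d, hd⟩ := Int.eq_ofNat_of_zero_le h5
  obtain ⟨m, hm⟩ := Int.eq_ofNat_of_zero_le hwn.le
  have hm' := hm
  rw [spin_norm, ha, hb] at hm
  have him : (w * z).im = ((a * d + b * c : ℕ) : ℤ) := by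
    simp [ha, hb, hc, hd]
  have hree : (w * z).re = (a : ℤ) * c + 2 * b * d := by
    simp [ha, hb, hc, hd]
  rw [ha] at o1
  rw [hc] at o2
  have hodv : Odd (a * d + b * c) := by
    rw [him] at hov; rw [Nat.odd_iff]; omega
  have key := spin_twist a b c d m (by exact_mod_cast o1) (by exact_mod_cast o2) hm.symm hodv
  unfold spinS spinTw spinGam
  rw [jacobiSym.mul_left, hree, him, hm', ha, hb, hc, hd, Int.toNat_natCast, Int.toNat_natCast, Int.toNat_natCast, Int.toNat_natCast, key]
  have f1 : (spinCl w).1.val = a % 16 := by simp [spinCl, ha, ZMod.val_natCast]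
  have f2 : (spinCl z).1.val = c % 16 := by simp [spinCl, hc, ZMod.val_natCast]
  have f3 : ((spinCl w).1 ^ 2 - 2 * (spinCl w).2 ^ 2).val = m % 16 := by
    have : ((spinCl w).1 ^ 2 - 2 * (spinCl w).2 ^ 2) = ((m : ℕ) : ZMod 16) := by
      have : ((m : ℤ) : ZMod 16) = (((a : ℤ) ^ 2 - 2 * (b : ℤ) ^ 2 : ℤ) : ZMod 16) := by rw [← hm]
      rw [Int.cast_natCast] at this
      rw [this]; simp [spinCl, ha, hb]
    rw [this, ZMod.val_natCast]
  have f4 : ((spinCl w).1 * (spinCl z).2 + (spinCl w).2 * (spinCl z).1).val = (a * d + b * c) % 16 := by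
    have : ((spinCl w).1 * (spinCl z).2 + (spinCl w).2 * (spinCl z).1) = ((a * d + b * c : ℕ) : ZMod 16) := by
      simp [spinCl, ha, hb, hc, hd]
    rw [this, ZMod.val_natCast]
  rw [f1, f2, f3, f4, ← spinSg_mod]
  have f5 : jacobiSym 2 ((a * d + b * c) % 16) = jacobiSym 2 (a * d + b * c) := by
    have ho : Odd ((a * d + b * c) % 16) := by rw [Nat.odd_iff] at *; omega
    rw [jacobiSym.at_two ho, jacobiSym.at_two hodv]
    congr 1
    rw [ZMod.natCast_eq_natCast_iff]
    unfold Nat.ModEq; omega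
  rw [f5]
  push_cast
  ring
end

section
lemma spinGam_mul (w z1 z2 : ℤ√2) (hw : 0 < w.norm) :
    spinGam w z1 * spinGam w z2 = jacobiSym w.im w.norm.toNat * spinGam w (z1 * z2) := by
  unfold spinGam
  rw [← jacobiSym.mul_left, ← jacobiSym.mul_left]
  apply jacobiSym.mod_left'
  apply Int.ModEq.symm
  rw [Int.modEq_iff_dvd, Int.toNat_of_nonneg hw.le]
  refine ⟨z1.im * z2.im, ?_⟩
  rw [spin_norm]; simp; ring

lemma spinGam_prod {ι : Type} (s : Finset ι) (w : ℤ√2) (hw : 0 < w.norm) (hp : spinPr w) (p : ι → ℤ√2) :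
    ∏ i ∈ s, spinGam w (p i) = jacobiSym w.im w.norm.toNat ^ (s.card + 1) * spinGam w (∏ i ∈ s, p i) := by
  classical
  have hc := spinPr_norm hp
  have hJ : jacobiSym w.im w.norm.toNat * jacobiSym w.im w.norm.toNat = 1 := by
    apply spin_jac_sq; rwa [Int.toNat_of_nonneg hw.le]
  induction s using Finset.induction_on with
  | empty =>
    simp only [Finset.prod_empty, Finset.card_empty, zero_add, pow_one]
    have : spinGam w 1 = jacobiSym w.im w.norm.toNat := by unfold spinGam; rw [mul_one]
    rw [this, hJ]
  | insert a s ha ih =>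
    rw [Finset.prod_insert ha, Finset.prod_insert ha, Finset.card_insert_of_notMem ha, ih]
    calc _ = jacobiSym w.im w.norm.toNat ^ (s.card + 1) * (spinGam w (p a) * spinGam w (∏ i ∈ s, p i)) := by ring
      _ = _ := by rw [spinGam_mul _ _ _ hw]; ring

lemma spin_range_period {q : ℕ} [NeZero q] (f : ZMod q → ℂ) (L : ℕ) :
    ∑ c ∈ Finset.range L, f (c : ZMod q) = (L / q : ℕ) * ∑ c : ZMod q, f c + ∑ c ∈ Finset.range (L % q), f (c : ZMod q) := by
  have key : ∀ K r : ℕ, ∑ c ∈ Finset.range (q * K + r), f (c : ZMod q) = K * ∑ c : ZMod q, f c + ∑ c ∈ Finset.range r, f (c : ZMod q) := by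
    intro K r
    induction K with
    | zero => simp
    | succ K ih =>
      have e : q * (K + 1) + r = q + (q * K + r) := by ring
      rw [e, Finset.sum_range_add]
      have h1 : ∑ x ∈ Finset.range (q * K + r), f ((q + x : ℕ) : ZMod q) = ∑ x ∈ Finset.range (q * K + r), f (x : ZMod q) := by
        apply Finset.sum_congr rfl; intro x _; simp
      have h2 : ∑ x ∈ Finset.range q, f (x : ZMod q) = ∑ c : ZMod q, f c := by
        have := spin_sum_range_zmod (q := q) (fun j : ℕ => f (j : ZMod q))
        rw [← this]
        apply Finset.sum_congr rfl; intro x _; simp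
      rw [h1, h2, ih]; push_cast; ring
  have := key (L / q) (L % q)
  rwa [Nat.div_add_mod] at this

lemma spin_box_sum {q : ℕ} [NeZero q] (G : ZMod q → ZMod q → ℂ) (hG : ∀ c d, ‖G c d‖ ≤ 1)
    (h0 : ∑ c : ZMod q, ∑ d : ZMod q, G c d = 0) (L : ℕ) :
    ‖∑ c ∈ Finset.range L, ∑ d ∈ Finset.range L, G (c : ZMod q) (d : ZMod q)‖ ≤ 2 * q * L := by
  have hq : 0 < q := Nat.pos_of_ne_zero (NeZero.ne q)
  have hlt : L % q < q := Nat.mod_lt _ hq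
  rw [spin_range_period (fun c : ZMod q => ∑ d ∈ Finset.range L, G c (d : ZMod q)) L, Finset.sum_comm,
    spin_range_period (fun d : ZMod q => ∑ c : ZMod q, G c d) L, Finset.sum_comm, h0, mul_zero, zero_add]
  have b1 : ‖∑ d ∈ Finset.range (L % q), ∑ c : ZMod q, G c (d : ZMod q)‖ ≤ q * q := by
    calc _ ≤ ∑ d ∈ Finset.range (L % q), (q : ℝ) := by
          refine norm_sum_le_of_le _ (fun d _ => ?_)
          calc _ ≤ ∑ c : ZMod q, (1 : ℝ) := norm_sum_le_of_le _ (fun c _ => hG _ _)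
            _ = q := by simp [ZMod.card]
      _ = (L % q : ℕ) * q := by simp
      _ ≤ q * q := by gcongr
  have b2 : ‖∑ c ∈ Finset.range (L % q), ∑ d ∈ Finset.range L, G (c : ZMod q) (d : ZMod q)‖ ≤ q * L := by
    calc _ ≤ ∑ c ∈ Finset.range (L % q), (L : ℝ) := by
          refine norm_sum_le_of_le _ (fun d _ => ?_)
          calc _ ≤ ∑ d ∈ Finset.range L, (1 : ℝ) := norm_sum_le_of_le _ (fun c _ => hG _ _)
            _ = L := by simp
      _ = (L % q : ℕ) * L := by simp
      _ ≤ q * L := by gcongr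
  have b3 : ((L / q : ℕ) : ℝ) * q ≤ L := by exact_mod_cast Nat.div_mul_le_self L q
  calc _ ≤ ((L / q : ℕ) : ℝ) * (q * q) + q * L := by
        refine (norm_add_le _ _).trans ?_
        gcongr
        rw [norm_mul, Complex.norm_natCast]
        gcongr
    _ = (((L / q : ℕ) : ℝ) * q) * q + q * L := by ring
    _ ≤ L * q + q * L := by gcongr
    _ = _ := by ring

/-- Elements of the box. -/
def spinPt (x : ℕ × ℕ) : ℤ√2 := ⟨(x.1 : ℤ), (x.2 : ℤ)⟩

lemma spin_pair_sum (w1 w2 : ℤ√2) (h1 : 0 < w1.norm) (h2 : 0 < w2.norm) (o1 : Odd w1.norm) (o2 : Odd w2.norm)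
    (hs : ¬ IsSquare (w1.norm.toNat * w2.norm.toNat)) (L : ℕ) :
    ‖∑ x ∈ Finset.range L ×ˢ Finset.range L, ((spinGam w1 (spinPt x) : ℂ) * (spinGam w2 (spinPt x) : ℂ))‖ ≤
      2 * ((w1.norm.toNat * w2.norm.toNat : ℕ) : ℝ) * L := by
  obtain ⟨m1, hm1⟩ := Int.eq_ofNat_of_zero_le h1.le
  obtain ⟨m2, hm2⟩ := Int.eq_ofNat_of_zero_le h2.le
  have e1 : w1.norm.toNat = m1 := by omega
  have e2 : w2.norm.toNat = m2 := by omega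
  rw [e1, e2] at hs ⊢
  have o1' : Odd m1 := by rw [hm1] at o1; exact_mod_cast o1
  have o2' : Odd m2 := by rw [hm2] at o2; exact_mod_cast o2
  have : NeZero m1 := ⟨by rintro rfl; simp at o1'⟩
  have : NeZero m2 := ⟨by rintro rfl; simp at o2'⟩
  have : NeZero (m1 * m2) := ⟨mul_ne_zero (NeZero.ne _) (NeZero.ne _)⟩
  set f1 := ZMod.castHom (dvd_mul_right m1 m2) (ZMod m1) with hf1
  set f2 := ZMod.castHom (dvd_mul_left m2 m1) (ZMod m2) with hf2
  set G : ZMod (m1 * m2) → ZMod (m1 * m2) → ℂ := fun c d =>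
    spinJ m1 (f1 (w1.re * d + w1.im * c)) * spinJ m2 (f2 (w2.re * d + w2.im * c)) with hGdef
  have hG : ∀ c d, ‖G c d‖ ≤ 1 := by
    intro c d
    rw [hGdef, norm_mul]
    exact mul_le_one₀ (spinJ_norm _ _) (norm_nonneg _) (spinJ_norm _ _)
  have h0 : ∑ c : ZMod (m1 * m2), ∑ d : ZMod (m1 * m2), G c d = 0 := by
    obtain ⟨t, ht⟩ := spin_exists_nonres (m1 * m2) (o1'.mul o2') hs
    have hu : IsUnit (t : ZMod (m1 * m2)) := by
      rw [ZMod.coe_int_isUnit_iff_isCoprime]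
      by_contra h
      have := (jacobiSym.eq_zero_iff_not_coprime (a := t) (b := m1 * m2)).2 (by
        rw [Int.isCoprime_iff_gcd_eq_one] at h
        rwa [Int.gcd_comm])
      rw [this] at ht; norm_num at ht
    obtain ⟨T, hT⟩ := hu
    have hsc : ∀ c d, G ((T : ZMod (m1 * m2)) * c) ((T : ZMod (m1 * m2)) * d) = - G c d := by
      intro c d
      rw [hGdef]
      simp only
      have a1 : (w1.re : ZMod (m1 * m2)) * (T * d) + w1.im * (T * c) = T * (w1.re * d + w1.im * c) := by ring
      have a2 : (w2.re : ZMod (m1 * m2)) * (T * d) + w2.im * (T * c) = T * (w2.re * d + w2.im * c) := by ring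
      rw [a1, a2, map_mul f1, map_mul f2, spinJ_mul, spinJ_mul, hT, map_intCast, map_intCast, spinJ_intCast, spinJ_intCast]
      rw [jacobiSym.mul_right] at ht
      have ht' : ((jacobiSym t m1 : ℤ) : ℂ) * ((jacobiSym t m2 : ℤ) : ℂ) = -1 := by exact_mod_cast ht
      linear_combination (spinJ m1 (f1 (w1.re * d + w1.im * c)) * spinJ m2 (f2 (w2.re * d + w2.im * c))) * ht'
    have h3 : ∑ c : ZMod (m1 * m2), ∑ d : ZMod (m1 * m2), G ((T : ZMod (m1 * m2)) * c) ((T : ZMod (m1 * m2)) * d) =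
        ∑ c : ZMod (m1 * m2), ∑ d : ZMod (m1 * m2), G c d := by
      have s1 : ∀ c, ∑ d : ZMod (m1 * m2), G ((T : ZMod (m1 * m2)) * c) ((T : ZMod (m1 * m2)) * d) =
          ∑ d : ZMod (m1 * m2), G ((T : ZMod (m1 * m2)) * c) d := fun c =>
        Equiv.sum_comp (Units.mulLeft T) (fun d => G ((T : ZMod (m1 * m2)) * c) d)
      rw [Finset.sum_congr rfl (fun c _ => s1 c)]
      exact Equiv.sum_comp (Units.mulLeft T) (fun c => ∑ d : ZMod (m1 * m2), G c d)
    simp_rw [hsc] at h3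
    simp only [Finset.sum_neg_distrib] at h3
    linear_combination (-1/2 : ℂ) * h3
  have := spin_box_sum G hG h0 L
  rw [Finset.sum_product]
  refine le_trans (le_of_eq ?_) this
  congr 1
  apply Finset.sum_congr rfl; intro c _
  apply Finset.sum_congr rfl; intro d _
  rw [hGdef]
  simp only
  have g1 : f1 ((w1.re : ZMod (m1 * m2)) * (d : ZMod (m1 * m2)) + w1.im * (c : ZMod (m1 * m2))) = ((w1.re * d + w1.im * c : ℤ) : ZMod m1) := by
    push_cast; simp only [map_add, map_mul, map_intCast, map_natCast]
  have g2 : f2 ((w2.re : ZMod (m1 * m2)) * (d : ZMod (m1 * m2)) + w2.im * (c : ZMod (m1 * m2))) = ((w2.re * d + w2.im * c : ℤ) : ZMod m2) := by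
    push_cast; simp only [map_add, map_mul, map_intCast, map_natCast]
  rw [g1, g2, spinJ_intCast, spinJ_intCast]
  unfold spinGam spinPt
  rw [e1, e2]
  simp

open Classical in
/-- Primitive elements of norm dividing `n`. -/
noncomputable def spinDiv (n : ℕ) : Finset (ℤ√2) := n.divisors.biUnion (fun d => (spinDS d).filter spinPr)

lemma spinDiv_card (n : ℕ) (hn : Odd n) : (spinDiv n).card ≤ n.divisors.card ^ 2 := by
  classical
  have hn0 : n ≠ 0 := by rintro rfl; simp at hn
  unfold spinDiv
  refine Finset.card_biUnion_le.trans ?_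
  rw [sq, ← smul_eq_mul]
  apply Finset.sum_le_card_nsmul
  intro d hd
  have hdn := Nat.dvd_of_mem_divisors hd
  refine (spinDS_card d (Odd.of_dvd_nat hn hdn)).trans ?_
  exact Finset.card_le_card (Nat.divisors_subset_of_dvd hn0 hdn)

lemma mem_spinDiv {n : ℕ} (hn : n ≠ 0) {w : ℤ√2} (h : spinD w) (hp : spinPr w) (hd : w.norm ∣ (n : ℤ)) : w ∈ spinDiv n := by
  classical
  unfold spinDiv
  rw [Finset.mem_biUnion]
  have hpos := spinD_norm_pos h
  refine ⟨w.norm.toNat, ?_, ?_⟩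
  · rw [Nat.mem_divisors]
    refine ⟨?_, hn⟩
    rw [← Int.natCast_dvd_natCast, Int.toNat_of_nonneg hpos.le]; exact hd
  · rw [Finset.mem_filter, mem_spinDS, Int.toNat_of_nonneg hpos.le]
    exact ⟨⟨h, rfl⟩, hp⟩

/-- Admissible families. -/
def spinAdm (W : Finset (ℤ√2)) (M : ℕ) : Prop := ∀ w ∈ W, spinD w ∧ spinPr w ∧ Odd w.norm ∧ w.norm ≤ M

lemma spinD_count (W : Finset (ℤ√2)) (M : ℕ) (hM : 1 ≤ M) (h : ∀ w ∈ W, spinD w ∧ w.norm ≤ M) : W.card ≤ 36 * M := by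
  set s := Nat.sqrt (9 * M) with hs
  have h1 : W.card ≤ (Finset.range (s + 1) ×ˢ Finset.range (s + 1)).card := by
    apply Finset.card_le_card_of_injOn (fun w => (w.re.toNat, w.im.toNat))
    · intro w hw
      obtain ⟨hD, hn⟩ := h w hw
      have h2 := spinD_re_sq hD
      obtain ⟨a1, a2, a3⟩ := hD
      have h3 : w.re.toNat ≤ s := by
        rw [hs, Nat.le_sqrt']
        zify
        rw [Int.toNat_of_nonneg a1.le]
        push_cast at *
        linarith
      simp only [Finset.coe_product, Set.mem_prod, Finset.mem_coe, Finset.mem_range]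
      omega
    · intro w hw z hz hwz
      obtain ⟨⟨a1, a2, a3⟩, -⟩ := h w hw
      obtain ⟨⟨b1, b2, b3⟩, -⟩ := h z hz
      simp only [Prod.mk.injEq] at hwz
      ext <;> omega
  rw [Finset.card_product, Finset.card_range] at h1
  have h2 : s * s ≤ 9 * M := Nat.sqrt_le _
  have h3 : 1 ≤ s := by rw [hs, Nat.le_sqrt]; omega
  nlinarith

lemma spin_square_pairs (W : Finset (ℤ√2)) (M : ℕ) (hM : 1 ≤ M) (h : spinAdm W M) (K : ℝ) (hK : 0 ≤ K)
    (hτ : ∀ s : ℕ, s ≤ M → ((s ^ 2).divisors.card : ℝ) ≤ K) :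
    (((W ×ˢ W).filter (fun p => IsSquare (p.1.norm.toNat * p.2.norm.toNat))).card : ℝ) ≤ M * K ^ 4 := by
  classical
  set S := (W ×ˢ W).filter (fun p => IsSquare (p.1.norm.toNat * p.2.norm.toNat)) with hS
  have hmap : ∀ p ∈ S, Nat.sqrt (p.1.norm.toNat * p.2.norm.toNat) ∈ Finset.Icc 1 M := by
    intro p hp
    rw [hS, Finset.mem_filter, Finset.mem_product] at hp
    obtain ⟨d1, -, -, l1⟩ := h _ hp.1.1
    obtain ⟨d2, -, -, l2⟩ := h _ hp.1.2
    have p1 := spinD_norm_pos d1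
    have p2 := spinD_norm_pos d2
    rw [Finset.mem_Icc, Nat.le_sqrt]
    constructor
    · have : 0 < p.1.norm.toNat * p.2.norm.toNat := Nat.mul_pos (by omega) (by omega)
      omega
    · have : p.1.norm.toNat * p.2.norm.toNat ≤ M * M := Nat.mul_le_mul (by omega) (by omega)
      calc _ ≤ Nat.sqrt (M * M) := Nat.sqrt_le_sqrt this
        _ = M := Nat.sqrt_eq M
  rw [Finset.card_eq_sum_card_fiberwise hmap]
  push_cast
  calc _ ≤ ∑ s ∈ Finset.Icc 1 M, K ^ 4 := by
        apply Finset.sum_le_sum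
        intro s hs
        rw [Finset.mem_Icc] at hs
        have hs0 : s ^ 2 ≠ 0 := pow_ne_zero _ (by omega)
        by_cases ho : Odd s
        · have hsub : (S.filter (fun p => Nat.sqrt (p.1.norm.toNat * p.2.norm.toNat) = s)) ⊆ spinDiv (s ^ 2) ×ˢ spinDiv (s ^ 2) := by
            intro p hp
            rw [Finset.mem_filter, hS, Finset.mem_filter, Finset.mem_product] at hp
            obtain ⟨⟨⟨q1, q2⟩, ⟨r, hr⟩⟩, hq⟩ := hp
            obtain ⟨d1, r1, -, l1⟩ := h _ q1
            obtain ⟨d2, r2, -, l2⟩ := h _ q2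
            rw [hr, Nat.sqrt_eq] at hq
            have e : ((s ^ 2 : ℕ) : ℤ) = p.1.norm * p.2.norm := by
              rw [← Int.toNat_of_nonneg (spinD_norm_pos d1).le, ← Int.toNat_of_nonneg (spinD_norm_pos d2).le, ← Nat.cast_mul, hr, hq, sq]
            rw [Finset.mem_product]
            exact ⟨mem_spinDiv hs0 d1 r1 (by rw [e]; exact dvd_mul_right _ _), mem_spinDiv hs0 d2 r2 (by rw [e]; exact dvd_mul_left _ _)⟩
          have hc := Finset.card_le_card hsub
          rw [Finset.card_product] at hc
          have hc2 := spinDiv_card (s ^ 2) ho.pow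
          have hc3 : (S.filter (fun p => Nat.sqrt (p.1.norm.toNat * p.2.norm.toNat) = s)).card ≤ ((s ^ 2).divisors.card ^ 2) * ((s ^ 2).divisors.card ^ 2) :=
            hc.trans (Nat.mul_le_mul hc2 hc2)
          calc ((S.filter (fun p => Nat.sqrt (p.1.norm.toNat * p.2.norm.toNat) = s)).card : ℝ) ≤ ((s ^ 2).divisors.card : ℝ) ^ 4 := by
                have : ((s ^ 2).divisors.card : ℝ) ^ 4 = (((s ^ 2).divisors.card ^ 2) * ((s ^ 2).divisors.card ^ 2) : ℕ) := by push_cast; ring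
                rw [this]; exact_mod_cast hc3
            _ ≤ K ^ 4 := by gcongr; exact hτ s hs.2
        · have : (S.filter (fun p => Nat.sqrt (p.1.norm.toNat * p.2.norm.toNat) = s)) = ∅ := by
            rw [Finset.filter_eq_empty_iff]
            intro p hp hq
            rw [hS, Finset.mem_filter, Finset.mem_product] at hp
            obtain ⟨⟨q1, q2⟩, ⟨r, hr⟩⟩ := hp
            obtain ⟨d1, -, o1, -⟩ := h _ q1
            obtain ⟨d2, -, o2, -⟩ := h _ q2
            rw [hr, Nat.sqrt_eq] at hq
            have c1 : Odd p.1.norm.toNat := by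
              rw [Int.odd_iff] at o1; rw [Nat.odd_iff]; have := spinD_norm_pos d1; omega
            have c2 : Odd p.2.norm.toNat := by
              rw [Int.odd_iff] at o2; rw [Nat.odd_iff]; have := spinD_norm_pos d2; omega
            have := c1.mul c2
            rw [hr, hq] at this
            exact ho (Nat.odd_mul.1 this).1
          rw [this]; simp; positivity
    _ = M * K ^ 4 := by simp
end

section
lemma spin_size_mul {z w : ℤ√2} (h1 : 0 ≤ z.re) (h2 : 0 ≤ z.im) (h3 : 0 ≤ w.re) (h4 : 0 ≤ w.im) :
    0 ≤ (z * w).re ∧ 0 ≤ (z * w).im ∧ (z * w).re + 2 * (z * w).im ≤ (z.re + 2 * z.im) * (w.re + 2 * w.im) := by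
  simp only [Zsqrtd.re_mul, Zsqrtd.im_mul]
  have a1 := mul_nonneg h1 h3
  have a2 := mul_nonneg h1 h4
  have a3 := mul_nonneg h2 h3
  have a4 := mul_nonneg h2 h4
  refine ⟨?_, ?_, ?_⟩ <;> nlinarith

lemma spin_size_prod {ι : Type} (s : Finset ι) (p : ι → ℤ√2) (N : ℤ) (hN : 0 ≤ N) (hp : ∀ i ∈ s, spinD (p i) ∧ (p i).norm ≤ N) :
    0 ≤ (∏ i ∈ s, p i).re ∧ 0 ≤ (∏ i ∈ s, p i).im ∧
      ((∏ i ∈ s, p i).re + 2 * (∏ i ∈ s, p i).im) ^ 2 ≤ (49 * N) ^ s.card := by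
  classical
  induction s using Finset.induction_on with
  | empty => simp
  | insert a s ha ih =>
    obtain ⟨i1, i2, i3⟩ := ih (fun i hi => hp i (Finset.mem_insert_of_mem hi))
    obtain ⟨hD, hn⟩ := hp a (Finset.mem_insert_self _ _)
    have hre := spinD_re_sq hD
    obtain ⟨d1, d2, d3⟩ := hD
    obtain ⟨m1, m2, m3⟩ := spin_size_mul d1.le d2 i1 i2
    rw [Finset.prod_insert ha, Finset.card_insert_of_notMem ha]
    refine ⟨m1, m2, ?_⟩
    have e : ((p a).re + 2 * (p a).im) ^ 2 ≤ 49 * N := by nlinarith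
    calc _ ≤ (((p a).re + 2 * (p a).im) * ((∏ i ∈ s, p i).re + 2 * (∏ i ∈ s, p i).im)) ^ 2 := by
          apply pow_le_pow_left₀ _ m3; linarith
      _ = ((p a).re + 2 * (p a).im) ^ 2 * ((∏ i ∈ s, p i).re + 2 * (∏ i ∈ s, p i).im) ^ 2 := by ring
      _ ≤ (49 * N) * (49 * N) ^ s.card := by
          apply mul_le_mul e i3 (sq_nonneg _); linarith
      _ = _ := by ring

lemma spin_norm_prod {ι : Type} (s : Finset ι) (p : ι → ℤ√2) : (∏ i ∈ s, p i).norm = ∏ i ∈ s, (p i).norm := by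
  classical
  induction s using Finset.induction_on with
  | empty => simp
  | insert a s ha ih => rw [Finset.prod_insert ha, Finset.prod_insert ha, Zsqrtd.norm_mul, ih]

/-- Fibre count of the product map. -/
lemma spin_fiber6 (Z : Finset (ℤ√2)) (N : ℕ) (hZ : spinAdm Z N) (Rr : ℝ) (hR : 0 ≤ Rr)
    (hτ : ∀ n : ℕ, n ≤ N ^ 6 → ((n.divisors.card : ℝ)) ≤ Rr) (x : ℤ√2) :
    (((Fintype.piFinset (fun _ : Fin 6 => Z)).filter (fun p => ∏ i, p i = x)).card : ℝ) ≤ Rr ^ 12 := by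
  classical
  rcases Finset.eq_empty_or_nonempty ((Fintype.piFinset (fun _ : Fin 6 => Z)).filter (fun p => ∏ i, p i = x)) with he | ⟨p0, hp0⟩
  · rw [he]; simp; positivity
  · have key : ∀ p : Fin 6 → ℤ√2, p ∈ (Fintype.piFinset (fun _ : Fin 6 => Z)).filter (fun p => ∏ i, p i = x) →
        (∀ i, p i ∈ Z) ∧ x.norm = ∏ i, (p i).norm := by
      intro p hp
      rw [Finset.mem_filter, Fintype.mem_piFinset] at hp
      exact ⟨hp.1, by rw [← hp.2, spin_norm_prod]⟩
    obtain ⟨k1, k2⟩ := key p0 hp0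
    have hpos : 0 < x.norm := by
      rw [k2]; exact Finset.prod_pos (fun i _ => spinD_norm_pos (hZ _ (k1 i)).1)
    have hle : x.norm ≤ (N : ℤ) ^ 6 := by
      rw [k2]
      calc _ ≤ ∏ i : Fin 6, (N : ℤ) := Finset.prod_le_prod (fun i _ => (spinD_norm_pos (hZ _ (k1 i)).1).le) (fun i _ => (hZ _ (k1 i)).2.2.2)
        _ = _ := by simp
    have hodd : Odd x.norm := by
      rw [k2]; exact Finset.prod_induction _ Odd (fun a b ha hb => ha.mul hb) odd_one (fun i _ => (hZ _ (k1 i)).2.2.1)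
    obtain ⟨n, hn⟩ := Int.eq_ofNat_of_zero_le hpos.le
    rw [hn] at hpos hle hodd
    have hn0 : n ≠ 0 := by rintro rfl; simp at hpos
    have hodd' : Odd n := by exact_mod_cast hodd
    have hsub : (Fintype.piFinset (fun _ : Fin 6 => Z)).filter (fun p => ∏ i, p i = x) ⊆ Fintype.piFinset (fun _ : Fin 6 => spinDiv n) := by
      intro p hp
      obtain ⟨q1, q2⟩ := key p hp
      rw [Fintype.mem_piFinset]
      intro i
      refine mem_spinDiv hn0 (hZ _ (q1 i)).1 (hZ _ (q1 i)).2.1 ?_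
      rw [← hn, q2]
      exact Finset.dvd_prod_of_mem _ (Finset.mem_univ i)
    have hc := Finset.card_le_card hsub
    rw [Fintype.card_piFinset] at hc
    simp only [Finset.prod_const, Finset.card_univ, Fintype.card_fin] at hc
    have hc2 := hc.trans (Nat.pow_le_pow_left (spinDiv_card n hodd') 6)
    rw [← pow_mul] at hc2
    calc _ ≤ ((n.divisors.card : ℝ)) ^ 12 := by exact_mod_cast hc2
      _ ≤ _ := by gcongr; exact hτ n (by exact_mod_cast hle)

lemma spin_moment (W Z : Finset (ℤ√2)) (M N : ℕ) (hW : spinAdm W M) (hZ : spinAdm Z N) (β : ℤ√2 → ℂ) (hβ : ∀ z, ‖β z‖ ≤ 1)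
    (Rr : ℝ) (hR : 0 ≤ Rr) (hτ : ∀ n : ℕ, n ≤ N ^ 6 → ((n.divisors.card : ℝ)) ≤ Rr) :
    ∃ θ : ℤ√2 → ℂ, (∀ w, ‖θ w‖ ≤ 1) ∧ ∑ w ∈ W, ‖∑ z ∈ Z, β z * (spinGam w z : ℂ)‖ ^ 6 ≤
      Rr ^ 12 * ∑ x ∈ Finset.range (49 ^ 3 * N ^ 3 + 1) ×ˢ Finset.range (49 ^ 3 * N ^ 3 + 1), ‖∑ w ∈ W, θ w * (spinGam w (spinPt x) : ℂ)‖ := by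
  classical
  set S : ℤ√2 → ℂ := fun w => ∑ z ∈ Z, β z * (spinGam w z : ℂ) with hS
  have hθ0 : ∀ w, ∃ t : ℂ, ‖t‖ ≤ 1 ∧ t * S w ^ 6 = (‖S w‖ ^ 6 : ℝ) := by
    intro w
    by_cases h : S w = 0
    · exact ⟨0, by simp, by simp [h]⟩
    · refine ⟨(‖S w ^ 6‖ : ℂ) / S w ^ 6, ?_, ?_⟩
      · rw [norm_div, Complex.norm_real, norm_norm, div_self]
        exact norm_ne_zero_iff.2 (pow_ne_zero _ h)
      · rw [div_mul_cancel₀ _ (pow_ne_zero _ h), norm_pow]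
  choose θ0 hθ1 hθ2 using hθ0
  set θ : ℤ√2 → ℂ := fun w => θ0 w * (jacobiSym w.im w.norm.toNat : ℂ) ^ 7 with hθ
  refine ⟨θ, ?_, ?_⟩
  · intro w
    rw [hθ, norm_mul, norm_pow]
    exact mul_le_one₀ (hθ1 w) (by positivity) (pow_le_one₀ (norm_nonneg _) (spin_jacobi_norm_le _ _))
  set U : ℤ√2 → ℂ := fun z => ∑ w ∈ W, θ w * (spinGam w z : ℂ) with hU
  set PP := Fintype.piFinset (fun _ : Fin 6 => Z) with hPP
  have hexp : ∀ w ∈ W, ((‖S w‖ ^ 6 : ℝ) : ℂ) = ∑ p ∈ PP, (∏ i, β (p i)) * (θ w * (spinGam w (∏ i, p i) : ℂ)) := by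
    intro w hw
    rw [← hθ2, hS]
    simp only
    rw [Finset.sum_pow', Finset.mul_sum]
    apply Finset.sum_congr rfl
    intro p _
    have := spinGam_prod Finset.univ w (spinD_norm_pos (hW w hw).1) (hW w hw).2.1 p
    rw [Finset.prod_mul_distrib]
    have h2 : (∏ i, (spinGam w (p i) : ℂ)) = (jacobiSym w.im w.norm.toNat : ℂ) ^ 7 * (spinGam w (∏ i, p i) : ℂ) := by
      have h3 : ((∏ i, spinGam w (p i) : ℤ) : ℂ) = ((jacobiSym w.im w.norm.toNat ^ (Finset.card (Finset.univ : Finset (Fin 6)) + 1) * spinGam w (∏ i, p i) : ℤ) : ℂ) := by rw [this]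
      push_cast at h3
      rw [h3]; simp
    rw [h2, hθ]; ring
  have hsum : ((∑ w ∈ W, ‖S w‖ ^ 6 : ℝ) : ℂ) = ∑ p ∈ PP, (∏ i, β (p i)) * U (∏ i, p i) := by
    rw [Complex.ofReal_sum, Finset.sum_congr rfl hexp, Finset.sum_comm]
    apply Finset.sum_congr rfl
    intro p _
    rw [hU, Finset.mul_sum]
  have hle : ∑ w ∈ W, ‖S w‖ ^ 6 ≤ ∑ p ∈ PP, ‖U (∏ i, p i)‖ := by
    have h0 : 0 ≤ ∑ w ∈ W, ‖S w‖ ^ 6 := by positivity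
    have : ‖((∑ w ∈ W, ‖S w‖ ^ 6 : ℝ) : ℂ)‖ = ∑ w ∈ W, ‖S w‖ ^ 6 := by
      rw [Complex.norm_real, Real.norm_of_nonneg h0]
    rw [← this, hsum]
    refine norm_sum_le_of_le _ (fun p _ => ?_)
    rw [norm_mul]
    refine mul_le_of_le_one_left (norm_nonneg _) ?_
    rw [norm_prod]
    exact Finset.prod_le_one (fun i _ => norm_nonneg _) (fun i _ => hβ _)
  refine hle.trans ?_
  set B := Finset.range (49 ^ 3 * N ^ 3 + 1) ×ˢ Finset.range (49 ^ 3 * N ^ 3 + 1) with hB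
  have hfac : ∀ p ∈ PP, 0 ≤ (∏ i, p i).re ∧ 0 ≤ (∏ i, p i).im ∧
      ((∏ i, p i).re + 2 * (∏ i, p i).im) ^ 2 ≤ (49 * (N : ℤ)) ^ 6 := by
    intro p hp
    rw [hPP, Fintype.mem_piFinset] at hp
    have := spin_size_prod Finset.univ p N (by positivity) (fun i _ => ⟨(hZ _ (hp i)).1, (hZ _ (hp i)).2.2.2⟩)
    simpa using this
  have hmaps : ∀ p ∈ PP, ((∏ i, p i).re.toNat, (∏ i, p i).im.toNat) ∈ B := by
    intro p hp
    obtain ⟨f1, f2, f3⟩ := hfac p hp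
    have f4 : (∏ i, p i).re + 2 * (∏ i, p i).im ≤ 49 ^ 3 * (N : ℤ) ^ 3 := by
      apply le_of_sq_le_sq _ (by positivity)
      calc _ ≤ _ := f3
        _ = _ := by ring
    have f5 : ((49 ^ 3 * N ^ 3 : ℕ) : ℤ) = 49 ^ 3 * (N : ℤ) ^ 3 := by push_cast; ring
    rw [hB, Finset.mem_product, Finset.mem_range, Finset.mem_range]
    simp only
    omega
  rw [← Finset.sum_fiberwise_of_maps_to hmaps, Finset.mul_sum]
  apply Finset.sum_le_sum
  intro x _
  have heq : ∀ p ∈ PP, ((∏ i, p i).re.toNat, (∏ i, p i).im.toNat) = x → ∏ i, p i = spinPt x := by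
    intro p hp hx
    obtain ⟨f1, f2, f3⟩ := hfac p hp
    rw [← hx, spinPt]
    ext
    · simp only; rw [Int.toNat_of_nonneg f1]
    · simp only; rw [Int.toNat_of_nonneg f2]
  calc _ ≤ ∑ p ∈ PP.filter (fun p => ((∏ i, p i).re.toNat, (∏ i, p i).im.toNat) = x), ‖U (spinPt x)‖ := by
        apply Finset.sum_le_sum
        intro p hp
        rw [Finset.mem_filter] at hp
        rw [heq p hp.1 hp.2]
    _ ≤ ∑ p ∈ PP.filter (fun p => ∏ i, p i = spinPt x), ‖U (spinPt x)‖ := by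
        apply Finset.sum_le_sum_of_subset_of_nonneg
        · intro p hp
          rw [Finset.mem_filter] at hp ⊢
          exact ⟨hp.1, heq p hp.1 hp.2⟩
        · intros; positivity
    _ ≤ _ := by
        rw [Finset.sum_const, nsmul_eq_mul]
        gcongr
        exact spin_fiber6 Z N hZ Rr hR hτ _
end

section
lemma spin_energy (W : Finset (ℤ√2)) (M : ℕ) (hM : 1 ≤ M) (hW : spinAdm W M) (θ : ℤ√2 → ℂ) (hθ : ∀ w, ‖θ w‖ ≤ 1)
    (K : ℝ) (hK : 0 ≤ K) (hτ : ∀ s : ℕ, s ≤ M → ((s ^ 2).divisors.card : ℝ) ≤ K) (L : ℕ) (hL : M ^ 3 ≤ L) :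
    ∑ x ∈ Finset.range L ×ˢ Finset.range L, ‖∑ w ∈ W, θ w * (spinGam w (spinPt x) : ℂ)‖ ^ 2 ≤ (L : ℝ) ^ 2 * M * (2592 + K ^ 4) := by
  classical
  set B := Finset.range L ×ˢ Finset.range L with hB
  set G : ℤ√2 → ℤ√2 → ℂ := fun w1 w2 => ∑ x ∈ B, ((spinGam w1 (spinPt x) : ℂ) * (spinGam w2 (spinPt x) : ℂ)) with hG
  have h1 : ((∑ x ∈ B, ‖∑ w ∈ W, θ w * (spinGam w (spinPt x) : ℂ)‖ ^ 2 : ℝ) : ℂ) =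
      ∑ p ∈ W ×ˢ W, (θ p.1 * (starRingEnd ℂ) (θ p.2)) * G p.1 p.2 := by
    rw [Complex.ofReal_sum]
    have : ∀ x ∈ B, ((‖∑ w ∈ W, θ w * (spinGam w (spinPt x) : ℂ)‖ ^ 2 : ℝ) : ℂ) =
        ∑ p ∈ W ×ˢ W, (θ p.1 * (starRingEnd ℂ) (θ p.2)) * ((spinGam p.1 (spinPt x) : ℂ) * (spinGam p.2 (spinPt x) : ℂ)) := by
      intro x _
      rw [Complex.ofReal_pow, ← Complex.mul_conj', map_sum, Finset.sum_mul_sum, Finset.sum_product]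
      apply Finset.sum_congr rfl; intro w1 _
      apply Finset.sum_congr rfl; intro w2 _
      rw [map_mul (starRingEnd ℂ), map_intCast]
      ring
    rw [Finset.sum_congr rfl this, Finset.sum_comm]
    apply Finset.sum_congr rfl; intro p _
    rw [hG, Finset.mul_sum]
  have h0 : 0 ≤ ∑ x ∈ B, ‖∑ w ∈ W, θ w * (spinGam w (spinPt x) : ℂ)‖ ^ 2 := by positivity
  have h2 : ∑ x ∈ B, ‖∑ w ∈ W, θ w * (spinGam w (spinPt x) : ℂ)‖ ^ 2 ≤ ∑ p ∈ W ×ˢ W, ‖G p.1 p.2‖ := by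
    have : ‖((∑ x ∈ B, ‖∑ w ∈ W, θ w * (spinGam w (spinPt x) : ℂ)‖ ^ 2 : ℝ) : ℂ)‖ = ∑ x ∈ B, ‖∑ w ∈ W, θ w * (spinGam w (spinPt x) : ℂ)‖ ^ 2 := by
      rw [Complex.norm_real, Real.norm_of_nonneg h0]
    rw [← this, h1]
    refine norm_sum_le_of_le _ (fun p _ => ?_)
    rw [norm_mul, norm_mul, RCLike.norm_conj]
    exact mul_le_of_le_one_left (norm_nonneg _) (mul_le_one₀ (hθ _) (norm_nonneg _) (hθ _))
  refine h2.trans ?_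
  rw [← Finset.sum_filter_add_sum_filter_not (W ×ˢ W) (fun p => IsSquare (p.1.norm.toNat * p.2.norm.toNat))]
  have hL' : (M : ℝ) ^ 3 ≤ L := by exact_mod_cast hL
  have hWc : (W.card : ℝ) ≤ 36 * M := by
    exact_mod_cast spinD_count W M hM (fun w hw => ⟨(hW w hw).1, (hW w hw).2.2.2⟩)
  have b1 : ∑ p ∈ (W ×ˢ W).filter (fun p => IsSquare (p.1.norm.toNat * p.2.norm.toNat)), ‖G p.1 p.2‖ ≤ M * K ^ 4 * (L : ℝ) ^ 2 := by
    calc _ ≤ ∑ p ∈ (W ×ˢ W).filter (fun p => IsSquare (p.1.norm.toNat * p.2.norm.toNat)), (L : ℝ) ^ 2 := by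
          apply Finset.sum_le_sum
          intro p _
          calc _ ≤ ∑ x ∈ B, (1 : ℝ) := by
                refine norm_sum_le_of_le _ (fun x _ => ?_)
                rw [norm_mul]
                exact mul_le_one₀ (spin_jacobi_norm_le _ _) (norm_nonneg _) (spin_jacobi_norm_le _ _)
            _ = _ := by simp [hB]; ring
      _ ≤ _ := by
          rw [Finset.sum_const, nsmul_eq_mul]
          gcongr
          exact spin_square_pairs W M hM hW K hK hτ
  have b2 : ∑ p ∈ (W ×ˢ W).filter (fun p => ¬ IsSquare (p.1.norm.toNat * p.2.norm.toNat)), ‖G p.1 p.2‖ ≤ 2592 * M * (L : ℝ) ^ 2 := by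
    calc _ ≤ ∑ p ∈ (W ×ˢ W).filter (fun p => ¬ IsSquare (p.1.norm.toNat * p.2.norm.toNat)), 2 * ((M : ℝ) * M) * L := by
          apply Finset.sum_le_sum
          intro p hp
          rw [Finset.mem_filter, Finset.mem_product] at hp
          obtain ⟨a1, -, a3, a4⟩ := hW _ hp.1.1
          obtain ⟨c1, -, c3, c4⟩ := hW _ hp.1.2
          refine (spin_pair_sum p.1 p.2 (spinD_norm_pos a1) (spinD_norm_pos c1) a3 c3 hp.2 L).trans ?_
          have e1 : (p.1.norm.toNat : ℝ) ≤ M := by exact_mod_cast (by omega : p.1.norm.toNat ≤ M)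
          have e2 : (p.2.norm.toNat : ℝ) ≤ M := by exact_mod_cast (by omega : p.2.norm.toNat ≤ M)
          push_cast
          gcongr
      _ ≤ ∑ p ∈ W ×ˢ W, 2 * ((M : ℝ) * M) * L := by
          apply Finset.sum_le_sum_of_subset_of_nonneg (Finset.filter_subset _ _)
          intros; positivity
      _ = (W.card : ℝ) * W.card * (2 * ((M : ℝ) * M) * L) := by simp [Finset.card_product]
      _ ≤ (36 * M) * (36 * M) * (2 * ((M : ℝ) * M) * L) := by gcongr
      _ = 2592 * M * (M ^ 3 * L) := by ring
      _ ≤ 2592 * M * (L * L) := by gcongr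
      _ = _ := by ring
  calc _ ≤ _ := add_le_add b1 b2
    _ = _ := by ring

lemma spin_core0 (W Z : Finset (ℤ√2)) (M N : ℕ) (hM : 1 ≤ M) (hMN : M ≤ N) (hW : spinAdm W M) (hZ : spinAdm Z N)
    (α β : ℤ√2 → ℂ) (hα : ∀ z, ‖α z‖ ≤ 1) (hβ : ∀ z, ‖β z‖ ≤ 1)
    (Rr : ℝ) (hR : 0 ≤ Rr) (hτ : ∀ n : ℕ, n ≤ N ^ 6 → ((n.divisors.card : ℝ)) ≤ Rr)
    (K : ℝ) (hK : 1 ≤ K) (hτ2 : ∀ s : ℕ, s ≤ M → ((s ^ 2).divisors.card : ℝ) ≤ K) :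
    M * ‖∑ w ∈ W, ∑ z ∈ Z, α w * β z * (spinGam w z : ℂ)‖ ^ 12 ≤
      36 ^ 10 * (49 ^ 3 + 1) ^ 4 * 2593 * ((M : ℝ) * N) ^ 12 * (Rr ^ 24 * K ^ 4) := by
  obtain ⟨θ, hθ, hmom⟩ := spin_moment W Z M N hW hZ β hβ Rr hR hτ
  set S : ℤ√2 → ℝ := fun w => ‖∑ z ∈ Z, β z * (spinGam w z : ℂ)‖ with hS
  set L := 49 ^ 3 * N ^ 3 + 1 with hL
  set V := ∑ x ∈ Finset.range L ×ˢ Finset.range L, ‖∑ w ∈ W, θ w * (spinGam w (spinPt x) : ℂ)‖ with hV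
  have hMN' : (M : ℝ) ≤ N := by exact_mod_cast hMN
  have hM' : (1 : ℝ) ≤ M := by exact_mod_cast hM
  have hN1 : (1 : ℝ) ≤ N := hM'.trans hMN'
  have hML : M ^ 3 ≤ L := by
    have : M ^ 3 ≤ N ^ 3 := Nat.pow_le_pow_left hMN 3
    omega
  have hen := spin_energy W M hM hW θ hθ K (by linarith) hτ2 L hML
  have hWc : (W.card : ℝ) ≤ 36 * M := by
    exact_mod_cast spinD_count W M hM (fun w hw => ⟨(hW w hw).1, (hW w hw).2.2.2⟩)
  have hV0 : 0 ≤ V := by rw [hV]; positivity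
  have hV2 : V ^ 2 ≤ (L : ℝ) ^ 2 * ((L : ℝ) ^ 2 * M * (2592 + K ^ 4)) := by
    have := sq_sum_le_card_mul_sum_sq (s := Finset.range L ×ˢ Finset.range L) (f := fun x => ‖∑ w ∈ W, θ w * (spinGam w (spinPt x) : ℂ)‖)
    rw [Finset.card_product, Finset.card_range] at this
    refine this.trans ?_
    push_cast
    rw [← sq]
    gcongr
  have hL1 : (L : ℝ) ≤ (49 ^ 3 + 1) * N ^ 3 := by
    rw [hL]; push_cast
    have : (1 : ℝ) ≤ (N : ℝ) ^ 3 := one_le_pow₀ hN1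
    linarith
  have hT : ‖∑ w ∈ W, ∑ z ∈ Z, α w * β z * (spinGam w z : ℂ)‖ ≤ ∑ w ∈ W, S w := by
    refine norm_sum_le_of_le _ (fun w _ => ?_)
    have : ∑ z ∈ Z, α w * β z * (spinGam w z : ℂ) = α w * ∑ z ∈ Z, β z * (spinGam w z : ℂ) := by
      rw [Finset.mul_sum]; apply Finset.sum_congr rfl; intros; ring
    rw [this, norm_mul]
    exact mul_le_of_le_one_left (norm_nonneg _) (hα w)
  have hS0 : ∀ w, 0 ≤ S w := fun w => norm_nonneg _
  have hH : (∑ w ∈ W, S w) ^ 6 ≤ (W.card : ℝ) ^ 5 * ∑ w ∈ W, S w ^ 6 :=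
    pow_sum_le_card_mul_sum_pow (fun w _ => hS0 w) 5
  have h6 : ‖∑ w ∈ W, ∑ z ∈ Z, α w * β z * (spinGam w z : ℂ)‖ ^ 6 ≤ (36 * M) ^ 5 * (Rr ^ 12 * V) := by
    calc _ ≤ (∑ w ∈ W, S w) ^ 6 := by gcongr
      _ ≤ _ := hH
      _ ≤ _ := by gcongr
  have hK4 : 1 ≤ K ^ 4 := one_le_pow₀ hK
  calc (M : ℝ) * ‖∑ w ∈ W, ∑ z ∈ Z, α w * β z * (spinGam w z : ℂ)‖ ^ 12
      = M * (‖∑ w ∈ W, ∑ z ∈ Z, α w * β z * (spinGam w z : ℂ)‖ ^ 6) ^ 2 := by ring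
    _ ≤ M * ((36 * M) ^ 5 * (Rr ^ 12 * V)) ^ 2 := by gcongr
    _ = 36 ^ 10 * M ^ 11 * Rr ^ 24 * V ^ 2 := by ring
    _ ≤ 36 ^ 10 * M ^ 11 * Rr ^ 24 * ((L : ℝ) ^ 2 * ((L : ℝ) ^ 2 * M * (2592 + K ^ 4))) := by gcongr
    _ = 36 ^ 10 * M ^ 12 * Rr ^ 24 * ((L : ℝ) ^ 4 * (2592 + K ^ 4)) := by ring
    _ ≤ 36 ^ 10 * M ^ 12 * Rr ^ 24 * (((49 ^ 3 + 1) * N ^ 3) ^ 4 * (2593 * K ^ 4)) := by gcongr; linarith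
    _ = _ := by ring

lemma spin_core (δ : ℝ) (hδ : 0 < δ) : ∃ C : ℝ, 1 ≤ C ∧ ∀ (M N : ℕ), 1 ≤ M → M ≤ N → ∀ W Z : Finset (ℤ√2), spinAdm W M → spinAdm Z N →
    ∀ α β : ℤ√2 → ℂ, (∀ z, ‖α z‖ ≤ 1) → (∀ z, ‖β z‖ ≤ 1) →
    M * ‖∑ w ∈ W, ∑ z ∈ Z, α w * β z * (spinGam w z : ℂ)‖ ^ 12 ≤ C * ((M : ℝ) * N) ^ 12 * (N : ℝ) ^ δ := by
  obtain ⟨C1, hC1, hτ⟩ := spin_divisor_bound (δ / 152) (by positivity)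
  refine ⟨36 ^ 10 * (49 ^ 3 + 1) ^ 4 * 2593 * C1 ^ 28, ?_, ?_⟩
  · have : 1 ≤ C1 ^ 28 := one_le_pow₀ hC1
    nlinarith
  intro M N hM hMN W Z hW hZ α β hα hβ
  have hN1 : (1 : ℝ) ≤ N := by exact_mod_cast hM.trans hMN
  have hN0 : (0 : ℝ) ≤ N := by linarith
  have := spin_core0 W Z M N hM hMN hW hZ α β hα hβ (C1 * ((N : ℝ) ^ 6) ^ (δ / 152)) (by positivity) ?_
    (C1 * ((N : ℝ) ^ 2) ^ (δ / 152)) ?_ ?_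
  · refine this.trans (le_of_eq ?_)
    have e1 : (((N : ℝ) ^ 6) ^ (δ / 152)) ^ 24 * (((N : ℝ) ^ 2) ^ (δ / 152)) ^ 4 = (N : ℝ) ^ δ := by
      rw [← Real.rpow_natCast (N : ℝ) 6, ← Real.rpow_natCast (N : ℝ) 2, ← Real.rpow_mul hN0, ← Real.rpow_mul hN0,
        ← Real.rpow_natCast, ← Real.rpow_natCast, ← Real.rpow_mul hN0, ← Real.rpow_mul hN0, ← Real.rpow_add (by linarith)]
      congr 1; push_cast; ring
    rw [← e1]; ring
  · intro n hn
    refine (hτ n).trans ?_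
    have : (n : ℝ) ≤ (N : ℝ) ^ 6 := by exact_mod_cast hn
    gcongr
  · have h2 : (1 : ℝ) ≤ ((N : ℝ) ^ 2) ^ (δ / 152) := Real.one_le_rpow (one_le_pow₀ hN1) (by positivity)
    nlinarith
  · intro s hs
    refine (hτ (s ^ 2)).trans ?_
    have h3 : (s : ℝ) ≤ N := by exact_mod_cast hs.trans hMN
    push_cast
    gcongr
end

section
/-- The spin coefficient. -/
noncomputable def spinA (n : ℕ) : ℤ := if n % 16 = 15 then ∑ W ∈ spinDS n, spinS W else 0

/-- All reduced elements of norm at most `M`. -/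
noncomputable def spinAll (M : ℕ) : Finset (ℤ√2) := by
  classical exact (Finset.range (M + 1)).biUnion spinDS

lemma mem_spinAll {M : ℕ} {w : ℤ√2} : w ∈ spinAll M ↔ spinD w ∧ w.norm ≤ M := by
  classical
  unfold spinAll
  rw [Finset.mem_biUnion]
  constructor
  · rintro ⟨m, hm, hw⟩
    rw [mem_spinDS] at hw
    rw [Finset.mem_range] at hm
    exact ⟨hw.1, by omega⟩
  · rintro ⟨h1, h2⟩
    have := spinD_norm_pos h1
    exact ⟨w.norm.toNat, by rw [Finset.mem_range]; omega, by rw [mem_spinDS]; exact ⟨h1, by omega⟩⟩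

lemma spinAll_sum {E : Type} [AddCommMonoid E] (M : ℕ) (F : ℕ → ℤ√2 → E) :
    ∑ m ∈ Finset.range (M + 1), ∑ w ∈ spinDS m, F m w = ∑ w ∈ spinAll M, F w.norm.toNat w := by
  classical
  unfold spinAll
  rw [Finset.sum_biUnion]
  · apply Finset.sum_congr rfl; intro m _
    apply Finset.sum_congr rfl; intro w hw
    rw [mem_spinDS] at hw
    rw [hw.2, Int.toNat_natCast]
  · intro a _ b _ hab
    rw [Function.onFun, Finset.disjoint_left]
    intro w h1 h2
    rw [mem_spinDS] at h1 h2
    exact hab (by have := h1.2.symm.trans h2.2; exact_mod_cast this)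

lemma spinTw_zero {w : ℤ√2} (h : spinD w) (hp : ¬ spinPr w) : spinTw w = 0 := by
  unfold spinPr at hp
  rw [Int.isCoprime_iff_gcd_eq_one, ] at hp
  obtain ⟨q, hq, hqd⟩ := Nat.exists_prime_and_dvd hp
  have h1 : (q : ℤ) ∣ w.re := (Int.natCast_dvd_natCast.2 hqd).trans (Int.gcd_dvd_left _ _)
  have h2 : (q : ℤ) ∣ w.im := (Int.natCast_dvd_natCast.2 hqd).trans (Int.gcd_dvd_right _ _)
  unfold spinTw
  obtain ⟨a1, a2, a3⟩ := h
  apply spin_jac_zero hq h2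
  · rw [← Int.natCast_dvd_natCast, Int.toNat_of_nonneg a1.le]; exact h1
  · omega

lemma spinA_mul_sum (M N : ℕ) (α β : ℕ → ℂ) :
    ∑ m ∈ Finset.range (M + 1), ∑ k ∈ Finset.range (N + 1), α m * β k * (spinA (m * k) : ℂ) =
    ∑ w ∈ spinAll M, ∑ z ∈ spinAll N, α w.norm.toNat * β z.norm.toNat *
      ((spinDel (spinCl w) (spinCl z) * (spinTw w * spinTw z * spinGam w z) : ℤ) : ℂ) := by
  have h1 : ∀ m k : ℕ, (spinA (m * k) : ℂ) = ∑ w ∈ spinDS m, ∑ z ∈ spinDS k,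
      ((spinDel (spinCl w) (spinCl z) * (spinTw w * spinTw z * spinGam w z) : ℤ) : ℂ) := by
    intro m k
    have h2 : ∀ w ∈ spinDS m, ∀ z ∈ spinDS k, spinDel (spinCl w) (spinCl z) * (spinTw w * spinTw z * spinGam w z) =
        if m * k % 16 = 15 then spinS (w * z) else 0 := by
      intro w hw z hz
      rw [mem_spinDS] at hw hz
      rw [← spinS_mul hw.1 hz.1, hw.2, hz.2]
      norm_cast
    rw [Finset.sum_congr rfl (fun w hw => Finset.sum_congr rfl (fun z hz => by rw [h2 w hw z hz]))]
    unfold spinA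
    split_ifs with h
    · rw [spinDS_mul m k h]; push_cast; rfl
    · simp
  simp_rw [h1]
  rw [← spinAll_sum M (fun m w => ∑ z ∈ spinAll N, α m * β z.norm.toNat *
      ((spinDel (spinCl w) (spinCl z) * (spinTw w * spinTw z * spinGam w z) : ℤ) : ℂ))]
  apply Finset.sum_congr rfl; intro m _
  have h3 : ∀ w ∈ spinDS m, ∑ z ∈ spinAll N, α m * β z.norm.toNat *
      ((spinDel (spinCl w) (spinCl z) * (spinTw w * spinTw z * spinGam w z) : ℤ) : ℂ) = ∑ k ∈ Finset.range (N + 1), ∑ z ∈ spinDS k,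
        α m * β k * ((spinDel (spinCl w) (spinCl z) * (spinTw w * spinTw z * spinGam w z) : ℤ) : ℂ) := fun w _ =>
    (spinAll_sum N (fun k z => α m * β k *
      ((spinDel (spinCl w) (spinCl z) * (spinTw w * spinTw z * spinGam w z) : ℤ) : ℂ))).symm
  rw [Finset.sum_congr rfl h3, Finset.sum_comm]
  apply Finset.sum_congr rfl; intro k _
  rw [Finset.mul_sum]
  apply Finset.sum_congr rfl; intro w _
  rw [Finset.mul_sum]

open Classical in
/-- Admissible elements. -/
noncomputable def spinAdmAll (M : ℕ) : Finset (ℤ√2) := (spinAll M).filter (fun w => spinPr w ∧ Odd w.norm)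

lemma spinAdmAll_adm (M : ℕ) : spinAdm (spinAdmAll M) M := by
  classical
  intro w hw
  unfold spinAdmAll at hw
  rw [Finset.mem_filter, mem_spinAll] at hw
  exact ⟨hw.1.1, hw.2.1, hw.2.2, hw.1.2⟩

lemma spin_term_zero {w z : ℤ√2} (hw : spinD w) (hz : spinD z) (h : ¬ ((spinPr w ∧ Odd w.norm) ∧ (spinPr z ∧ Odd z.norm))) :
    spinDel (spinCl w) (spinCl z) * (spinTw w * spinTw z * spinGam w z) = 0 := by
  by_cases h1 : spinPr w
  · by_cases h2 : spinPr z
    · have h3 : ¬ (w.norm * z.norm) % 16 = 15 := by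
        intro h4
        have : Odd (w.norm * z.norm) := by rw [Int.odd_iff]; omega
        rw [Int.odd_mul] at this
        exact h ⟨⟨h1, this.1⟩, h2, this.2⟩
      rw [← spinS_mul hw hz, if_neg h3]
    · rw [spinTw_zero hz h2]; simp
  · rw [spinTw_zero hw h1]; simp

lemma spinA_mul_sum' (M N : ℕ) (α β : ℕ → ℂ) :
    ∑ m ∈ Finset.range (M + 1), ∑ k ∈ Finset.range (N + 1), α m * β k * (spinA (m * k) : ℂ) =
    ∑ w ∈ spinAdmAll M, ∑ z ∈ spinAdmAll N, α w.norm.toNat * β z.norm.toNat *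
      ((spinDel (spinCl w) (spinCl z) * (spinTw w * spinTw z * spinGam w z) : ℤ) : ℂ) := by
  classical
  rw [spinA_mul_sum]
  unfold spinAdmAll
  rw [Finset.sum_filter]
  apply Finset.sum_congr rfl
  intro w hw
  split_ifs with h
  · rw [Finset.sum_filter]
    apply Finset.sum_congr rfl
    intro z hz
    split_ifs with h2
    · rfl
    · rw [spin_term_zero (mem_spinAll.1 hw).1 (mem_spinAll.1 hz).1 (fun h3 => h2 h3.2)]; simp
  · apply Finset.sum_eq_zero
    intro z hz
    rw [spin_term_zero (mem_spinAll.1 hw).1 (mem_spinAll.1 hz).1 (fun h3 => h h3.1)]; simp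

lemma spin_ex_univ (ι : Type) [Fintype ι] : ∃ X : Finset ι, ∀ q, q ∈ X := ⟨Finset.univ, fun q => Finset.mem_univ q⟩

lemma spin_bilin0 (δ : ℝ) (hδ : 0 < δ) : ∃ C : ℝ, 1 ≤ C ∧ ∀ (M N : ℕ), 1 ≤ M → M ≤ N →
    ∀ α β : ℕ → ℂ, (∀ z, ‖α z‖ ≤ 1) → (∀ z, ‖β z‖ ≤ 1) →
    M * ‖∑ m ∈ Finset.range (M + 1), ∑ k ∈ Finset.range (N + 1), α m * β k * (spinA (m * k) : ℂ)‖ ^ 12 ≤ C * ((M : ℝ) * N) ^ 12 * (N : ℝ) ^ δ := by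
  classical
  obtain ⟨C0, hC0, hcore⟩ := spin_core δ hδ
  obtain ⟨X, hX⟩ : ∃ X : Finset ((ZMod 16 × ZMod 16) × (ZMod 16 × ZMod 16)), ∀ q, q ∈ X := spin_ex_univ _
  refine ⟨(X.card : ℝ) ^ 12 * C0, ?_, ?_⟩
  · have : (1 : ℝ) ≤ X.card := by
      exact_mod_cast Finset.card_pos.2 ⟨((0, 0), (0, 0)), hX _⟩
    have := one_le_pow₀ this (n := 12)
    nlinarith
  intro M N hM hMN α β hα hβ
  rw [spinA_mul_sum']
  set A : (ZMod 16 × ZMod 16) → ℤ√2 → ℂ := fun r w => if spinCl w = r then α w.norm.toNat * (spinTw w : ℂ) else 0 with hA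
  set B : (ZMod 16 × ZMod 16) → ℤ√2 → ℂ := fun r w => if spinCl w = r then β w.norm.toNat * (spinTw w : ℂ) else 0 with hB
  have hA1 : ∀ r w, ‖A r w‖ ≤ 1 := by
    intro r w; rw [hA]; simp only; split_ifs
    · rw [norm_mul]; exact mul_le_one₀ (hα _) (norm_nonneg _) (spin_jacobi_norm_le _ _)
    · simp
  have hB1 : ∀ r w, ‖B r w‖ ≤ 1 := by
    intro r w; rw [hB]; simp only; split_ifs
    · rw [norm_mul]; exact mul_le_one₀ (hβ _) (norm_nonneg _) (spin_jacobi_norm_le _ _)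
    · simp
  set T : (ZMod 16 × ZMod 16) × (ZMod 16 × ZMod 16) → ℂ := fun q => ∑ w ∈ spinAdmAll M, ∑ z ∈ spinAdmAll N, A q.1 w * B q.2 z * (spinGam w z : ℂ) with hT
  have hdec : ∑ w ∈ spinAdmAll M, ∑ z ∈ spinAdmAll N, α w.norm.toNat * β z.norm.toNat *
      ((spinDel (spinCl w) (spinCl z) * (spinTw w * spinTw z * spinGam w z) : ℤ) : ℂ) = ∑ q ∈ X, (spinDel q.1 q.2 : ℂ) * T q := by
    rw [hT]
    simp_rw [Finset.mul_sum]
    symm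
    rw [Finset.sum_comm]
    apply Finset.sum_congr rfl; intro w _
    rw [Finset.sum_comm]
    apply Finset.sum_congr rfl; intro z _
    rw [Finset.sum_eq_single (spinCl w, spinCl z)]
    · simp only [hA, hB, if_true]; push_cast; ring
    · intro q _ hq
      simp only [hA, hB]
      by_cases h1 : spinCl w = q.1
      · have h2 : ¬ spinCl z = q.2 := fun h2 => hq (by rw [h1, h2])
        rw [if_neg h2]; ring
      · rw [if_neg h1]; ring
    · intro h; exact absurd (hX _) h
  rw [hdec]
  have hle : ‖∑ q ∈ X, (spinDel q.1 q.2 : ℂ) * T q‖ ≤ ∑ q ∈ X, ‖T q‖ := by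
    refine norm_sum_le_of_le _ (fun q _ => ?_)
    rw [norm_mul]
    refine mul_le_of_le_one_left (norm_nonneg _) ?_
    rw [Complex.norm_intCast]; exact_mod_cast spinDel_abs _ _
  calc (M : ℝ) * ‖∑ q ∈ X, (spinDel q.1 q.2 : ℂ) * T q‖ ^ 12 ≤ M * (∑ q ∈ X, ‖T q‖) ^ 12 := by gcongr
    _ ≤ M * ((X.card : ℝ) ^ 11 * ∑ q ∈ X, ‖T q‖ ^ 12) := by
        gcongr; exact pow_sum_le_card_mul_sum_pow (fun q _ => norm_nonneg _) 11
    _ = (X.card : ℝ) ^ 11 * ∑ q ∈ X, M * ‖T q‖ ^ 12 := by rw [← Finset.mul_sum]; ring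
    _ ≤ (X.card : ℝ) ^ 11 * ∑ q ∈ X, C0 * ((M : ℝ) * N) ^ 12 * (N : ℝ) ^ δ := by
        refine mul_le_mul_of_nonneg_left (Finset.sum_le_sum (fun q _ => ?_)) (by positivity)
        exact hcore M N hM hMN _ _ (spinAdmAll_adm M) (spinAdmAll_adm N) _ _ (hA1 _) (hB1 _)
    _ = _ := by rw [Finset.sum_const, nsmul_eq_mul]; ring

lemma spin_bilin (δ : ℝ) (hδ : 0 < δ) : ∃ C : ℝ, 1 ≤ C ∧ ∀ (M N : ℕ), 1 ≤ M → 1 ≤ N →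
    ∀ α β : ℕ → ℂ, (∀ z, ‖α z‖ ≤ 1) → (∀ z, ‖β z‖ ≤ 1) →
    (min M N : ℕ) * ‖∑ m ∈ Finset.range (M + 1), ∑ k ∈ Finset.range (N + 1), α m * β k * (spinA (m * k) : ℂ)‖ ^ 12 ≤ C * ((M : ℝ) * N) ^ 12 * ((M : ℝ) * N) ^ δ := by
  obtain ⟨C, hC, h⟩ := spin_bilin0 δ hδ
  refine ⟨C, hC, ?_⟩
  intro M N hM hN α β hα hβ
  have hM1 : (1 : ℝ) ≤ M := by exact_mod_cast hM
  have hN1 : (1 : ℝ) ≤ N := by exact_mod_cast hN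
  rcases le_total M N with hMN | hMN
  · rw [min_eq_left hMN]
    refine (h M N hM hMN α β hα hβ).trans ?_
    gcongr
    nlinarith
  · rw [min_eq_right hMN, Finset.sum_comm]
    have := h N M hN hMN β α hβ hα
    have e : ∑ y ∈ Finset.range (N + 1), ∑ x ∈ Finset.range (M + 1), α x * β y * (spinA (x * y) : ℂ) =
        ∑ m ∈ Finset.range (N + 1), ∑ k ∈ Finset.range (M + 1), β m * α k * (spinA (m * k) : ℂ) := by
      apply Finset.sum_congr rfl; intro m _
      apply Finset.sum_congr rfl; intro k _
      rw [mul_comm k m, mul_comm (α k)]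
    rw [e]
    refine this.trans ?_
    rw [mul_comm (N : ℝ) M]
    gcongr
    nlinarith
end

section
/-- The Polya-Vinogradov bound. -/
noncomputable def spinPV (v : ℕ) : ℝ := Real.sqrt (v * v.divisors.card) * (v.divisors.card * (1 + Real.log v))

lemma spinPV_nonneg (v : ℕ) : 0 ≤ spinPV v := by
  unfold spinPV
  have : 0 ≤ Real.log v := Real.log_natCast_nonneg v
  positivity

lemma spin_ap_sum (v : ℕ) (hv : Odd v) (hs : ¬ IsSquare v) (q c : ℕ) (hc : c < q) (hq : Nat.Coprime q v) (a b : ℕ) :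
    |((∑ u ∈ (Finset.Ico a b).filter (fun u => u % q = c), jacobiSym (2 * (u : ℤ)) v : ℤ) : ℝ)| ≤ spinPV v := by
  have hq0 : 0 < q := by omega
  set k0 := (a + q - 1 - c) / q with hk0
  set k1 := (b + q - 1 - c) / q with hk1
  have key : ∀ b k : ℕ, (b + q - 1 - c) / q ≤ k ↔ b ≤ c + q * k := by
    intro b k
    rw [← Nat.lt_succ_iff, Nat.div_lt_iff_lt_mul hq0, Nat.succ_mul, mul_comm k q]
    omega
  have hset : (Finset.Ico a b).filter (fun u => u % q = c) = (Finset.Ico k0 k1).image (fun k => c + q * k) := by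
    ext u
    simp only [Finset.mem_filter, Finset.mem_image, Finset.mem_Ico]
    constructor
    · rintro ⟨⟨h1, h2⟩, h3⟩
      have h4 : c + q * (u / q) = u := by rw [← h3]; exact Nat.mod_add_div u q
      refine ⟨u / q, ⟨?_, ?_⟩, h4⟩
      · rw [hk0, key, h4]; exact h1
      · rw [← not_le, hk1, key, h4]; omega
    · rintro ⟨k, ⟨h1, h2⟩, rfl⟩
      rw [hk0, key] at h1
      rw [← not_le, hk1, key] at h2
      refine ⟨⟨h1, by omega⟩, ?_⟩
      rw [Nat.add_mul_mod_self_left, Nat.mod_eq_of_lt hc]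
  rw [hset, Finset.sum_image (by
    intro x _ y _ h
    simp only at h
    exact Nat.eq_of_mul_eq_mul_left hq0 (by omega))]
  have hcop : IsCoprime (q : ℤ) (v : ℤ) := Nat.isCoprime_iff_coprime.2 hq
  obtain ⟨q', y, hy⟩ := hcop
  have hterm : ∀ k : ℕ, jacobiSym (2 * ((c + q * k : ℕ) : ℤ)) v = jacobiSym (2 * q) v * jacobiSym (c * q' + k) v := by
    intro k
    rw [← jacobiSym.mul_left]
    apply jacobiSym.mod_left'
    apply Int.ModEq.symm
    rw [← ZMod.intCast_eq_intCast_iff]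
    have h1 : ((q' : ZMod v)) * (q : ZMod v) = 1 := by
      have : ((q' * q + y * v : ℤ) : ZMod v) = ((1 : ℤ) : ZMod v) := by rw [hy]
      push_cast at this
      simpa using this
    push_cast
    linear_combination 2 * (c : ZMod v) * h1
  simp_rw [hterm]
  rw [← Finset.mul_sum, Finset.sum_Ico_eq_sum_range]
  have hp := spin_polya v hv hs (c * q' + k0) (k1 - k0)
  have e : ∑ k ∈ Finset.range (k1 - k0), jacobiSym (c * q' + ((k0 + k : ℕ) : ℤ)) v = ∑ j ∈ Finset.range (k1 - k0), jacobiSym (c * q' + k0 + j) v := by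
    apply Finset.sum_congr rfl; intro k _
    congr 1; push_cast; ring
  rw [e, Int.cast_mul, abs_mul]
  have h1 : |((jacobiSym (2 * q) v : ℤ) : ℝ)| ≤ 1 := by
    have := spin_jacobi_abs_le (2 * q) v
    rw [← Int.cast_abs]; exact_mod_cast this
  exact (mul_le_of_le_one_left (abs_nonneg _) h1).trans hp

/-- Good condition. -/
def spinGood (d v u : ℕ) : Prop := ((u : ℤ) ^ 2 - 2 * (v : ℤ) ^ 2) % 16 = 15 ∧ (d : ℤ) ∣ (u : ℤ) ^ 2 - 2 * (v : ℤ) ^ 2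

instance (d v u : ℕ) : Decidable (spinGood d v u) := by unfold spinGood; infer_instance

lemma spinGood_mod (d v u : ℕ) : spinGood d v (u % (16 * d)) ↔ spinGood d v u := by
  unfold spinGood
  have e : ((u : ℤ)) = ((u % (16 * d) : ℕ) : ℤ) + 16 * d * ((u / (16 * d) : ℕ) : ℤ) := by
    have := Nat.mod_add_div u (16 * d)
    exact_mod_cast this.symm
  set r := ((u % (16 * d) : ℕ) : ℤ)
  set k := ((u / (16 * d) : ℕ) : ℤ)
  have e2 : (u : ℤ) ^ 2 - 2 * (v : ℤ) ^ 2 = (r ^ 2 - 2 * (v : ℤ) ^ 2) + 16 * (d * (2 * r * k + 16 * d * k ^ 2)) := by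
    rw [e]; ring
  have e3 : (u : ℤ) ^ 2 - 2 * (v : ℤ) ^ 2 = (r ^ 2 - 2 * (v : ℤ) ^ 2) + d * (16 * (2 * r * k + 16 * d * k ^ 2)) := by
    rw [e]; ring
  constructor
  · rintro ⟨h1, h2⟩
    refine ⟨by rw [e2]; omega, ?_⟩
    rw [e3]; exact dvd_add h2 (dvd_mul_right _ _)
  · rintro ⟨h1, h2⟩
    refine ⟨by rw [e2] at h1; omega, ?_⟩
    rw [e3] at h2; exact (dvd_add_left (dvd_mul_right _ _)).1 h2

lemma spin_roots (d v : ℕ) (hd : Odd d) (hdv : Nat.Coprime d v) :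
    ((Finset.range (16 * d)).filter (spinGood d v)).card ≤ 16 * d.divisors.card := by
  have hd0 : 0 < d := hd.pos
  have : NeZero d := ⟨hd0.ne'⟩
  have hu : IsUnit (2 * (v : ZMod d) ^ 2) := by
    apply IsUnit.mul
    · have := (ZMod.isUnit_iff_coprime 2 d).2 (Nat.coprime_two_left.2 hd)
      exact_mod_cast this
    · exact ((ZMod.isUnit_iff_coprime v d).2 hdv.symm).pow 2
  have h1 : ((Finset.range (16 * d)).filter (spinGood d v)).card ≤
      ((Finset.univ.filter (fun x : ZMod d => x ^ 2 = 2 * (v : ZMod d) ^ 2)) ×ˢ Finset.range 16).card := by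
    apply Finset.card_le_card_of_injOn (fun c : ℕ => (((c : ℕ) : ZMod d), c / d))
    · intro c hc
      simp only [Finset.coe_filter, Finset.mem_range, Set.mem_ofPred_eq] at hc
      simp only [Finset.coe_product, Set.mem_prod, Finset.coe_filter, Set.mem_ofPred_eq, Finset.mem_univ, true_and, Finset.mem_coe, Finset.mem_range]
      refine ⟨?_, ?_⟩
      · have := (ZMod.intCast_zmod_eq_zero_iff_dvd _ d).2 hc.2.2
        push_cast at this
        exact sub_eq_zero.1 this
      · rw [Nat.div_lt_iff_lt_mul hd0]; exact hc.1
    · intro x _ y _ h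
      simp only [Prod.mk.injEq] at h
      have h1 := (ZMod.natCast_eq_natCast_iff' x y d).1 h.1
      rw [← Nat.mod_add_div x d, ← Nat.mod_add_div y d, h1, h.2]
  rw [Finset.card_product, Finset.card_range] at h1
  have h2 := spin_sqrt_count d hd _ hu
  calc _ ≤ _ := h1
    _ ≤ d.divisors.card * 16 := Nat.mul_le_mul_right _ h2
    _ = _ := by ring

lemma spin_fixed_v (d v : ℕ) (hd : Odd d) (hv : Odd v) (hs : ¬ IsSquare v) (a b : ℕ) :
    |((∑ u ∈ (Finset.Ico a b).filter (spinGood d v), jacobiSym (2 * (u : ℤ)) v : ℤ) : ℝ)| ≤ 16 * d.divisors.card * spinPV v := by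
  have hPV := spinPV_nonneg v
  by_cases hdv : Nat.Coprime d v
  · have hmaps : ∀ u ∈ (Finset.Ico a b).filter (spinGood d v), u % (16 * d) ∈ (Finset.range (16 * d)).filter (spinGood d v) := by
      intro u hu
      rw [Finset.mem_filter] at hu
      rw [Finset.mem_filter, Finset.mem_range, spinGood_mod]
      exact ⟨Nat.mod_lt _ (by have := hd.pos; omega), hu.2⟩
    rw [← Finset.sum_fiberwise_of_maps_to hmaps, Int.cast_sum]
    have hq : Nat.Coprime (16 * d) v := by
      refine Nat.Coprime.mul_left ?_ hdv
      have : Nat.Coprime (2 ^ 4) v := Nat.Coprime.pow_left 4 (Nat.coprime_two_left.2 hv)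
      exact this
    calc _ ≤ ∑ c ∈ (Finset.range (16 * d)).filter (spinGood d v), spinPV v := by
          refine (Finset.abs_sum_le_sum_abs _ _).trans (Finset.sum_le_sum (fun c hc => ?_))
          rw [Finset.mem_filter, Finset.mem_range] at hc
          have e : ((Finset.Ico a b).filter (spinGood d v)).filter (fun u => u % (16 * d) = c) = (Finset.Ico a b).filter (fun u => u % (16 * d) = c) := by
            rw [Finset.filter_filter]
            apply Finset.filter_congr
            intro u _
            constructor
            · exact fun h => h.2
            · exact fun h => ⟨by rw [← spinGood_mod, h]; exact hc.2, h⟩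
          rw [e]
          exact spin_ap_sum v hv hs _ c hc.1 hq a b
      _ = (((Finset.range (16 * d)).filter (spinGood d v)).card : ℝ) * spinPV v := by simp
      _ ≤ _ := by
          gcongr
          exact_mod_cast spin_roots d v hd hdv
  · obtain ⟨p, hp, h1, h2⟩ := Nat.Prime.not_coprime_iff_dvd.1 hdv
    rw [Finset.sum_eq_zero]
    · simp; positivity
    · intro u hu
      rw [Finset.mem_filter] at hu
      have h3 : (p : ℤ) ∣ (u : ℤ) ^ 2 - 2 * (v : ℤ) ^ 2 := (Int.natCast_dvd_natCast.2 h1).trans hu.2.2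
      have h4 : (p : ℤ) ∣ (v : ℤ) := Int.natCast_dvd_natCast.2 h2
      have h5 : (p : ℤ) ∣ (u : ℤ) ^ 2 := by
        have := dvd_add h3 ((h4.pow (two_ne_zero)).mul_left 2)
        simpa using this
      have h6 : (p : ℤ) ∣ u := (Nat.prime_iff_prime_int.1 hp).dvd_of_dvd_pow h5
      exact spin_jac_zero hp (h6.mul_left 2) h2 hv.pos.ne'

lemma spinA_decomp (d t : ℕ) : ∑ n ∈ (Finset.range (t + 1)).filter (fun n => d ∣ n), spinA n =
    ∑ v ∈ Finset.range (Nat.sqrt (4 * t) + 1), ∑ u ∈ (Finset.Ico (3 * v / 2 + 1) (Nat.sqrt (t + 2 * v ^ 2) + 1)).filter (spinGood d v),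
      jacobiSym (2 * (u : ℤ)) v := by
  have h1 : ∑ n ∈ (Finset.range (t + 1)).filter (fun n => d ∣ n), spinA n =
      ∑ w ∈ (spinAll t).filter (fun w => w.norm % 16 = 15 ∧ (d : ℤ) ∣ w.norm), spinS w := by
    rw [Finset.sum_filter, Finset.sum_filter]
    have := spinAll_sum t (fun n w => if n % 16 = 15 ∧ d ∣ n then spinS w else 0)
    calc _ = ∑ n ∈ Finset.range (t + 1), ∑ w ∈ spinDS n, (if n % 16 = 15 ∧ d ∣ n then spinS w else 0) := by
          apply Finset.sum_congr rfl; intro n _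
          unfold spinA
          split_ifs <;> simp_all
      _ = _ := this
      _ = _ := by
          apply Finset.sum_congr rfl; intro w hw
          have hpos := spinD_norm_pos (mem_spinAll.1 hw).1
          obtain ⟨n, hn⟩ := Int.eq_ofNat_of_zero_le hpos.le
          rw [hn, Int.toNat_natCast]
          have : (n % 16 = 15 ∧ d ∣ n) ↔ ((n : ℤ) % 16 = 15 ∧ (d : ℤ) ∣ n) := by
            rw [Int.natCast_dvd_natCast]; omega
          simp only [this]
  rw [h1, Finset.sum_sigma']
  refine Finset.sum_bij' (fun w _ => (⟨w.im.toNat, w.re.toNat⟩ : Σ _ : ℕ, ℕ)) (fun x _ => (⟨(x.2 : ℤ), (x.1 : ℤ)⟩ : ℤ√2)) ?_ ?_ ?_ ?_ ?_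
  · intro w hw
    rw [Finset.mem_filter, mem_spinAll] at hw
    obtain ⟨⟨hD, hn⟩, h2, h3⟩ := hw
    have him := spinD_im_sq hD
    rw [spin_norm] at *
    obtain ⟨a1, a2, a3⟩ := hD
    obtain ⟨u, hu⟩ := Int.eq_ofNat_of_zero_le a1.le
    obtain ⟨v, hv⟩ := Int.eq_ofNat_of_zero_le a2
    rw [hu, hv] at hn h2 h3 him a3
    rw [hu, hv]
    simp only [Finset.mem_sigma, Finset.mem_range, Finset.mem_filter, Finset.mem_Ico, Int.toNat_natCast, Nat.lt_succ_iff, Nat.le_sqrt']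
    refine ⟨?_, ⟨?_, ?_⟩, h2, h3⟩
    · zify; linarith
    · omega
    · zify; linarith
  · intro x hx
    simp only [Finset.mem_sigma, Finset.mem_range, Finset.mem_filter, Finset.mem_Ico, Nat.lt_succ_iff, Nat.le_sqrt'] at hx
    obtain ⟨h2, ⟨h3, h4⟩, h5, h6⟩ := hx
    rw [Finset.mem_filter, mem_spinAll, spin_norm]
    refine ⟨⟨⟨?_, ?_, ?_⟩, ?_⟩, h5, h6⟩
    · simp only; omega
    · simp only; omega
    · simp only; omega
    · simp only; zify at h4; linarith
  · intro w hw
    rw [Finset.mem_filter, mem_spinAll] at hw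
    obtain ⟨⟨⟨a1, a2, a3⟩, hn⟩, h2, h3⟩ := hw
    ext
    · simp only; omega
    · simp only; omega
  · intro x _
    simp
  · intro w hw
    rw [Finset.mem_filter, mem_spinAll] at hw
    obtain ⟨⟨⟨a1, a2, a3⟩, hn⟩, h2, h3⟩ := hw
    unfold spinS
    simp only
    rw [Int.toNat_of_nonneg a1.le]
end

section
lemma spin_log_bound (η : ℝ) (hη : 0 < η) : ∀ x : ℝ, 1 ≤ x → 1 + Real.log x ≤ (1 + 1 / η) * x ^ η := by
  intro x hx
  have h1 : 1 ≤ x ^ η := Real.one_le_rpow hx hη.le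
  have h2 := Real.log_le_rpow_div (by linarith : 0 ≤ x) hη
  have : x ^ η / η = 1 / η * x ^ η := by ring
  linarith [this]

lemma spinPV_bound (η : ℝ) (hη : 0 < η) : ∃ C : ℝ, 1 ≤ C ∧ ∀ v : ℕ, 1 ≤ v → spinPV v ≤ C * (v : ℝ) ^ (1 / 2 + η) := by
  obtain ⟨C1, hC1, hτ⟩ := spin_divisor_bound (η / 3) (by positivity)
  have hL := spin_log_bound (η / 3) (by positivity)
  refine ⟨C1 ^ 2 * (1 + 1 / (η / 3)), ?_, ?_⟩
  · have h1 : 1 ≤ C1 ^ 2 := one_le_pow₀ hC1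
    have h2 : 0 < 1 / (η / 3) := by positivity
    nlinarith
  intro v hv
  have hv1 : (1 : ℝ) ≤ v := by exact_mod_cast hv
  have hv0 : (0 : ℝ) < v := by linarith
  have ht1 : (1 : ℝ) ≤ v.divisors.card := by
    exact_mod_cast Finset.card_pos.2 ⟨1, Nat.one_mem_divisors.2 (by omega)⟩
  have hlog : 0 ≤ Real.log v := Real.log_natCast_nonneg v
  unfold spinPV
  have hs : Real.sqrt (v * v.divisors.card) ≤ (v : ℝ) ^ (1 / 2 : ℝ) * v.divisors.card := by
    rw [Real.sqrt_mul hv0.le, Real.sqrt_eq_rpow]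
    gcongr
    rw [Real.sqrt_le_left (by linarith)]
    nlinarith
  calc _ ≤ ((v : ℝ) ^ (1 / 2 : ℝ) * (C1 * (v : ℝ) ^ (η / 3))) * ((C1 * (v : ℝ) ^ (η / 3)) * ((1 + 1 / (η / 3)) * (v : ℝ) ^ (η / 3))) := by
        gcongr
        · refine hs.trans ?_
          gcongr
          exact hτ v
        · exact hτ v
        · exact hL v hv1
    _ = C1 ^ 2 * (1 + 1 / (η / 3)) * ((v : ℝ) ^ (1 / 2 : ℝ) * (v : ℝ) ^ (η / 3) * (v : ℝ) ^ (η / 3) * (v : ℝ) ^ (η / 3)) := by ring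
    _ = _ := by
        rw [← Real.rpow_add hv0, ← Real.rpow_add hv0, ← Real.rpow_add hv0]
        congr 2; ring

lemma spin_squares_count (n : ℕ) : (((Finset.range n).filter IsSquare).card : ℝ) ≤ Real.sqrt n + 1 := by
  have h1 : (Finset.range n).filter IsSquare ⊆ (Finset.range (Nat.sqrt n + 1)).image (fun r => r * r) := by
    intro v hv
    rw [Finset.mem_filter, Finset.mem_range] at hv
    obtain ⟨h, r, rfl⟩ := hv
    rw [Finset.mem_image]
    refine ⟨r, ?_, rfl⟩
    rw [Finset.mem_range, Nat.lt_succ_iff, Nat.le_sqrt]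
    exact h.le
  have h2 := (Finset.card_le_card h1).trans Finset.card_image_le
  rw [Finset.card_range] at h2
  have h3 : (Nat.sqrt n : ℝ) ≤ Real.sqrt n := Real.nat_sqrt_le_real_sqrt
  have : (((Finset.range n).filter IsSquare).card : ℝ) ≤ (Nat.sqrt n : ℝ) + 1 := by exact_mod_cast h2
  linarith

lemma spin_typeI0 (d t : ℕ) (hd : Odd d) (ht : 1 ≤ t) (P : ℝ) (hP : 0 ≤ P) (hPV : ∀ v : ℕ, v ^ 2 ≤ 4 * t → 1 ≤ v → spinPV v ≤ P) :
    |((∑ n ∈ (Finset.range (t + 1)).filter (fun n => d ∣ n), spinA n : ℤ) : ℝ)| ≤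
      (3 * (t : ℝ) ^ (1 / 2 : ℝ)) * (16 * d.divisors.card * P) + 16 * (t : ℝ) ^ (3 / 4 : ℝ) := by
  have ht1 : (1 : ℝ) ≤ t := by exact_mod_cast ht
  have ht0 : (0 : ℝ) < t := by linarith
  set s := (t : ℝ) ^ (1 / 4 : ℝ) with hs
  have hs1 : 1 ≤ s := Real.one_le_rpow ht1 (by norm_num)
  have e2 : (t : ℝ) ^ (1 / 2 : ℝ) = s ^ 2 := by
    rw [hs, ← Real.rpow_natCast, ← Real.rpow_mul ht0.le]; norm_num
  have e3 : (t : ℝ) ^ (3 / 4 : ℝ) = s ^ 3 := by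
    rw [hs, ← Real.rpow_natCast, ← Real.rpow_mul ht0.le]; norm_num
  have e4 : (t : ℝ) = s ^ 4 := by
    rw [hs, ← Real.rpow_natCast, ← Real.rpow_mul ht0.le]; norm_num
  rw [e2, e3, spinA_decomp, Int.cast_sum]
  refine (Finset.abs_sum_le_sum_abs _ _).trans ?_
  set V := Nat.sqrt (4 * t) + 1 with hV
  have hV1 : (V : ℝ) ≤ 3 * s ^ 2 := by
    have h1 : (Nat.sqrt (4 * t) : ℝ) ≤ 2 * s ^ 2 := by
      refine (Real.nat_sqrt_le_real_sqrt).trans ?_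
      rw [Real.sqrt_le_left (by positivity)]
      push_cast
      rw [e4]; ring_nf; rfl
    rw [hV]; push_cast
    nlinarith
  rw [← Finset.sum_filter_add_sum_filter_not (Finset.range V) IsSquare]
  have hD : (0 : ℝ) ≤ 16 * d.divisors.card * P := mul_nonneg (mul_nonneg (by norm_num) (Nat.cast_nonneg _)) hP
  have b1 : ∑ v ∈ (Finset.range V).filter IsSquare, |((∑ u ∈ (Finset.Ico (3 * v / 2 + 1) (Nat.sqrt (t + 2 * v ^ 2) + 1)).filter (spinGood d v),
      jacobiSym (2 * (u : ℤ)) v : ℤ) : ℝ)| ≤ 16 * s ^ 3 := by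
    calc _ ≤ ∑ v ∈ (Finset.range V).filter IsSquare, 4 * s ^ 2 := by
          apply Finset.sum_le_sum
          intro v hv
          rw [Finset.mem_filter, Finset.mem_range, hV, Nat.lt_succ_iff, Nat.le_sqrt'] at hv
          have hv2 : (v : ℝ) ^ 2 ≤ 4 * t := by exact_mod_cast hv.1
          have h1 : (Nat.sqrt (t + 2 * v ^ 2) : ℝ) ≤ 3 * s ^ 2 := by
            refine (Real.nat_sqrt_le_real_sqrt).trans ?_
            rw [Real.sqrt_le_left (by positivity)]
            push_cast
            nlinarith
          rw [Int.cast_sum]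
          calc _ ≤ ∑ u ∈ (Finset.Ico (3 * v / 2 + 1) (Nat.sqrt (t + 2 * v ^ 2) + 1)).filter (spinGood d v), (1 : ℝ) := by
                refine (Finset.abs_sum_le_sum_abs _ _).trans (Finset.sum_le_sum (fun u _ => ?_))
                have := spin_jacobi_abs_le (2 * (u : ℤ)) v
                rw [← Int.cast_abs]; exact_mod_cast this
            _ ≤ ∑ u ∈ Finset.Ico (3 * v / 2 + 1) (Nat.sqrt (t + 2 * v ^ 2) + 1), (1 : ℝ) := by
                apply Finset.sum_le_sum_of_subset_of_nonneg (Finset.filter_subset _ _)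
                intros; positivity
            _ = ((Nat.sqrt (t + 2 * v ^ 2) + 1 - (3 * v / 2 + 1) : ℕ) : ℝ) := by simp
            _ ≤ ((Nat.sqrt (t + 2 * v ^ 2) : ℕ) : ℝ) := by
                exact_mod_cast (by omega)
            _ ≤ 4 * s ^ 2 := by nlinarith
      _ = (((Finset.range V).filter IsSquare).card : ℝ) * (4 * s ^ 2) := by simp
      _ ≤ (4 * s) * (4 * s ^ 2) := by
          gcongr
          refine (spin_squares_count V).trans ?_
          have : Real.sqrt V ≤ 2 * s := by
            rw [Real.sqrt_le_left (by positivity)]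
            nlinarith
          linarith
      _ = _ := by ring
  have b2 : ∑ v ∈ (Finset.range V).filter (fun v => ¬ IsSquare v), |((∑ u ∈ (Finset.Ico (3 * v / 2 + 1) (Nat.sqrt (t + 2 * v ^ 2) + 1)).filter (spinGood d v),
      jacobiSym (2 * (u : ℤ)) v : ℤ) : ℝ)| ≤ (3 * s ^ 2) * (16 * d.divisors.card * P) := by
    calc _ ≤ ∑ v ∈ (Finset.range V).filter (fun v => ¬ IsSquare v), 16 * d.divisors.card * P := by
          apply Finset.sum_le_sum
          intro v hv
          rw [Finset.mem_filter, Finset.mem_range, hV, Nat.lt_succ_iff, Nat.le_sqrt'] at hv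
          by_cases hvo : Odd v
          · refine (spin_fixed_v d v hd hvo hv.2 _ _).trans ?_
            exact mul_le_mul_of_nonneg_left (hPV v hv.1 hvo.pos) (mul_nonneg (by norm_num) (Nat.cast_nonneg _))
          · have : (Finset.Ico (3 * v / 2 + 1) (Nat.sqrt (t + 2 * v ^ 2) + 1)).filter (spinGood d v) = ∅ := by
              rw [Finset.filter_eq_empty_iff]
              intro u _ hg
              have := spin_odd_of_norm (w := (⟨u, v⟩ : ℤ√2)) (by rw [spin_norm]; simp only; have := hg.1; omega)
              simp only at this
              apply hvo
              rw [Nat.odd_iff]; omega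
            rw [this]; simpa using hD
      _ ≤ ∑ v ∈ Finset.range V, 16 * d.divisors.card * P := by
          apply Finset.sum_le_sum_of_subset_of_nonneg (Finset.filter_subset _ _)
          intros; exact hD
      _ = V * (16 * d.divisors.card * P) := by simp
      _ ≤ _ := mul_le_mul_of_nonneg_right hV1 hD
  linarith

lemma spin_typeI (δ : ℝ) (hδ : 0 < δ) : ∃ C : ℝ, 1 ≤ C ∧ ∀ d t : ℕ, 1 ≤ d → 1 ≤ t →
    |((∑ n ∈ (Finset.range (t + 1)).filter (fun n => d ∣ n), spinA n : ℤ) : ℝ)| ≤ C * (t : ℝ) ^ (3 / 4 + δ) := by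
  obtain ⟨C1, hC1, hτ⟩ := spin_divisor_bound (δ / 2) (by positivity)
  obtain ⟨C2, hC2, hPV⟩ := spinPV_bound δ hδ
  set c4 := (4 : ℝ) ^ ((1 / 2 + δ) / 2) with hc4
  have hc41 : 1 ≤ c4 := Real.one_le_rpow (by norm_num) (by positivity)
  have hbig : 1 ≤ C1 * C2 * c4 := by
    have : 1 ≤ C1 * C2 := by nlinarith
    nlinarith
  refine ⟨48 * (C1 * C2 * c4) + 16, by linarith, ?_⟩
  intro d t hd ht
  have ht1 : (1 : ℝ) ≤ t := by exact_mod_cast ht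
  have ht0 : (0 : ℝ) < t := by linarith
  have hrhs : 0 ≤ (48 * (C1 * C2 * c4) + 16) * (t : ℝ) ^ (3 / 4 + δ) := by positivity
  by_cases hdt : t < d
  · rw [Finset.sum_eq_zero]
    · simpa using hrhs
    · intro n hn
      rw [Finset.mem_filter, Finset.mem_range] at hn
      have : n = 0 := Nat.eq_zero_of_dvd_of_lt hn.2 (by omega)
      subst this; simp [spinA]
  push Not at hdt
  by_cases hdo : Odd d
  · have := spin_typeI0 d t hdo ht (C2 * (c4 * (t : ℝ) ^ (1 / 4 + δ / 2))) (by positivity) ?_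
    · refine this.trans ?_
      have h1 : (d.divisors.card : ℝ) ≤ C1 * (t : ℝ) ^ (δ / 2) := by
        refine (hτ d).trans ?_
        gcongr
      have h2 : (t : ℝ) ^ (3 / 4 : ℝ) ≤ (t : ℝ) ^ (3 / 4 + δ) := Real.rpow_le_rpow_of_exponent_le ht1 (by linarith)
      have h3 : (t : ℝ) ^ (1 / 2 : ℝ) * (t : ℝ) ^ (δ / 2) * (t : ℝ) ^ (1 / 4 + δ / 2) = (t : ℝ) ^ (3 / 4 + δ) := by
        rw [← Real.rpow_add ht0, ← Real.rpow_add ht0]; congr 1; ring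
      calc _ ≤ (3 * (t : ℝ) ^ (1 / 2 : ℝ)) * (16 * (C1 * (t : ℝ) ^ (δ / 2)) * (C2 * (c4 * (t : ℝ) ^ (1 / 4 + δ / 2)))) + 16 * (t : ℝ) ^ (3 / 4 + δ) := by
            gcongr
        _ = 48 * (C1 * C2 * c4) * ((t : ℝ) ^ (1 / 2 : ℝ) * (t : ℝ) ^ (δ / 2) * (t : ℝ) ^ (1 / 4 + δ / 2)) + 16 * (t : ℝ) ^ (3 / 4 + δ) := by ring
        _ = _ := by rw [h3]; ring
    · intro v hv hv1
      refine (hPV v hv1).trans ?_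
      gcongr
      have hv2 : (v : ℝ) ^ 2 ≤ 4 * t := by exact_mod_cast hv
      have e : (v : ℝ) ^ (1 / 2 + δ) = ((v : ℝ) ^ 2) ^ ((1 / 2 + δ) / 2) := by
        rw [← Real.rpow_natCast, ← Real.rpow_mul (by positivity)]; congr 1; push_cast; ring
      rw [e]
      calc _ ≤ (4 * (t : ℝ)) ^ ((1 / 2 + δ) / 2) := by gcongr
        _ = _ := by
          rw [Real.mul_rpow (by norm_num) ht0.le, hc4]
          congr 2; ring
  · rw [Finset.sum_eq_zero]
    · simpa using hrhs
    · intro n hn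
      rw [Finset.mem_filter, Finset.mem_range] at hn
      unfold spinA
      rw [if_neg]
      have : 2 ∣ n := (even_iff_two_dvd.1 (Nat.not_odd_iff_even.1 hdo)).trans hn.2
      omega
end

section
lemma spin_sep_bound (F : ℕ → ℕ → ℂ) (M N : ℕ) (t : ℕ → ℕ) (Bd : ℝ)
    (hB : ∀ α β : ℕ → ℂ, (∀ m, ‖α m‖ ≤ 1) → (∀ k, ‖β k‖ ≤ 1) →
      ‖∑ m ∈ Finset.range (M + 1), ∑ k ∈ Finset.range (N + 1), α m * β k * F m k‖ ≤ Bd)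
    (α β : ℕ → ℂ) (hα : ∀ m, ‖α m‖ ≤ 1) (hβ : ∀ k, ‖β k‖ ≤ 1) :
    ‖∑ m ∈ Finset.range (M + 1), ∑ k ∈ Finset.range (N + 1), α m * β k * ((if k < t m then (1 : ℂ) else 0) * F m k)‖ ≤
      (2 + Real.log (N + 1)) * Bd := by
  have hBd : 0 ≤ Bd := (norm_nonneg _).trans (hB (fun _ => 0) (fun _ => 0) (by simp) (by simp))
  have hsep := fun m => spin_separate (N + 1) (t m)
  choose c hc1 hc2 using hsep
  have e1 : ∑ m ∈ Finset.range (M + 1), ∑ k ∈ Finset.range (N + 1), α m * β k * ((if k < t m then (1 : ℂ) else 0) * F m k) =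
      ∑ h : ZMod (N + 1), (spinKap (N + 1) h : ℂ) * ∑ m ∈ Finset.range (M + 1), ∑ k ∈ Finset.range (N + 1),
        (α m * (c m h / (spinKap (N + 1) h : ℂ))) * (β k * ZMod.stdAddChar (h * (k : ZMod (N + 1)))) * F m k := by
    simp_rw [Finset.mul_sum]
    symm
    rw [Finset.sum_comm]
    apply Finset.sum_congr rfl; intro m _
    rw [Finset.sum_comm]
    apply Finset.sum_congr rfl; intro k hk
    rw [hc2 m k (Finset.mem_range.1 hk), Finset.sum_mul, Finset.mul_sum]
    apply Finset.sum_congr rfl; intro h _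
    have e2 : (spinKap (N + 1) h : ℂ) * (c m h / (spinKap (N + 1) h : ℂ)) = c m h := by
      by_cases h0 : spinKap (N + 1) h = 0
      · have := hc1 m h
        rw [h0] at this
        have : c m h = 0 := by simpa using this
        rw [this]; simp
      · rw [mul_div_cancel₀]; exact_mod_cast h0
    linear_combination (α m * β k * ZMod.stdAddChar (h * (k : ZMod (N + 1))) * F m k) * e2
  rw [e1]
  calc _ ≤ ∑ h : ZMod (N + 1), spinKap (N + 1) h * Bd := by
        refine norm_sum_le_of_le _ (fun h _ => ?_)
        have hk := spinKap_nonneg h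
        rw [norm_mul, Complex.norm_real, Real.norm_of_nonneg hk]
        refine mul_le_mul_of_nonneg_left (hB (fun m => α m * (c m h / (spinKap (N + 1) h : ℂ)))
          (fun k => β k * ZMod.stdAddChar (h * (k : ZMod (N + 1)))) ?_ ?_) hk
        · intro m
          rw [norm_mul, norm_div, Complex.norm_real, Real.norm_of_nonneg hk]
          exact mul_le_one₀ (hα m) (by positivity) (div_le_one_of_le₀ (hc1 m h) hk)
        · intro k
          rw [norm_mul, AddChar.norm_apply, mul_one]; exact hβ k
    _ = (∑ h : ZMod (N + 1), spinKap (N + 1) h) * Bd := by rw [Finset.sum_mul]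
    _ ≤ _ := by
        have := spinKap_sum (N + 1)
        push_cast at this
        gcongr

lemma spin_typeII (δ : ℝ) (hδ : 0 < δ) : ∃ C : ℝ, 1 ≤ C ∧ ∀ x y : ℕ, 1 ≤ x → 1 ≤ y → ∀ α β : ℕ → ℂ,
    (∀ m, ‖α m‖ ≤ 1) → (∀ k, ‖β k‖ ≤ 1) → (∀ m, m ≤ y → α m = 0) → (∀ k, k ≤ y → β k = 0) →
    ‖∑ m ∈ Finset.range (x + 1), ∑ k ∈ Finset.range (x / m + 1), α m * β k * (spinA (m * k) : ℂ)‖ ≤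
      (Nat.log 2 x + 1) * ((2 + Real.log (x + 1)) * (C * (2 * (x : ℝ)) ^ (12 + δ) / y) ^ (1 / 12 : ℝ)) := by
  obtain ⟨C, hC, hbil⟩ := spin_bilin δ hδ
  refine ⟨C, hC, ?_⟩
  intro x y hx hy α β hα hβ hα0 hβ0
  have hx1 : (1 : ℝ) ≤ x := by exact_mod_cast hx
  have hy1 : (1 : ℝ) ≤ y := by exact_mod_cast hy
  set Bd := (C * (2 * (x : ℝ)) ^ (12 + δ) / y) ^ (1 / 12 : ℝ) with hBd
  have hBd0 : 0 ≤ Bd := by positivity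
  have hlog0 : 0 ≤ Real.log ((x : ℝ) + 1) := Real.log_nonneg (by linarith)
  have hmaps : ∀ m ∈ Finset.range (x + 1), Nat.log 2 m ∈ Finset.range (Nat.log 2 x + 1) := by
    intro m hm
    rw [Finset.mem_range] at hm ⊢
    have := Nat.log_mono_right (b := 2) (by omega : m ≤ x)
    omega
  rw [← Finset.sum_fiberwise_of_maps_to hmaps]
  calc _ ≤ ∑ i ∈ Finset.range (Nat.log 2 x + 1), ((2 + Real.log (x + 1)) * Bd) := by
        refine norm_sum_le_of_le _ (fun i hi => ?_)
        rw [Finset.mem_range] at hi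
        have hi2 : 2 ^ i ≤ x := Nat.pow_le_of_le_log (by omega) (by omega)
        have hip : 0 < 2 ^ i := by positivity
        set M := 2 ^ (i + 1) with hM
        set N := x / 2 ^ i with hN
        have hN1 : 1 ≤ N := by rw [hN, Nat.le_div_iff_mul_le hip]; omega
        have hM1 : 1 ≤ M := Nat.one_le_two_pow
        have hMN : M * N ≤ 2 * x := by
          have : 2 ^ i * N ≤ x := Nat.mul_div_le x _
          rw [hM, pow_succ]; nlinarith
        have hNx : N ≤ x := Nat.div_le_self _ _
        set a' : ℕ → ℂ := fun m => if Nat.log 2 m = i ∧ m ≤ x then α m else 0 with ha'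
        have ha1 : ∀ m, ‖a' m‖ ≤ 1 := by
          intro m; rw [ha']; simp only; split_ifs
          · exact hα m
          · simp
        have hmem : ∀ m, a' m ≠ 0 → 2 ^ i ≤ m ∧ m < M ∧ m ≤ x ∧ Nat.log 2 m = i := by
          intro m hm
          rw [ha'] at hm
          simp only [ne_eq, ite_eq_right_iff, not_forall] at hm
          obtain ⟨⟨h1, h2⟩, h3⟩ := hm
          have hm0 : m ≠ 0 := by rintro rfl; exact h3 (hα0 0 (by omega))
          refine ⟨?_, ?_, h2, h1⟩
          · rw [← h1]; exact Nat.pow_log_le_self 2 hm0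
          · rw [hM, ← h1]; exact Nat.lt_pow_succ_log_self (by norm_num) m
        have e : ∑ m ∈ (Finset.range (x + 1)).filter (fun m => Nat.log 2 m = i), ∑ k ∈ Finset.range (x / m + 1), α m * β k * (spinA (m * k) : ℂ) =
            ∑ m ∈ Finset.range (M + 1), ∑ k ∈ Finset.range (N + 1), a' m * β k * ((if k < x / m + 1 then (1 : ℂ) else 0) * (spinA (m * k) : ℂ)) := by
          have e1 : ∑ m ∈ (Finset.range (x + 1)).filter (fun m => Nat.log 2 m = i), ∑ k ∈ Finset.range (x / m + 1), α m * β k * (spinA (m * k) : ℂ) =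
            ∑ m ∈ Finset.range (x + 1), ∑ k ∈ Finset.range (x / m + 1), a' m * β k * (spinA (m * k) : ℂ) := by
            rw [Finset.sum_filter]
            apply Finset.sum_congr rfl; intro m hm
            rw [Finset.mem_range] at hm
            by_cases h : Nat.log 2 m = i
            · have : a' m = α m := by rw [ha']; simp only; rw [if_pos ⟨h, by omega⟩]
              rw [if_pos h, this]
            · have : a' m = 0 := by rw [ha']; simp only; rw [if_neg (fun hh => h hh.1)]
              rw [if_neg h, this]; simp
          have e2 : ∑ m ∈ Finset.range (x + 1), ∑ k ∈ Finset.range (x / m + 1), a' m * β k * (spinA (m * k) : ℂ) =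
              ∑ m ∈ Finset.range (x + 1 + (M + 1)), ∑ k ∈ Finset.range (x / m + 1), a' m * β k * (spinA (m * k) : ℂ) := by
            apply Finset.sum_subset
            · intro m; simp only [Finset.mem_range]; omega
            · intro m _ hm
              rw [Finset.mem_range] at hm
              have : a' m = 0 := by by_contra h; have := hmem m h; omega
              rw [this]; simp
          have e3 : ∑ m ∈ Finset.range (M + 1), ∑ k ∈ Finset.range (N + 1), a' m * β k * ((if k < x / m + 1 then (1 : ℂ) else 0) * (spinA (m * k) : ℂ)) =
              ∑ m ∈ Finset.range (x + 1 + (M + 1)), ∑ k ∈ Finset.range (N + 1), a' m * β k * ((if k < x / m + 1 then (1 : ℂ) else 0) * (spinA (m * k) : ℂ)) := by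
            apply Finset.sum_subset
            · intro m; simp only [Finset.mem_range]; omega
            · intro m _ hm
              rw [Finset.mem_range] at hm
              have : a' m = 0 := by by_contra h; have := hmem m h; omega
              rw [this]; simp
          rw [e1, e2, e3]
          apply Finset.sum_congr rfl; intro m _
          by_cases h : a' m = 0
          · rw [h]; simp
          · obtain ⟨h1, h2, h3, h4⟩ := hmem m h
            have hle : x / m ≤ N := Nat.div_le_div_left h1 hip
            symm
            calc _ = ∑ k ∈ Finset.range (N + 1), (if k < x / m + 1 then a' m * β k * (spinA (m * k) : ℂ) else 0) := by
                  apply Finset.sum_congr rfl; intro k _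
                  split_ifs <;> simp
              _ = _ := by
                  rw [← Finset.sum_filter]
                  apply Finset.sum_congr _ (fun _ _ => rfl)
                  ext k; simp only [Finset.mem_filter, Finset.mem_range]; omega
        rw [e]
        by_cases hcase : M ≤ y ∨ N ≤ y
        · rw [Finset.sum_eq_zero]
          · simp only [norm_zero]; positivity
          · intro m _
            apply Finset.sum_eq_zero
            intro k hk
            rw [Finset.mem_range] at hk
            rcases hcase with h | h
            · have : a' m = 0 := by
                by_contra h'
                obtain ⟨h1, h2, h3, h4⟩ := hmem m h'
                apply h'
                rw [ha']; simp only; rw [hα0 m (by omega)]; simp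
              rw [this]; simp
            · rw [hβ0 k (by omega)]; simp
        · push Not at hcase
          have hsep := spin_sep_bound (fun m k => (spinA (m * k) : ℂ)) M N (fun m => x / m + 1) Bd ?_ a' β ha1 hβ
          · refine hsep.trans ?_
            gcongr
          · intro a b h1 h2
            have hb := hbil M N hM1 hN1 a b h1 h2
            set T := ‖∑ m ∈ Finset.range (M + 1), ∑ k ∈ Finset.range (N + 1), a m * b k * (spinA (m * k) : ℂ)‖ with hT
            have hT0 : 0 ≤ T := norm_nonneg _
            have hmin : (y : ℝ) ≤ (min M N : ℕ) := by
              exact_mod_cast le_min hcase.1.le hcase.2.le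
            have hMN' : (M : ℝ) * N ≤ 2 * x := by exact_mod_cast hMN
            have h3 : y * T ^ 12 ≤ C * (2 * (x : ℝ)) ^ (12 + δ) := by
              calc y * T ^ 12 ≤ (min M N : ℕ) * T ^ 12 := by gcongr
                _ ≤ _ := hb
                _ ≤ C * (2 * (x : ℝ)) ^ 12 * (2 * (x : ℝ)) ^ δ := by gcongr
                _ = _ := by
                  rw [Real.rpow_add (by positivity), mul_assoc]
                  congr 2
                  exact_mod_cast (Real.rpow_natCast (2 * (x : ℝ)) 12).symm
            have h4 : T ^ 12 ≤ C * (2 * (x : ℝ)) ^ (12 + δ) / y := by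
              rw [le_div_iff₀ (by positivity)]; linarith
            calc T = (T ^ 12) ^ (1 / 12 : ℝ) := by
                  rw [← Real.rpow_natCast, ← Real.rpow_mul hT0]; norm_num
              _ ≤ Bd := by rw [hBd]; gcongr
    _ = _ := by rw [Finset.sum_const, nsmul_eq_mul, Finset.card_range]; push_cast; ring
end

section
open Finset

lemma spinA_abs_le (n : ℕ) : |((spinA n : ℤ) : ℝ)| ≤ ((n.divisors.card : ℕ) : ℝ) := by
  classical
  unfold spinA
  split_ifs with h
  · have hodd : Odd n := by rw [Nat.odd_iff]; omega
    have h1 : ∑ W ∈ spinDS n, spinS W = ∑ W ∈ (spinDS n).filter spinPr, spinS W := by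
      symm
      apply Finset.sum_subset (Finset.filter_subset _ _)
      intro W hW hW2
      by_contra h0
      apply hW2
      rw [Finset.mem_filter]
      refine ⟨hW, ?_⟩
      rw [mem_spinDS] at hW
      have h3 := spin_odd_of_norm (w := W) (by rw [hW.2]; omega)
      have h4 : 0 < W.im := by have := hW.1.2.1; omega
      exact spinS_coprime h4 h0
    rw [h1]
    have h2 := spinDS_card n hodd
    have h5 : |∑ W ∈ (spinDS n).filter spinPr, spinS W| ≤ (((spinDS n).filter spinPr).card : ℤ) := by
      refine (Finset.abs_sum_le_sum_abs _ _).trans ?_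
      have : ∀ W ∈ (spinDS n).filter spinPr, |spinS W| ≤ 1 := fun W _ => by
        unfold spinS; exact spin_jacobi_abs_le _ _
      refine (Finset.sum_le_sum this).trans ?_
      simp
    have h6 : |∑ W ∈ (spinDS n).filter spinPr, spinS W| ≤ ((n.divisors.card : ℕ) : ℤ) := by
      refine h5.trans ?_
      refine le_trans (le_of_eq ?_) (Int.ofNat_le.2 h2)
      congr!
    exact_mod_cast h6
  · simp

lemma spin_conv (f g : ArithmeticFunction ℝ) (A : ℕ → ℝ) (N : ℕ) :
    ∑ n ∈ Ioc 0 N, (f * g) n * A n = ∑ m ∈ Ioc 0 N, ∑ k ∈ Ioc 0 (N / m), f m * g k * A (m * k) := by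
  trans ∑ x ∈ Ioc 0 N ×ˢ Ioc 0 N with x.1 * x.2 ≤ N, f x.1 * g x.2 * A (x.1 * x.2)
  · simp only [ArithmeticFunction.mul_apply]
    trans ∑ n ∈ Ioc 0 N, ∑ x ∈ Ioc 0 N ×ˢ Ioc 0 N with x.1 * x.2 = n, f x.1 * g x.2 * A (x.1 * x.2)
    · refine sum_congr rfl fun n hn ↦ ?_
      simp only [mem_Ioc] at hn
      rw [Nat.divisorsAntidiagonal_eq_prod_filter_of_le hn.1.ne' hn.2, Finset.sum_mul]
      refine sum_congr rfl fun x hx => ?_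
      rw [(Finset.mem_filter.1 hx).2]
    · simp_rw [sum_filter]
      rw [sum_comm]
      exact sum_congr rfl fun _ _ ↦ (by simp_all)
  · rw [sum_filter, sum_product]
    refine sum_congr rfl fun n hn ↦ ?_
    simp only [sum_ite, not_le, sum_const_zero, add_zero]
    congr 1
    ext k
    simp only [mem_filter, mem_Ioc, and_assoc, and_congr_right_iff] at hn ⊢
    intro _
    rw [Nat.le_div_iff_mul_le hn.1, mul_comm k n]
    constructor
    · intro h; exact h.2
    · intro h; exact ⟨(Nat.le_mul_of_pos_left k hn.1).trans h, h⟩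

lemma spin_abel_aux (f c : ℕ → ℝ) (hf : Monotone f) (B : ℝ) (n : ℕ)
    (hB : ∀ j ≤ n, |∑ k ∈ Ioc 0 j, c k| ≤ B) :
    |∑ k ∈ Ioc 0 n, f k * c k - f n * ∑ k ∈ Ioc 0 n, c k| ≤ B * (f n - f 0) := by
  induction n with
  | zero => simp
  | succ n ih =>
    have h1 := ih (fun j hj => hB j (by omega))
    have h2 := hB n (by omega)
    rw [Finset.sum_Ioc_succ_top (by omega), Finset.sum_Ioc_succ_top (by omega)]
    have h3 : f n ≤ f (n + 1) := hf (by omega)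
    have e : ∑ k ∈ Ioc 0 n, f k * c k + f (n + 1) * c (n + 1) - f (n + 1) * (∑ k ∈ Ioc 0 n, c k + c (n + 1))
       = (∑ k ∈ Ioc 0 n, f k * c k - f n * ∑ k ∈ Ioc 0 n, c k) - (f (n + 1) - f n) * ∑ k ∈ Ioc 0 n, c k := by ring
    rw [e]
    refine (abs_sub _ _).trans ?_
    rw [abs_mul, abs_of_nonneg (sub_nonneg.2 h3)]
    have := mul_le_mul_of_nonneg_left h2 (sub_nonneg.2 h3)
    nlinarith

lemma spin_abel_log (c : ℕ → ℝ) (B : ℝ) (n : ℕ)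
    (hB : ∀ j ≤ n, |∑ k ∈ Ioc 0 j, c k| ≤ B) :
    |∑ k ∈ Ioc 0 n, Real.log k * c k| ≤ 2 * B * Real.log n := by
  have hm : Monotone (fun k : ℕ => Real.log (k : ℝ)) := by
    intro a b hab
    rcases Nat.eq_zero_or_pos a with rfl | ha
    · simp only [Nat.cast_zero, Real.log_zero]; exact Real.log_natCast_nonneg b
    · exact Real.log_le_log (by exact_mod_cast ha) (by exact_mod_cast hab)
  have h := spin_abel_aux _ c hm B n hB
  simp only [Nat.cast_zero, Real.log_zero, sub_zero] at h
  have h2 := hB n le_rfl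
  have h3 := Real.log_natCast_nonneg n
  have h4 : |Real.log n * ∑ k ∈ Ioc 0 n, c k| ≤ Real.log n * B := by
    rw [abs_mul, abs_of_nonneg h3]; exact mul_le_mul_of_nonneg_left h2 h3
  have := abs_add_le (∑ k ∈ Ioc 0 n, Real.log k * c k - Real.log n * ∑ k ∈ Ioc 0 n, c k) (Real.log n * ∑ k ∈ Ioc 0 n, c k)
  rw [sub_add_cancel] at this
  nlinarith

lemma spin_abel_anti (g c : ℕ → ℝ) (hg : Antitone g) (hg0 : ∀ n, 0 ≤ g n) (B : ℝ) (n : ℕ)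
    (hB : ∀ j ≤ n, |∑ k ∈ Ioc 0 j, c k| ≤ B) :
    |∑ k ∈ Ioc 0 n, g k * c k| ≤ B * g 0 := by
  have hm : Monotone (fun k : ℕ => - g k) := fun a b hab => neg_le_neg (hg hab)
  have h := spin_abel_aux _ c hm B n hB
  have h2 := hB n le_rfl
  have h4 : |g n * ∑ k ∈ Ioc 0 n, c k| ≤ g n * B := by
    rw [abs_mul, abs_of_nonneg (hg0 n)]; exact mul_le_mul_of_nonneg_left h2 (hg0 n)
  have e : ∑ k ∈ Ioc 0 n, g k * c k = g n * ∑ k ∈ Ioc 0 n, c k -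
    (∑ k ∈ Ioc 0 n, -g k * c k - -g n * ∑ k ∈ Ioc 0 n, c k) := by
    simp only [neg_mul, Finset.sum_neg_distrib]; ring
  rw [e]
  refine (abs_sub _ _).trans ?_
  nlinarith

/-- Sums along multiples of `d`. -/
lemma spin_mult_sum (F : ℕ → ℤ) (h0 : F 0 = 0) (d j : ℕ) (hd : 1 ≤ d) :
    ∑ n ∈ (range (d * j + 1)).filter (fun n => d ∣ n), F n = ∑ k ∈ Ioc 0 j, F (d * k) := by
  symm
  have : ∑ k ∈ Ioc 0 j, F (d * k) = ∑ k ∈ range (j + 1), F (d * k) := by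
    apply Finset.sum_subset
    · intro k; simp only [mem_Ioc, mem_range]; omega
    · intro k hk hk2
      simp only [mem_Ioc, mem_range] at hk hk2
      have : k = 0 := by omega
      subst this; simpa using h0
  rw [this]
  apply Finset.sum_bij (fun k _ => d * k)
  · intro k hk
    simp only [mem_range, mem_filter] at hk ⊢
    exact ⟨Nat.lt_succ_of_le (Nat.mul_le_mul_left d (by omega)), dvd_mul_right _ _⟩
  · intro a _ b _ h
    exact Nat.eq_of_mul_eq_mul_left hd h
  · intro n hn
    simp only [mem_range, mem_filter] at hn
    obtain ⟨h1, k, rfl⟩ := hn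
    refine ⟨k, ?_, rfl⟩
    rw [mem_range]
    have : d * k ≤ d * j := by omega
    have := Nat.le_of_mul_le_mul_left this hd
    omega
  · intros; rfl

lemma spinA_zero : spinA 0 = 0 := by simp [spinA]

lemma spin_typeI' (δ : ℝ) (hδ : 0 < δ) : ∃ C : ℝ, 1 ≤ C ∧ ∀ d j x : ℕ, 1 ≤ d → d * j ≤ x →
    |∑ k ∈ Ioc 0 j, ((spinA (d * k) : ℤ) : ℝ)| ≤ C * (x : ℝ) ^ (3 / 4 + δ) := by
  obtain ⟨C, hC, h⟩ := spin_typeI δ hδ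
  refine ⟨C, hC, fun d j x hd hx => ?_⟩
  rcases Nat.eq_zero_or_pos j with rfl | hj
  · simp; positivity
  have h1 := h d (d * j) hd (Nat.mul_pos hd hj)
  rw [spin_mult_sum _ spinA_zero d j hd] at h1
  push_cast at h1
  refine h1.trans ?_
  gcongr
  exact_mod_cast hx
end

section
open Finset

noncomputable def spinLo (f : ArithmeticFunction ℝ) (y : ℕ) : ArithmeticFunction ℝ :=
  ⟨fun n => if n ≤ y then f n else 0, by simp⟩

lemma spinLo_apply (f : ArithmeticFunction ℝ) (y n : ℕ) : spinLo f y n = if n ≤ y then f n else 0 := rfl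

noncomputable def spinLam : ArithmeticFunction ℝ := ArithmeticFunction.vonMangoldt
noncomputable def spinMu : ArithmeticFunction ℝ := (ArithmeticFunction.moebius : ArithmeticFunction ℝ)
noncomputable def spinZe : ArithmeticFunction ℝ := (ArithmeticFunction.zeta : ArithmeticFunction ℝ)

lemma spin_vaughan (y : ℕ) : spinLam = spinLo spinLam y + spinLo spinMu y * ArithmeticFunction.log
    - spinLo spinMu y * spinLo spinLam y * spinZe
    + (spinMu - spinLo spinMu y) * ((spinLam - spinLo spinLam y) * spinZe) := by
  have h1 : spinLam * spinZe = ArithmeticFunction.log := ArithmeticFunction.vonMangoldt_mul_zeta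
  have h2 : spinMu * spinZe = 1 := ArithmeticFunction.coe_moebius_mul_coe_zeta
  rw [← h1]
  linear_combination -(spinLam - spinLo spinLam y) * h2

lemma spinMu_abs (n : ℕ) : |spinMu n| ≤ 1 := by
  have : spinMu n = ((ArithmeticFunction.moebius n : ℤ) : ℝ) := rfl
  rw [this]
  exact_mod_cast ArithmeticFunction.abs_moebius_le_one

lemma spinLam_nonneg (n : ℕ) : 0 ≤ spinLam n := ArithmeticFunction.vonMangoldt_nonneg
lemma spinLam_le (n : ℕ) : spinLam n ≤ Real.log n := ArithmeticFunction.vonMangoldt_le_log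

lemma spinLo_lam_nonneg (y n : ℕ) : 0 ≤ spinLo spinLam y n := by
  rw [spinLo_apply]; split_ifs; exacts [spinLam_nonneg n, le_rfl]
lemma spinLo_lam_le (y n : ℕ) : spinLo spinLam y n ≤ spinLam n := by
  rw [spinLo_apply]; split_ifs; exacts [le_rfl, spinLam_nonneg n]
lemma spinLo_mu_abs (y n : ℕ) : |spinLo spinMu y n| ≤ 1 := by
  rw [spinLo_apply]; split_ifs; exacts [spinMu_abs n, by simp]

/-- `(μ₁ * Λ₁)` is bounded by `log`. -/
lemma spin_muLam (y n : ℕ) : |(spinLo spinMu y * spinLo spinLam y) n| ≤ Real.log n := by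
  rw [ArithmeticFunction.mul_apply]
  refine (Finset.abs_sum_le_sum_abs _ _).trans ?_
  have h1 : ∀ p ∈ n.divisorsAntidiagonal, |spinLo spinMu y p.1 * spinLo spinLam y p.2| ≤ spinLam p.2 := by
    intro p _
    rw [abs_mul, abs_of_nonneg (spinLo_lam_nonneg y p.2)]
    have := spinLo_mu_abs y p.1
    have := spinLo_lam_le y p.2
    have := spinLo_lam_nonneg y p.2
    nlinarith
  refine (Finset.sum_le_sum h1).trans ?_
  rw [Nat.sum_divisorsAntidiagonal' (f := fun _ b => spinLam b)]
  exact ArithmeticFunction.vonMangoldt_sum.le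

lemma spin_muLam_zero (y n : ℕ) (h : y ^ 2 < n) : (spinLo spinMu y * spinLo spinLam y) n = 0 := by
  rw [ArithmeticFunction.mul_apply]
  apply Finset.sum_eq_zero
  intro p hp
  rw [Nat.mem_divisorsAntidiagonal] at hp
  rw [spinLo_apply, spinLo_apply]
  by_cases h1 : p.1 ≤ y
  · by_cases h2 : p.2 ≤ y
    · exfalso
      have := Nat.mul_le_mul h1 h2
      rw [hp.1] at this
      nlinarith
    · rw [if_neg h2, mul_zero]
  · rw [if_neg h1, zero_mul]

lemma spin_b_bound (y n : ℕ) : |((spinLam - spinLo spinLam y) * spinZe) n| ≤ Real.log n := by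
  have h0 : ∀ m, 0 ≤ (spinLam - spinLo spinLam y) m ∧ (spinLam - spinLo spinLam y) m ≤ spinLam m := by
    intro m
    have : (spinLam - spinLo spinLam y) m = spinLam m - spinLo spinLam y m := rfl
    rw [this]
    have := spinLo_lam_le y m
    have := spinLo_lam_nonneg y m
    constructor <;> linarith
  unfold spinZe
  rw [ArithmeticFunction.coe_mul_zeta_apply, abs_of_nonneg (Finset.sum_nonneg fun i _ => (h0 i).1)]
  refine (Finset.sum_le_sum fun i _ => (h0 i).2).trans ?_
  exact ArithmeticFunction.vonMangoldt_sum.le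

lemma spin_b_zero (y n : ℕ) (h : n ≤ y) : ((spinLam - spinLo spinLam y) * spinZe) n = 0 := by
  unfold spinZe
  rw [ArithmeticFunction.coe_mul_zeta_apply]
  apply Finset.sum_eq_zero
  intro m hm
  have : (spinLam - spinLo spinLam y) m = spinLam m - spinLo spinLam y m := rfl
  rw [this, spinLo_apply, if_pos ((Nat.divisor_le hm).trans h), sub_self]

lemma spin_mu2 (y n : ℕ) : (spinMu - spinLo spinMu y) n = if n ≤ y then 0 else spinMu n := by
  have : (spinMu - spinLo spinMu y) n = spinMu n - spinLo spinMu y n := rfl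
  rw [this, spinLo_apply]
  split_ifs <;> simp

/-- Term 1. -/
lemma spin_term1 (δ : ℝ) (hδ : 0 < δ) : ∃ C : ℝ, 1 ≤ C ∧ ∀ x y : ℕ, 1 ≤ x → y ≤ x →
    |∑ n ∈ Ioc 0 x, spinLo spinLam y n * ((spinA n : ℤ) : ℝ)| ≤ C * (y * Real.log x * (x : ℝ) ^ δ) := by
  obtain ⟨C, hC, h⟩ := spin_divisor_bound δ hδ
  refine ⟨C, hC, fun x y hx hy => ?_⟩
  have e : ∑ n ∈ Ioc 0 x, spinLo spinLam y n * ((spinA n : ℤ) : ℝ) = ∑ n ∈ Ioc 0 y, spinLam n * ((spinA n : ℤ) : ℝ) := by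
    symm
    have : ∑ n ∈ Ioc 0 y, spinLam n * ((spinA n : ℤ) : ℝ) = ∑ n ∈ Ioc 0 y, spinLo spinLam y n * ((spinA n : ℤ) : ℝ) := by
      refine sum_congr rfl fun n hn => ?_
      rw [spinLo_apply, if_pos (mem_Ioc.1 hn).2]
    rw [this]
    apply Finset.sum_subset
    · intro n; simp only [mem_Ioc]; omega
    · intro n h1 h2
      simp only [mem_Ioc] at h1 h2
      rw [spinLo_apply, if_neg (by omega), zero_mul]
  rw [e]
  refine (Finset.abs_sum_le_sum_abs _ _).trans ?_
  have h1 : ∀ n ∈ Ioc 0 y, |spinLam n * ((spinA n : ℤ) : ℝ)| ≤ Real.log x * (C * (x : ℝ) ^ δ) := by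
    intro n hn
    rw [mem_Ioc] at hn
    rw [abs_mul, abs_of_nonneg (spinLam_nonneg n)]
    have hnx : (n : ℝ) ≤ x := by exact_mod_cast hn.2.trans hy
    refine mul_le_mul ((spinLam_le n).trans (Real.log_le_log (by exact_mod_cast hn.1) hnx)) ?_ (abs_nonneg _) (Real.log_natCast_nonneg x)
    refine (spinA_abs_le n).trans ((h n).trans ?_)
    gcongr
  refine (Finset.sum_le_sum h1).trans ?_
  rw [sum_const, nsmul_eq_mul, Nat.card_Ioc, Nat.sub_zero]
  apply le_of_eq; ring

/-- Term 2. -/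
lemma spin_term2 (B : ℝ) (hB0 : 0 ≤ B) (x y : ℕ) (hx : 1 ≤ x)
    (hB : ∀ d j : ℕ, 1 ≤ d → d * j ≤ x → |∑ k ∈ Ioc 0 j, ((spinA (d * k) : ℤ) : ℝ)| ≤ B) :
    |∑ n ∈ Ioc 0 x, (spinLo spinMu y * ArithmeticFunction.log) n * ((spinA n : ℤ) : ℝ)| ≤
      y * (2 * B * Real.log x) := by
  rw [spin_conv _ _ (fun n => ((spinA n : ℤ) : ℝ))]
  have hlx := Real.log_natCast_nonneg x
  refine (Finset.abs_sum_le_sum_abs _ _).trans ?_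
  have h1 : ∀ m ∈ Ioc 0 x, |∑ k ∈ Ioc 0 (x / m), spinLo spinMu y m * ArithmeticFunction.log k * ((spinA (m * k) : ℤ) : ℝ)| ≤ if m ≤ y then 2 * B * Real.log x else 0 := by
    intro m hm
    rw [mem_Ioc] at hm
    split_ifs with hmy
    · simp_rw [mul_assoc]
      rw [← Finset.mul_sum, abs_mul]
      have h2 : |∑ k ∈ Ioc 0 (x / m), Real.log k * ((spinA (m * k) : ℤ) : ℝ)| ≤ 2 * B * Real.log ((x / m : ℕ) : ℝ) := by
        apply spin_abel_log
        intro j hj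
        exact hB m j hm.1 ((Nat.mul_le_mul_left m hj).trans (Nat.mul_div_le x m))
      have h3 : Real.log ((x / m : ℕ) : ℝ) ≤ Real.log x := by
        apply Real.log_le_log
        · exact_mod_cast Nat.div_pos hm.2 hm.1
        · exact_mod_cast Nat.div_le_self x m
      have h4 := spinLo_mu_abs y m
      calc _ ≤ 1 * (2 * B * Real.log x) := by
            refine mul_le_mul h4 (h2.trans ?_) (abs_nonneg _) zero_le_one
            exact mul_le_mul_of_nonneg_left h3 (by positivity)
        _ = _ := by ring
    · rw [spinLo_apply, if_neg hmy]; simp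
  refine (Finset.sum_le_sum h1).trans ?_
  rw [← Finset.sum_filter, sum_const, nsmul_eq_mul]
  refine mul_le_mul_of_nonneg_right ?_ (by positivity)
  have : ((Ioc 0 x).filter (fun m => m ≤ y)).card ≤ (Ioc 0 y).card := by
    apply Finset.card_le_card
    intro m; simp only [mem_filter, mem_Ioc]; omega
  rw [Nat.card_Ioc] at this
  exact_mod_cast this

/-- Term 3. -/
lemma spin_term3 (B : ℝ) (hB0 : 0 ≤ B) (x y : ℕ) (hx : 1 ≤ x)
    (hB : ∀ d j : ℕ, 1 ≤ d → d * j ≤ x → |∑ k ∈ Ioc 0 j, ((spinA (d * k) : ℤ) : ℝ)| ≤ B) :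
    |∑ n ∈ Ioc 0 x, (spinLo spinMu y * spinLo spinLam y * spinZe) n * ((spinA n : ℤ) : ℝ)| ≤
      (y : ℝ) ^ 2 * (Real.log x * B) := by
  rw [spin_conv _ _ (fun n => ((spinA n : ℤ) : ℝ))]
  have hlx := Real.log_natCast_nonneg x
  refine (Finset.abs_sum_le_sum_abs _ _).trans ?_
  have h1 : ∀ m ∈ Ioc 0 x, |∑ k ∈ Ioc 0 (x / m), (spinLo spinMu y * spinLo spinLam y) m * spinZe k * ((spinA (m * k) : ℤ) : ℝ)| ≤ if m ≤ y ^ 2 then Real.log x * B else 0 := by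
    intro m hm
    rw [mem_Ioc] at hm
    split_ifs with hmy
    · simp_rw [mul_assoc]
      rw [← Finset.mul_sum, abs_mul]
      have e : ∑ k ∈ Ioc 0 (x / m), spinZe k * ((spinA (m * k) : ℤ) : ℝ) = ∑ k ∈ Ioc 0 (x / m), ((spinA (m * k) : ℤ) : ℝ) := by
        refine sum_congr rfl fun k hk => ?_
        rw [mem_Ioc] at hk
        have : spinZe k = 1 := by
          unfold spinZe
          rw [ArithmeticFunction.natCoe_apply, ArithmeticFunction.zeta_apply, if_neg (by omega), Nat.cast_one]
        rw [this, one_mul]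
      rw [e]
      have h2 := hB m (x / m) hm.1 (Nat.mul_div_le x m)
      refine mul_le_mul ((spin_muLam y m).trans ?_) h2 (abs_nonneg _) hlx
      exact Real.log_le_log (by exact_mod_cast hm.1) (by exact_mod_cast hm.2)
    · rw [spin_muLam_zero y m (by omega)]; simp
  refine (Finset.sum_le_sum h1).trans ?_
  rw [← Finset.sum_filter, sum_const, nsmul_eq_mul]
  refine mul_le_mul_of_nonneg_right ?_ (by positivity)
  have : ((Ioc 0 x).filter (fun m => m ≤ y ^ 2)).card ≤ (Ioc 0 (y ^ 2)).card := by
    apply Finset.card_le_card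
    intro m; simp only [mem_filter, mem_Ioc]; omega
  rw [Nat.card_Ioc] at this
  exact_mod_cast this

/-- Term 4. -/
lemma spin_term4 (δ : ℝ) (hδ : 0 < δ) : ∃ C : ℝ, 1 ≤ C ∧ ∀ x y : ℕ, 2 ≤ x → 1 ≤ y →
    |∑ n ∈ Ioc 0 x, ((spinMu - spinLo spinMu y) * ((spinLam - spinLo spinLam y) * spinZe)) n * ((spinA n : ℤ) : ℝ)| ≤
      Real.log x * ((Nat.log 2 x + 1) * ((2 + Real.log (x + 1)) * (C * (2 * (x : ℝ)) ^ (12 + δ) / y) ^ (1 / 12 : ℝ))) := by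
  obtain ⟨C, hC, h⟩ := spin_typeII δ hδ
  refine ⟨C, hC, fun x y hx hy => ?_⟩
  have hl : 0 < Real.log x := Real.log_pos (by exact_mod_cast hx)
  set b := (spinLam - spinLo spinLam y) * spinZe with hb
  set a := spinMu - spinLo spinMu y with ha
  have ha1 : ∀ m, |a m| ≤ 1 := by
    intro m; rw [ha, spin_mu2]; split_ifs; exacts [by simp, spinMu_abs m]
  have ha0 : ∀ m ≤ y, a m = 0 := by
    intro m hm; rw [ha, spin_mu2, if_pos hm]
  let β : ℕ → ℂ := fun k => if k ≤ x then ((b k / Real.log x : ℝ) : ℂ) else 0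
  have h1 := h x y (by omega) hy (fun m => ((a m : ℝ) : ℂ)) β
    (fun m => by rw [Complex.norm_real]; exact ha1 m)
    (fun k => by
      show ‖if k ≤ x then ((b k / Real.log x : ℝ) : ℂ) else 0‖ ≤ 1
      split_ifs with hk
      · rw [Complex.norm_real, Real.norm_eq_abs, abs_div, abs_of_pos hl, div_le_one hl]
        rcases Nat.eq_zero_or_pos k with rfl | hk0
        · simp [hl.le]
        refine (spin_b_bound y k).trans ?_
        exact Real.log_le_log (by exact_mod_cast hk0) (by exact_mod_cast hk)
      · simp)
    (fun m hm => by rw [ha0 m hm]; simp)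
    (fun k hk => by
      show (if k ≤ x then ((b k / Real.log x : ℝ) : ℂ) else 0) = 0
      rw [hb, spin_b_zero y k hk]; simp)
  have e : ((∑ n ∈ Ioc 0 x, (a * b) n * ((spinA n : ℤ) : ℝ) : ℝ) : ℂ) = (Real.log x : ℂ) *
      ∑ m ∈ range (x + 1), ∑ k ∈ range (x / m + 1), ((a m : ℝ) : ℂ) * β k * (spinA (m * k) : ℂ) := by
    rw [spin_conv _ _ (fun n => ((spinA n : ℤ) : ℝ))]
    have hsub : ∀ N, Ioc 0 N ⊆ range (N + 1) := by
      intro N n; simp only [mem_Ioc, mem_range]; omega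
    have hz : ∀ N, ∀ n ∈ range (N + 1), n ∉ Ioc 0 N → n = 0 := by
      intro N n; simp only [mem_Ioc, mem_range]; omega
    rw [← Finset.sum_subset (hsub x) (fun m hm hm2 => by
      rw [hz x m hm hm2]
      apply Finset.sum_eq_zero
      intro k _
      simp)]
    push_cast
    rw [Finset.mul_sum]
    refine sum_congr rfl fun m hm => ?_
    rw [← Finset.sum_subset (hsub (x / m)) (fun k hk hk2 => by
      rw [hz _ k hk hk2, Nat.mul_zero, spinA_zero]; simp)]
    rw [Finset.mul_sum]
    refine sum_congr rfl fun k hk => ?_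
    have hkx : k ≤ x := (mem_Ioc.1 hk).2.trans (Nat.div_le_self x m)
    have : β k = ((b k / Real.log x : ℝ) : ℂ) := if_pos hkx
    rw [this]
    push_cast
    have hl' : (Real.log x : ℂ) ≠ 0 := by exact_mod_cast hl.ne'
    rw [Complex.natCast_log] at *
    field_simp
  rw [← Real.norm_eq_abs, ← Complex.norm_real, e, norm_mul, Complex.norm_real, Real.norm_of_nonneg hl.le]
  exact mul_le_mul_of_nonneg_left h1 hl.le
end

section
open Finset

lemma spin_natlog (x : ℕ) (hx : 1 ≤ x) : ((Nat.log 2 x : ℕ) : ℝ) + 1 ≤ 2 * (1 + Real.log x) := by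
  have h1 : ((Nat.log 2 x : ℕ) : ℝ) * Real.log 2 ≤ Real.log x := by
    rw [← Real.log_pow]
    apply Real.log_le_log (by positivity)
    exact_mod_cast Nat.pow_log_le_self 2 (by omega)
  have h2 := Real.log_two_gt_d9
  have h3 : (0 : ℝ) ≤ ((Nat.log 2 x : ℕ) : ℝ) := by positivity
  nlinarith

lemma spin_rpow_le {R a b : ℝ} (hR : 1 ≤ R) (h : a ≤ b) : R ^ a ≤ R ^ b :=
  Real.rpow_le_rpow_of_exponent_le hR h

lemma spin_lam_bound : ∃ C : ℝ, 1 ≤ C ∧ ∀ x : ℕ, 2 ≤ x →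
    |∑ n ∈ Ioc 0 x, spinLam n * ((spinA n : ℤ) : ℝ)| ≤ C * (x : ℝ) ^ (149 / 150 : ℝ) := by
  obtain ⟨C1, hC1, H1⟩ := spin_term1 (1 / 1000) (by norm_num)
  obtain ⟨C2, hC2, H2⟩ := spin_typeI' (1 / 1000) (by norm_num)
  obtain ⟨C4, hC4, H4⟩ := spin_term4 (1 / 1000) (by norm_num)
  have HL := spin_log_bound (1 / 10000) (by norm_num)
  set K : ℝ := 1 + 1 / (1 / 10000 : ℝ) with hK
  have hK1 : 1 ≤ K := by rw [hK]; norm_num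
  set D : ℝ := (C4 * 2 ^ (12 + 1 / 1000 : ℝ) * 2) ^ (1 / 12 : ℝ) with hD
  have hD0 : 0 ≤ D := by positivity
  refine ⟨C1 * K + 2 * C2 * K + K * C2 + 6 * K ^ 3 * D, ?_, fun x hx => ?_⟩
  · have : 1 * 1 ≤ C1 * K := mul_le_mul hC1 hK1 zero_le_one (by linarith)
    have : 0 ≤ 2 * C2 * K + K * C2 + 6 * K ^ 3 * D := by positivity
    linarith
  have hR : (1 : ℝ) ≤ x := by exact_mod_cast (by omega : 1 ≤ x)
  have hx1 : 1 ≤ x := by omega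
  set R : ℝ := (x : ℝ) with hRdef
  have hR0 : 0 < R := by linarith
  have hl0 : 0 ≤ Real.log R := Real.log_nonneg hR
  have hlK : 1 + Real.log R ≤ K * R ^ (1 / 10000 : ℝ) := HL R hR
  have hlK' : Real.log R ≤ K * R ^ (1 / 10000 : ℝ) := by linarith
  set t : ℝ := R ^ (1 / 10 : ℝ) with ht
  have ht1 : 1 ≤ t := Real.one_le_rpow hR (by norm_num)
  have htR : t ≤ R := by
    calc t ≤ R ^ (1 : ℝ) := spin_rpow_le hR (by norm_num)
      _ = R := Real.rpow_one R
  set y : ℕ := ⌊t⌋₊ with hy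
  have hy1 : 1 ≤ y := Nat.le_floor (by exact_mod_cast ht1)
  have hyt : (y : ℝ) ≤ t := Nat.floor_le (by linarith)
  have hty : t ≤ 2 * y := by
    have h1 : t < y + 1 := Nat.lt_floor_add_one t
    have h2 : (1 : ℝ) ≤ y := by exact_mod_cast hy1
    linarith
  have hyx : y ≤ x := by
    have : (y : ℝ) ≤ (x : ℝ) := hyt.trans htR
    exact_mod_cast this
  have hy0 : (0 : ℝ) < y := by exact_mod_cast hy1
  set B : ℝ := C2 * R ^ (3 / 4 + 1 / 1000 : ℝ) with hB
  have hB0 : 0 ≤ B := by positivity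
  have hBB : ∀ d j : ℕ, 1 ≤ d → d * j ≤ x → |∑ k ∈ Ioc 0 j, ((spinA (d * k) : ℤ) : ℝ)| ≤ B :=
    fun d j hd hj => H2 d j x hd hj
  have T1 := H1 x y hx1 hyx
  have T2 := spin_term2 B hB0 x y hx1 hBB
  have T3 := spin_term3 B hB0 x y hx1 hBB
  have T4 := H4 x y hx hy1
  set P : ℝ := R ^ (149 / 150 : ℝ) with hP
  have E1 : C1 * (y * Real.log R * R ^ (1 / 1000 : ℝ)) ≤ C1 * K * P := by
    have : (y : ℝ) * Real.log R * R ^ (1 / 1000 : ℝ) ≤ t * (K * R ^ (1 / 10000 : ℝ)) * R ^ (1 / 1000 : ℝ) := by gcongr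
    have e : t * (K * R ^ (1 / 10000 : ℝ)) * R ^ (1 / 1000 : ℝ) = K * R ^ (1 / 10 + 1 / 10000 + 1 / 1000 : ℝ) := by
      rw [Real.rpow_add hR0, Real.rpow_add hR0]; ring
    have h3 : R ^ (1 / 10 + 1 / 10000 + 1 / 1000 : ℝ) ≤ P := spin_rpow_le hR (by norm_num)
    calc _ ≤ C1 * (K * R ^ (1 / 10 + 1 / 10000 + 1 / 1000 : ℝ)) := by rw [← e]; gcongr
      _ ≤ C1 * (K * P) := by gcongr
      _ = _ := by ring
  have E2 : y * (2 * B * Real.log R) ≤ 2 * C2 * K * P := by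
    have h1 : y * (2 * B * Real.log R) ≤ t * (2 * B * (K * R ^ (1 / 10000 : ℝ))) := by gcongr
    have e : t * (2 * B * (K * R ^ (1 / 10000 : ℝ))) = 2 * C2 * K * R ^ (1 / 10 + (3 / 4 + 1 / 1000) + 1 / 10000 : ℝ) := by
      rw [Real.rpow_add hR0, Real.rpow_add hR0 (1 / 10)]; ring
    have h3 : R ^ (1 / 10 + (3 / 4 + 1 / 1000) + 1 / 10000 : ℝ) ≤ P := spin_rpow_le hR (by norm_num)
    rw [e] at h1
    refine h1.trans ?_
    gcongr
  have E3 : (y : ℝ) ^ 2 * (Real.log R * B) ≤ K * C2 * P := by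
    have h1 : (y : ℝ) ^ 2 * (Real.log R * B) ≤ t ^ 2 * ((K * R ^ (1 / 10000 : ℝ)) * B) := by gcongr
    have e : t ^ 2 * ((K * R ^ (1 / 10000 : ℝ)) * B) = K * C2 * R ^ (1 / 10 + 1 / 10 + (3 / 4 + 1 / 1000) + 1 / 10000 : ℝ) := by
      rw [Real.rpow_add hR0, Real.rpow_add hR0 (1 / 10 + 1 / 10), Real.rpow_add hR0 (1 / 10)]; ring
    have h3 : R ^ (1 / 10 + 1 / 10 + (3 / 4 + 1 / 1000) + 1 / 10000 : ℝ) ≤ P := spin_rpow_le hR (by norm_num)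
    rw [e] at h1
    refine h1.trans ?_
    gcongr
  have E4 : Real.log R * ((Nat.log 2 x + 1) * ((2 + Real.log (R + 1)) * (C4 * (2 * R) ^ (12 + 1 / 1000 : ℝ) / y) ^ (1 / 12 : ℝ))) ≤ 6 * K ^ 3 * D * P := by
    have g1 : ((Nat.log 2 x : ℕ) : ℝ) + 1 ≤ 2 * (K * R ^ (1 / 10000 : ℝ)) := by
      have := spin_natlog x hx1
      linarith
    have g2 : 2 + Real.log (R + 1) ≤ 3 * (K * R ^ (1 / 10000 : ℝ)) := by
      have h1 : Real.log (R + 1) ≤ Real.log (2 * R) := Real.log_le_log (by linarith) (by linarith)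
      rw [Real.log_mul (by norm_num) hR0.ne'] at h1
      have := Real.log_two_lt_d9
      linarith
    have g3 : (C4 * (2 * R) ^ (12 + 1 / 1000 : ℝ) / y) ^ (1 / 12 : ℝ) ≤ D * R ^ ((12 + 1 / 1000 - 1 / 10) * (1 / 12) : ℝ) := by
      rw [hD, Real.rpow_mul hR0.le, ← Real.mul_rpow (by positivity) (by positivity)]
      apply Real.rpow_le_rpow (by positivity) _ (by norm_num)
      rw [div_le_iff₀ hy0, Real.mul_rpow (by norm_num) hR0.le, Real.rpow_sub hR0 (12 + 1 / 1000) (1 / 10), ← ht]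
      have : C4 * 2 ^ (12 + 1 / 1000 : ℝ) * 2 * (R ^ (12 + 1 / 1000 : ℝ) / t) * y
        = (C4 * (2 ^ (12 + 1 / 1000 : ℝ) * R ^ (12 + 1 / 1000 : ℝ))) * (2 * y / t) := by ring
      rw [this]
      apply le_mul_of_one_le_right (by positivity)
      rw [le_div_iff₀ (by linarith)]; linarith
    have g0 : 0 ≤ 2 + Real.log (R + 1) := by
      have := Real.log_nonneg (by linarith : 1 ≤ R + 1); linarith
    calc _ ≤ (K * R ^ (1 / 10000 : ℝ)) * ((2 * (K * R ^ (1 / 10000 : ℝ))) * ((3 * (K * R ^ (1 / 10000 : ℝ))) * (D * R ^ ((12 + 1 / 1000 - 1 / 10) * (1 / 12) : ℝ)))) := by gcongr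
      _ = 6 * K ^ 3 * D * R ^ (1 / 10000 + 1 / 10000 + 1 / 10000 + (12 + 1 / 1000 - 1 / 10) * (1 / 12) : ℝ) := by
        rw [Real.rpow_add hR0 (1 / 10000 + 1 / 10000 + 1 / 10000), Real.rpow_add hR0 (1 / 10000 + 1 / 10000), Real.rpow_add hR0 (1 / 10000)]; ring
      _ ≤ _ := by
        have : R ^ (1 / 10000 + 1 / 10000 + 1 / 10000 + (12 + 1 / 1000 - 1 / 10) * (1 / 12) : ℝ) ≤ P := spin_rpow_le hR (by norm_num)
        gcongr
  have hsum : ∑ n ∈ Ioc 0 x, spinLam n * ((spinA n : ℤ) : ℝ) =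
     ∑ n ∈ Ioc 0 x, spinLo spinLam y n * ((spinA n : ℤ) : ℝ) +
     ∑ n ∈ Ioc 0 x, (spinLo spinMu y * ArithmeticFunction.log) n * ((spinA n : ℤ) : ℝ) -
     ∑ n ∈ Ioc 0 x, (spinLo spinMu y * spinLo spinLam y * spinZe) n * ((spinA n : ℤ) : ℝ) +
     ∑ n ∈ Ioc 0 x, ((spinMu - spinLo spinMu y) * ((spinLam - spinLo spinLam y) * spinZe)) n * ((spinA n : ℤ) : ℝ) := by
    rw [← Finset.sum_add_distrib, ← Finset.sum_sub_distrib, ← Finset.sum_add_distrib]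
    refine sum_congr rfl fun n _ => ?_
    have hsub : ∀ F G : ArithmeticFunction ℝ, (F - G) n = F n - G n := fun _ _ => rfl
    have h := congrArg (fun F : ArithmeticFunction ℝ => F n) (spin_vaughan y)
    simp only [ArithmeticFunction.add_apply] at h
    rw [hsub (_ + _) _, ArithmeticFunction.add_apply] at h
    rw [h]; ring
  rw [hsum]
  have F4 := T4.trans E4
  have F3 := T3.trans E3
  have F2 := T2.trans E2
  have F1 := T1.trans E1
  rw [abs_le] at *
  constructor <;> linarith [F1.1, F1.2, F2.1, F2.2, F3.1, F3.2, F4.1, F4.2]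
end

section
open Finset

noncomputable def spinLp (n : ℕ) : ℝ := if n.Prime then Real.log n * ((spinA n : ℤ) : ℝ) else 0

lemma spin_prime_log : ∃ C : ℝ, 1 ≤ C ∧ ∀ x : ℕ, 2 ≤ x →
    |∑ n ∈ Ioc 0 x, spinLp n| ≤ C * (x : ℝ) ^ (149 / 150 : ℝ) := by
  obtain ⟨C0, hC0, H0⟩ := spin_lam_bound
  obtain ⟨C1, hC1, H1⟩ := spin_divisor_bound (1 / 1000) (by norm_num)
  have HL := spin_log_bound (1 / 10000) (by norm_num)
  set K : ℝ := 1 + 1 / (1 / 10000 : ℝ) with hK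
  have hK1 : 1 ≤ K := by rw [hK]; norm_num
  refine ⟨C0 + C1 * (2 * K), ?_, fun x hx => ?_⟩
  · have : 0 ≤ C1 * (2 * K) := by positivity
    linarith
  have hR : (1 : ℝ) ≤ x := by exact_mod_cast (by omega : 1 ≤ x)
  have hR0 : (0 : ℝ) < x := by linarith
  have e : ∑ n ∈ Ioc 0 x, spinLp n = ∑ n ∈ Ioc 0 x, spinLam n * ((spinA n : ℤ) : ℝ) -
      ∑ n ∈ Ioc 0 x with ¬ n.Prime, spinLam n * ((spinA n : ℤ) : ℝ) := by
    rw [Finset.sum_filter, ← Finset.sum_sub_distrib]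
    refine sum_congr rfl fun n _ => ?_
    unfold spinLp
    by_cases hn : n.Prime
    · rw [if_pos hn, if_neg (by simpa using hn), sub_zero]
      congr 1
      exact (ArithmeticFunction.vonMangoldt_apply_prime hn).symm
    · rw [if_neg hn, if_pos hn, sub_self]
  rw [e]
  have h1 := H0 x hx
  have h2 : |∑ n ∈ Ioc 0 x with ¬ n.Prime, spinLam n * ((spinA n : ℤ) : ℝ)| ≤ C1 * (2 * K) * (x : ℝ) ^ (149 / 150 : ℝ) := by
    refine (Finset.abs_sum_le_sum_abs _ _).trans ?_
    have h3 : ∀ n ∈ (Ioc 0 x).filter (fun n => ¬ n.Prime), |spinLam n * ((spinA n : ℤ) : ℝ)| ≤ spinLam n * (C1 * (x : ℝ) ^ (1 / 1000 : ℝ)) := by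
      intro n hn
      rw [mem_filter, mem_Ioc] at hn
      rw [abs_mul, abs_of_nonneg (spinLam_nonneg n)]
      refine mul_le_mul_of_nonneg_left ?_ (spinLam_nonneg n)
      refine (spinA_abs_le n).trans ((H1 n).trans ?_)
      have : (n : ℝ) ≤ x := by exact_mod_cast hn.1.2
      gcongr
    refine (Finset.sum_le_sum h3).trans ?_
    rw [← Finset.sum_mul]
    have h4 := Chebyshev.psi_sub_theta_eq_sum_not_prime (x : ℝ)
    rw [Nat.floor_natCast] at h4
    have h5 := Chebyshev.psi_sub_theta_le hR
    rw [h4] at h5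
    have h6 : ∑ n ∈ Ioc 0 x with ¬ n.Prime, spinLam n ≤ 2 * √(x : ℝ) * Real.log x := h5
    have h7 : Real.log x ≤ K * (x : ℝ) ^ (1 / 10000 : ℝ) := by have := HL x hR; linarith
    calc _ ≤ (2 * √(x : ℝ) * (K * (x : ℝ) ^ (1 / 10000 : ℝ))) * (C1 * (x : ℝ) ^ (1 / 1000 : ℝ)) := by
          refine mul_le_mul_of_nonneg_right (h6.trans ?_) (by positivity)
          gcongr
      _ = C1 * (2 * K) * (x : ℝ) ^ (1 / 2 + 1 / 10000 + 1 / 1000 : ℝ) := by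
          rw [Real.sqrt_eq_rpow, Real.rpow_add hR0 (1 / 2 + 1 / 10000), Real.rpow_add hR0 (1 / 2)]; ring
      _ ≤ _ := by
          have := spin_rpow_le hR (by norm_num : (1 / 2 + 1 / 10000 + 1 / 1000 : ℝ) ≤ 149 / 150)
          gcongr
  refine (abs_sub _ _).trans ?_
  rw [add_mul]
  exact add_le_add h1 h2

lemma spin_prime_A : ∃ C : ℝ, 1 ≤ C ∧ ∀ x : ℕ, 2 ≤ x →
    |∑ n ∈ Ioc 0 x, if n.Prime then ((spinA n : ℤ) : ℝ) else 0| ≤ C * (x : ℝ) ^ (149 / 150 : ℝ) := by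
  obtain ⟨C, hC, H⟩ := spin_prime_log
  refine ⟨C * 2, by linarith, fun x hx => ?_⟩
  let g : ℕ → ℝ := fun n => 1 / Real.log (max n 2 : ℕ)
  have hpos : ∀ n : ℕ, 0 < Real.log (max n 2 : ℕ) := fun n =>
    Real.log_pos (by exact_mod_cast (by omega : 1 < max n 2))
  have hg : Antitone g := by
    intro a b hab
    apply one_div_le_one_div_of_le (hpos a)
    apply Real.log_le_log
    · exact_mod_cast (by omega : 0 < max a 2)
    · exact_mod_cast (by omega : max a 2 ≤ max b 2)
  have h := spin_abel_anti g spinLp hg (fun n => (one_div_pos.2 (hpos n)).le) (C * (x : ℝ) ^ (149 / 150 : ℝ)) x (by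
    intro j hj
    rcases Nat.lt_or_ge j 2 with h2 | h2
    · have : ∑ k ∈ Ioc 0 j, spinLp k = 0 := by
        apply Finset.sum_eq_zero
        intro k hk
        rw [mem_Ioc] at hk
        have : k = 1 := by omega
        subst this
        simp [spinLp]
      rw [this, abs_zero]; positivity
    · refine (H j h2).trans ?_
      have : (j : ℝ) ≤ x := by exact_mod_cast hj
      gcongr)
  have e : ∑ k ∈ Ioc 0 x, g k * spinLp k = ∑ n ∈ Ioc 0 x, if n.Prime then ((spinA n : ℤ) : ℝ) else 0 := by
    refine sum_congr rfl fun n _ => ?_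
    unfold spinLp
    split_ifs with hn
    · have h2 := hn.two_le
      have h3 : g n = 1 / Real.log n := by
        show 1 / Real.log (max n 2 : ℕ) = _
        rw [max_eq_left h2]
      have h4 : 0 < Real.log n := Real.log_pos (by exact_mod_cast h2)
      rw [h3]; field_simp
    · simp
  rw [e] at h
  refine h.trans ?_
  have h5 : g 0 ≤ 2 := by
    show 1 / Real.log (max 0 2 : ℕ) ≤ 2
    have h6 : Real.log (max 0 2 : ℕ) = Real.log 2 := by norm_num
    rw [h6]
    have := Real.log_two_gt_d9
    rw [div_le_iff₀ (by linarith)]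
    linarith
  calc _ ≤ C * (x : ℝ) ^ (149 / 150 : ℝ) * 2 := by gcongr
    _ = _ := by ring
end

open Finset

theorem spin_sum_bound
    (f : ℕ → ℤ)
    (hf : ∀ p : ℕ, p.Prime → p % 16 = 15 →
      ∀ u v : ℕ, 0 < u → 0 < v → (p : ℤ) = u ^ 2 - 2 * v ^ 2 →
        f p = jacobiSym (2 * u) v) :
    ∀ ε : ℝ, 0 < ε → ∃ C : ℝ, 0 < C ∧ ∀ X : ℝ, 2 ≤ X →
      |((∑ p ∈ Finset.filter (fun p => p.Prime ∧ p % 16 = 15)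
          (Finset.range (⌊X⌋₊ + 1)), f p : ℤ) : ℝ)| ≤
        C * X ^ ((149 : ℝ) / 150 + ε) := by
  intro ε hε
  obtain ⟨C, hC, H⟩ := spin_prime_A
  refine ⟨C, by linarith, fun X hX => ?_⟩
  have hx2 : 2 ≤ ⌊X⌋₊ := Nat.le_floor (by exact_mod_cast hX)
  have hxX : ((⌊X⌋₊ : ℕ) : ℝ) ≤ X := Nat.floor_le (by linarith)
  set x := ⌊X⌋₊ with hxdef
  have hA : ∀ p : ℕ, p.Prime → p % 16 = 15 → spinA p = 2 * f p := by
    intro p hp h16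
    unfold spinA
    rw [if_pos h16]
    have : ∀ W ∈ spinDS p, spinS W = f p := by
      intro W hW
      rw [mem_spinDS] at hW
      have h3 := spin_odd_of_norm (w := W) (by rw [hW.2]; omega)
      have h4 : 0 < W.im := by have := hW.1.2.1; omega
      have h5 : 0 < W.re := hW.1.1
      have hre : ((W.re.toNat : ℕ) : ℤ) = W.re := Int.toNat_of_nonneg h5.le
      have him : ((W.im.toNat : ℕ) : ℤ) = W.im := Int.toNat_of_nonneg h4.le
      rw [hf p hp h16 W.re.toNat W.im.toNat (by omega) (by omega) (by
        rw [hre, him, ← spin_norm, hW.2])]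
      unfold spinS
      rw [hre]
    rw [Finset.sum_congr rfl this, Finset.sum_const, spinDS_prime p hp h16]
    simp
  have h := H x hx2
  have e : ∑ n ∈ Ioc 0 x, (if n.Prime then ((spinA n : ℤ) : ℝ) else 0) =
      2 * ((∑ p ∈ Finset.filter (fun p => p.Prime ∧ p % 16 = 15) (Finset.range (x + 1)), f p : ℤ) : ℝ) := by
    rw [Finset.sum_filter]
    push_cast
    rw [Finset.mul_sum]
    have hs : Ioc 0 x ⊆ range (x + 1) := by
      intro n; simp only [mem_Ioc, mem_range]; omega
    rw [Finset.sum_subset hs (fun n h1 h2 => by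
      simp only [mem_Ioc, mem_range] at h1 h2
      have : n = 0 := by omega
      subst this; simp [Nat.not_prime_zero])]
    refine sum_congr rfl fun n _ => ?_
    by_cases hn : n.Prime
    · by_cases h16 : n % 16 = 15
      · rw [if_pos hn, if_pos ⟨hn, h16⟩, hA n hn h16]; push_cast; ring
      · rw [if_pos hn, if_neg (fun h => h16 h.2)]
        unfold spinA
        rw [if_neg h16]; simp
    · rw [if_neg hn, if_neg (fun h => hn h.1)]; simp
  rw [e, abs_mul, abs_of_pos (by norm_num : (0 : ℝ) < 2)] at h
  have h9 : C * (x : ℝ) ^ (149 / 150 : ℝ) ≤ C * X ^ ((149 : ℝ) / 150 + ε) := by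
    refine mul_le_mul_of_nonneg_left ?_ (by linarith)
    calc (x : ℝ) ^ (149 / 150 : ℝ) ≤ X ^ (149 / 150 : ℝ) := by
          apply Real.rpow_le_rpow (by positivity) hxX (by norm_num)
      _ ≤ _ := spin_rpow_le (by linarith) (by linarith)
  have := abs_nonneg ((∑ p ∈ Finset.filter (fun p => p.Prime ∧ p % 16 = 15) (Finset.range (x + 1)), f p : ℤ) : ℝ)
  linarith
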